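/- (Main decay estimate, Theorem 1.3.) For every q ∈ (0,2) and every positive integer m there exist δ₁ > 0 and C > 0 (depending only on n, m, q) such that the following holds. Let T ≥ 1 and let f : [0,T]×S¹ → ℝⁿ be a conformal Willmore immersion whose conformal factor is e^{2u} with u(t,θ) = −mt + v(t,θ). Assume: (a) τ₁(f,c)(t) = 0 and τ₂(f,S)(t) = 0 for every t ∈ [0,T], every c ∈ ℝⁿ and every n×n real skew-symmetric matrix S; (b) sup_{[0,T]×S¹} |∇v| < δ₁; (c) δ̃ := sup_{t ∈ [0,T−1]} ∫_{[t,t+1]×S¹} |A|² dV_g < δ₁. Then for all t ∈ [0,T−1], ∫_{[t,t+1]×S¹} |A|² dV_g ≤ C δ̃ (e^{−qt} + e^{−q(T−t)}). -/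

import Mathlib

noncomputable section

open Real MeasureTheory Set Filter
open scoped InnerProductSpace

/-- Partial derivative in the first variable. -/
def pt {F : Type*} [NormedAddCommGroup F] [NormedSpace ℝ F] (f : ℝ → ℝ → F) (t θ : ℝ) : F :=
  deriv (fun s => f s θ) t

/-- Partial derivative in the second variable. -/
def pth {F : Type*} [NormedAddCommGroup F] [NormedSpace ℝ F] (f : ℝ → ℝ → F) (t θ : ℝ) : F :=
  deriv (fun s => f t s) θ

variable {n : ℕ}

/-- Mean curvature vector `H = e^{-2u}(∂_t² f + ∂_θ² f)`. -/
def Hmc (f : ℝ → ℝ → EuclideanSpace ℝ (Fin n)) (u : ℝ → ℝ → ℝ) :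
    ℝ → ℝ → EuclideanSpace ℝ (Fin n) :=
  fun t θ => Real.exp (-(2 * u t θ)) • (pt (pt f) t θ + pth (pth f) t θ)

/-- Component `A_tt` of the second fundamental form. -/
def Att (f : ℝ → ℝ → EuclideanSpace ℝ (Fin n)) (u : ℝ → ℝ → ℝ) :
    ℝ → ℝ → EuclideanSpace ℝ (Fin n) :=
  fun t θ => pt (pt f) t θ - pt u t θ • pt f t θ + pth u t θ • pth f t θ

/-- Component `A_tθ` of the second fundamental form. -/
def Atth (f : ℝ → ℝ → EuclideanSpace ℝ (Fin n)) (u : ℝ → ℝ → ℝ) :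
    ℝ → ℝ → EuclideanSpace ℝ (Fin n) :=
  fun t θ => pt (pth f) t θ - pth u t θ • pt f t θ - pt u t θ • pth f t θ

/-- Component `A_θθ` of the second fundamental form. -/
def Athth (f : ℝ → ℝ → EuclideanSpace ℝ (Fin n)) (u : ℝ → ℝ → ℝ) :
    ℝ → ℝ → EuclideanSpace ℝ (Fin n) :=
  fun t θ => pth (pth f) t θ + pt u t θ • pt f t θ - pth u t θ • pth f t θ

/-- `|A|²`, the squared norm of the second fundamental form. -/
def Asq (f : ℝ → ℝ → EuclideanSpace ℝ (Fin n)) (u : ℝ → ℝ → ℝ) : ℝ → ℝ → ℝ :=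
  fun t θ => Real.exp (-(4 * u t θ)) *
    (‖Att f u t θ‖ ^ 2 + 2 * ‖Atth f u t θ‖ ^ 2 + ‖Athth f u t θ‖ ^ 2)

/-- The left-hand side of the Willmore equation in conformal coordinates. -/
def willmoreOp (f : ℝ → ℝ → EuclideanSpace ℝ (Fin n)) (u : ℝ → ℝ → ℝ) :
    ℝ → ℝ → EuclideanSpace ℝ (Fin n) :=
  fun t θ =>
    (2 : ℝ) • (pt (pt (Hmc f u)) t θ + pth (pth (Hmc f u)) t θ)
    + (4 : ℝ) • pt (fun a b => Real.exp (-(2 * u a b)) •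
        (⟪Hmc f u a b, Att f u a b⟫_ℝ • pt f a b + ⟪Hmc f u a b, Atth f u a b⟫_ℝ • pth f a b)) t θ
    + (4 : ℝ) • pth (fun a b => Real.exp (-(2 * u a b)) •
        (⟪Hmc f u a b, Atth f u a b⟫_ℝ • pt f a b + ⟪Hmc f u a b, Athth f u a b⟫_ℝ • pth f a b)) t θ
    - pt (fun a b => ‖Hmc f u a b‖ ^ 2 • pt f a b) t θ
    - pth (fun a b => ‖Hmc f u a b‖ ^ 2 • pth f a b) t θ

/-- A conformal immersion of a cylinder `s × S¹` (in the `t` variable),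
with conformal factor `e^{2u}`; maps are `2π`-periodic in the second variable. -/
structure ConfImm (f : ℝ → ℝ → EuclideanSpace ℝ (Fin n)) (u : ℝ → ℝ → ℝ) (s : Set ℝ) :
    Prop where
  smooth_f : ContDiff ℝ (⊤ : ℕ∞) (fun p : ℝ × ℝ => f p.1 p.2)
  smooth_u : ContDiff ℝ (⊤ : ℕ∞) (fun p : ℝ × ℝ => u p.1 p.2)
  periodic_f : ∀ t θ, f t (θ + 2 * π) = f t θ
  periodic_u : ∀ t θ, u t (θ + 2 * π) = u t θ
  conf_t : ∀ t ∈ s, ∀ θ : ℝ, ‖pt f t θ‖ ^ 2 = Real.exp (2 * u t θ)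
  conf_th : ∀ t ∈ s, ∀ θ : ℝ, ‖pth f t θ‖ ^ 2 = Real.exp (2 * u t θ)
  conf_orth : ∀ t ∈ s, ∀ θ : ℝ, ⟪pt f t θ, pth f t θ⟫_ℝ = 0

/-- A conformal Willmore immersion of a cylinder. -/
structure ConfWillmore (f : ℝ → ℝ → EuclideanSpace ℝ (Fin n)) (u : ℝ → ℝ → ℝ) (s : Set ℝ)
    extends ConfImm f u s : Prop where
  willmore : ∀ t ∈ s, ∀ θ : ℝ, willmoreOp f u t θ = 0

/-- The first residue `τ₁(f,c)(t)`. -/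
def tau1 (f : ℝ → ℝ → EuclideanSpace ℝ (Fin n)) (u : ℝ → ℝ → ℝ)
    (c : EuclideanSpace ℝ (Fin n)) (t : ℝ) : ℝ :=
  ⟪(-2 : ℝ) • (∫ θ in (0 : ℝ)..(2 * π), pt (Hmc f u) t θ)
    - (4 : ℝ) • (∫ θ in (0 : ℝ)..(2 * π), Real.exp (-(2 * u t θ)) •
        (⟪Hmc f u t θ, Att f u t θ⟫_ℝ • pt f t θ + ⟪Hmc f u t θ, Atth f u t θ⟫_ℝ • pth f t θ))
    + ∫ θ in (0 : ℝ)..(2 * π), ‖Hmc f u t θ‖ ^ 2 • pt f t θ, c⟫_ℝ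

/-- The second residue `τ₂(f,S)(t)`, for a matrix `S`. -/
def tau2 (f : ℝ → ℝ → EuclideanSpace ℝ (Fin n)) (u : ℝ → ℝ → ℝ)
    (S : Matrix (Fin n) (Fin n) ℝ) (t : ℝ) : ℝ :=
  2 * (∫ θ in (0 : ℝ)..(2 * π),
        (⟪Hmc f u t θ, pt (fun a b => (Matrix.toEuclideanLin S) (f a b)) t θ⟫_ℝ
          - ⟪pt (Hmc f u) t θ, (Matrix.toEuclideanLin S) (f t θ)⟫_ℝ))
  - 4 * (∫ θ in (0 : ℝ)..(2 * π), Real.exp (-(2 * u t θ)) *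
        (⟪Hmc f u t θ, Att f u t θ⟫_ℝ * ⟪pt f t θ, (Matrix.toEuclideanLin S) (f t θ)⟫_ℝ
          + ⟪Hmc f u t θ, Atth f u t θ⟫_ℝ * ⟪pth f t θ, (Matrix.toEuclideanLin S) (f t θ)⟫_ℝ))
  + ∫ θ in (0 : ℝ)..(2 * π), ‖Hmc f u t θ‖ ^ 2 * ⟪pt f t θ, (Matrix.toEuclideanLin S) (f t θ)⟫_ℝ

/-- Pointwise norm of the gradient of a scalar function on the cylinder. -/
def gradNorm (u : ℝ → ℝ → ℝ) (t θ : ℝ) : ℝ :=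
  Real.sqrt ((pt u t θ) ^ 2 + (pth u t θ) ^ 2)

/-- Integral of a density over the piece `[a,b] × S¹` of the cylinder. -/
def cylInt (F : ℝ → ℝ → ℝ) (a b : ℝ) : ℝ :=
  ∫ p in Set.Icc a b ×ˢ Set.Icc (0 : ℝ) (2 * π), F p.1 p.2

/-- The density `|A|² dV_g` (with respect to `dt dθ`). -/
def Adens (f : ℝ → ℝ → EuclideanSpace ℝ (Fin n)) (u : ℝ → ℝ → ℝ) : ℝ → ℝ → ℝ :=
  fun t θ => Asq f u t θ * Real.exp (2 * u t θ)

/-- The density `|H|² dV_g` (with respect to `dt dθ`). -/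
def Hdens (f : ℝ → ℝ → EuclideanSpace ℝ (Fin n)) (u : ℝ → ℝ → ℝ) : ℝ → ℝ → ℝ :=
  fun t θ => ‖Hmc f u t θ‖ ^ 2 * Real.exp (2 * u t θ)

section Calculus

variable {V W : Type*} [NormedAddCommGroup V] [NormedSpace ℝ V]
  [NormedAddCommGroup W] [NormedSpace ℝ W]

/-- Smoothness of a function of two real variables in curried form. -/
def Smooth2 (F : ℝ → ℝ → V) : Prop :=
  ContDiff ℝ (⊤ : ℕ∞) (fun p : ℝ × ℝ => F p.1 p.2)

namespace Smooth2

variable {F G : ℝ → ℝ → V}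

lemma continuous (hF : Smooth2 F) : Continuous (fun p : ℝ × ℝ => F p.1 p.2) :=
  ContDiff.continuous hF

lemma continuous_snd (hF : Smooth2 F) (t : ℝ) : Continuous (F t) :=
  hF.continuous.comp (by fun_prop : Continuous fun θ : ℝ => (t, θ))

lemma continuous_fst (hF : Smooth2 F) (θ : ℝ) : Continuous (fun t => F t θ) :=
  hF.continuous.comp (by fun_prop : Continuous fun t : ℝ => (t, θ))

lemma dt (hF : Smooth2 F) (t θ : ℝ) : HasDerivAt (fun s => F s θ) (pt F t θ) t := by
  have h : DifferentiableAt ℝ (fun s => F s θ) t := by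
    have := (ContDiff.differentiable hF (by simp)).comp
      (by fun_prop : Differentiable ℝ fun s : ℝ => (s, θ))
    exact this t
  exact h.hasDerivAt

lemma dth (hF : Smooth2 F) (t θ : ℝ) : HasDerivAt (F t) (pth F t θ) θ := by
  have h : DifferentiableAt ℝ (F t) θ := by
    have := (ContDiff.differentiable hF (by simp)).comp
      (by fun_prop : Differentiable ℝ fun s : ℝ => (t, s))
    exact this θ
  exact h.hasDerivAt

lemma pt_eq_fderiv (hF : Smooth2 F) (t θ : ℝ) :
    pt F t θ = fderiv ℝ (fun p : ℝ × ℝ => F p.1 p.2) (t, θ) (1, 0) := by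
  have h1 := (ContDiff.differentiable hF (by simp) (t, θ)).hasFDerivAt
  have h2 : HasDerivAt (fun s : ℝ => (s, θ)) ((1 : ℝ), (0 : ℝ)) t :=
    (hasDerivAt_id t).prodMk (hasDerivAt_const t θ)
  exact (HasFDerivAt.comp_hasDerivAt (f := fun s : ℝ => (s, θ)) t h1 h2).deriv

lemma pth_eq_fderiv (hF : Smooth2 F) (t θ : ℝ) :
    pth F t θ = fderiv ℝ (fun p : ℝ × ℝ => F p.1 p.2) (t, θ) (0, 1) := by
  have h1 := (ContDiff.differentiable hF (by simp) (t, θ)).hasFDerivAt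
  have h2 : HasDerivAt (fun s : ℝ => (t, s)) ((0 : ℝ), (1 : ℝ)) θ :=
    (hasDerivAt_const θ t).prodMk (hasDerivAt_id θ)
  exact (HasFDerivAt.comp_hasDerivAt (f := fun s : ℝ => (t, s)) θ h1 h2).deriv

lemma pt (hF : Smooth2 F) : Smooth2 (pt F) := by
  have h : ContDiff ℝ (⊤ : ℕ∞) (fderiv ℝ (fun p : ℝ × ℝ => F p.1 p.2)) :=
    ContDiff.fderiv_right hF (by simp)
  have h2 : ContDiff ℝ (⊤ : ℕ∞)
      (fun p => fderiv ℝ (fun p : ℝ × ℝ => F p.1 p.2) p ((1 : ℝ), (0 : ℝ))) :=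
    h.clm_apply contDiff_const
  unfold Smooth2
  convert h2 using 2 with p
  exact hF.pt_eq_fderiv p.1 p.2

lemma pth (hF : Smooth2 F) : Smooth2 (pth F) := by
  have h : ContDiff ℝ (⊤ : ℕ∞) (fderiv ℝ (fun p : ℝ × ℝ => F p.1 p.2)) :=
    ContDiff.fderiv_right hF (by simp)
  have h2 : ContDiff ℝ (⊤ : ℕ∞)
      (fun p => fderiv ℝ (fun p : ℝ × ℝ => F p.1 p.2) p ((0 : ℝ), (1 : ℝ))) :=
    h.clm_apply contDiff_const
  unfold Smooth2
  convert h2 using 2 with p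
  exact hF.pth_eq_fderiv p.1 p.2

lemma pth_pt (hF : Smooth2 F) (t θ : ℝ) : _root_.pth (_root_.pt F) t θ = _root_.pt (_root_.pth F) t θ := by
  set U : ℝ × ℝ → V := fun p => F p.1 p.2 with hU
  have h : ContDiff ℝ (⊤ : ℕ∞) (fderiv ℝ U) := ContDiff.fderiv_right hF (by simp)
  have hd := (h.differentiable (by simp) (t, θ)).hasFDerivAt
  have hsym : IsSymmSndFDerivAt ℝ U (t, θ) :=
    (ContDiff.contDiffAt hF).isSymmSndFDerivAt
      (by rw [minSmoothness_of_isRCLikeNormedField]; exact WithTop.coe_le_coe.2 (le_top : ((2:ℕ∞)) ≤ ⊤))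
  have e1 : _root_.pt F = fun a b => fderiv ℝ U (a, b) (1, 0) := by
    ext1 a; ext1 b; exact hF.pt_eq_fderiv a b
  have e2 : _root_.pth F = fun a b => fderiv ℝ U (a, b) (0, 1) := by
    ext1 a; ext1 b; exact hF.pth_eq_fderiv a b
  have h2 : HasDerivAt (fun s : ℝ => (t, s)) ((0 : ℝ), (1 : ℝ)) θ :=
    (hasDerivAt_const θ t).prodMk (hasDerivAt_id θ)
  have h3 : HasDerivAt (fun s : ℝ => (s, θ)) ((1 : ℝ), (0 : ℝ)) t :=
    (hasDerivAt_id t).prodMk (hasDerivAt_const t θ)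
  have k1 := (HasFDerivAt.comp_hasDerivAt (f := fun s : ℝ => (t, s)) θ hd h2).clm_apply
    (hasDerivAt_const θ ((1 : ℝ), (0 : ℝ)))
  have k2 := (HasFDerivAt.comp_hasDerivAt (f := fun s : ℝ => (s, θ)) t hd h3).clm_apply
    (hasDerivAt_const t ((0 : ℝ), (1 : ℝ)))
  have j1 : _root_.pth (_root_.pt F) t θ = fderiv ℝ (fderiv ℝ U) (t, θ) (0, 1) (1, 0) := by
    rw [e1]; simpa [_root_.pth] using k1.deriv
  have j2 : _root_.pt (_root_.pth F) t θ = fderiv ℝ (fderiv ℝ U) (t, θ) (1, 0) (0, 1) := by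
    rw [e2]; simpa [_root_.pt] using k2.deriv
  rw [j1, j2]
  exact hsym _ _

lemma add (hF : Smooth2 F) (hG : Smooth2 G) : Smooth2 (fun t θ => F t θ + G t θ) :=
  ContDiff.add hF hG

lemma sub (hF : Smooth2 F) (hG : Smooth2 G) : Smooth2 (fun t θ => F t θ - G t θ) :=
  ContDiff.sub hF hG

lemma neg (hF : Smooth2 F) : Smooth2 (fun t θ => -F t θ) :=
  ContDiff.neg hF

lemma smul {c : ℝ → ℝ → ℝ} (hc : Smooth2 c) (hF : Smooth2 F) :
    Smooth2 (fun t θ => c t θ • F t θ) :=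
  ContDiff.smul hc hF

lemma mul {c d : ℝ → ℝ → ℝ} (hc : Smooth2 c) (hd : Smooth2 d) :
    Smooth2 (fun t θ => c t θ * d t θ) :=
  ContDiff.mul hc hd

lemma const (c : V) : Smooth2 (fun _ _ => c) := contDiff_const

lemma of_fst {c : ℝ → V} (hc : ContDiff ℝ (⊤ : ℕ∞) c) : Smooth2 (fun t _ => c t) :=
  hc.comp contDiff_fst

lemma of_snd {c : ℝ → V} (hc : ContDiff ℝ (⊤ : ℕ∞) c) : Smooth2 (fun _ θ => c θ) :=
  hc.comp contDiff_snd

lemma exp {c : ℝ → ℝ → ℝ} (hc : Smooth2 c) : Smooth2 (fun t θ => Real.exp (c t θ)) :=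
  ContDiff.exp hc

lemma clm (hF : Smooth2 F) (L : V →L[ℝ] W) : Smooth2 (fun t θ => L (F t θ)) :=
  L.contDiff.comp hF

lemma pow {c : ℝ → ℝ → ℝ} (hc : Smooth2 c) (k : ℕ) : Smooth2 (fun t θ => c t θ ^ k) :=
  ContDiff.pow hc k

end Smooth2

lemma Smooth2.inner {V : Type*} [NormedAddCommGroup V] [InnerProductSpace ℝ V]
    {F G : ℝ → ℝ → V} (hF : Smooth2 F) (hG : Smooth2 G) :
    Smooth2 (fun t θ => ⟪F t θ, G t θ⟫_ℝ) :=
  ContDiff.inner ℝ hF hG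

lemma Smooth2.norm_sq {V : Type*} [NormedAddCommGroup V] [InnerProductSpace ℝ V]
    {F : ℝ → ℝ → V} (hF : Smooth2 F) : Smooth2 (fun t θ => ‖F t θ‖ ^ 2) :=
  ContDiff.norm_sq ℝ hF

/-- `2π`-periodicity in the second variable. -/
def Periodic2 {V : Type*} (F : ℝ → ℝ → V) : Prop := ∀ t θ, F t (θ + 2 * π) = F t θ

lemma Periodic2.pt {F : ℝ → ℝ → V} (hF : Periodic2 F) : Periodic2 (pt F) := by
  intro t θ
  unfold _root_.pt
  simp only [hF _ θ]

lemma Periodic2.pth {F : ℝ → ℝ → V} (hF : Periodic2 F) : Periodic2 (pth F) := by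
  intro t θ
  unfold _root_.pth
  rw [← deriv_comp_add_const]
  congr 1
  ext s
  exact hF t s

/-- Integral over the circle `{t} × S¹`. -/
def circInt (F : ℝ → ℝ → V) (t : ℝ) : V := ∫ θ in (0 : ℝ)..(2 * π), F t θ

lemma circInt_continuous {F : ℝ → ℝ → V} (hF : Continuous (fun p : ℝ × ℝ => F p.1 p.2)) :
    Continuous (circInt F) :=
  intervalIntegral.continuous_parametric_intervalIntegral_of_continuous' (f := F) hF _ _

lemma circInt_hasDerivAt [CompleteSpace V] {F : ℝ → ℝ → V} (hF : Smooth2 F) (t : ℝ) :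
    HasDerivAt (circInt F) (circInt (pt F) t) t := by
  obtain ⟨M, hM⟩ := (isCompact_Icc.prod isCompact_Icc : IsCompact
    (Icc (t - 1) (t + 1) ×ˢ Icc (0 : ℝ) (2 * π))).exists_bound_of_continuousOn
    hF.pt.continuous.continuousOn
  refine (intervalIntegral.hasDerivAt_integral_of_dominated_loc_of_deriv_le (F := F)
    (F' := pt F) (bound := fun _ => M)
    (Icc_mem_nhds (by linarith : t - 1 < t) (by linarith : t < t + 1)) ?_ ?_ ?_ ?_ ?_ ?_).2
  · exact Eventually.of_forall fun x => (hF.continuous_snd x).aestronglyMeasurable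
  · exact (hF.continuous_snd t).intervalIntegrable _ _
  · exact (hF.pt.continuous_snd t).aestronglyMeasurable
  · refine Eventually.of_forall fun θ hθ x hx => hM (x, θ) ⟨hx, ?_⟩
    rw [uIoc_of_le (by positivity)] at hθ
    exact Ioc_subset_Icc_self hθ
  · simp
  · exact Eventually.of_forall fun θ _ x _ => hF.dt x θ

lemma circInt_pth_eq_zero [CompleteSpace V] {F : ℝ → ℝ → V} (hF : Smooth2 F)
    (hp : Periodic2 F) (t : ℝ) : circInt (pth F) t = 0 := by
  unfold circInt
  rw [intervalIntegral.integral_eq_sub_of_hasDerivAt (fun θ _ => hF.dth t θ)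
    ((hF.pth.continuous_snd t).intervalIntegrable _ _)]
  have := hp t 0
  rw [zero_add] at this
  rw [this, sub_self]

/-- Two-dimensional divergence theorem on a piece of the cylinder, with vanishing flux at the
two ends. -/
lemma integral_div_nonpos {U K G : ℝ → ℝ → ℝ} {a b : ℝ} (hab : a ≤ b) (hU : Smooth2 U)
    (hK : Smooth2 K) (hKp : Periodic2 K) (ha : ∀ θ, U a θ = 0) (hb : ∀ θ, U b θ = 0)
    (hG : Continuous (fun p : ℝ × ℝ => G p.1 p.2))
    (h : ∀ t ∈ Icc a b, ∀ θ, G t θ ≤ pt U t θ + pth K t θ) :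
    ∫ t in a..b, circInt G t ≤ 0 := by
  have h1 : ∫ t in a..b, circInt (pt U) t = 0 := by
    rw [intervalIntegral.integral_eq_sub_of_hasDerivAt (fun t _ => circInt_hasDerivAt hU t)
      ((circInt_continuous hU.pt.continuous).intervalIntegrable _ _)]
    simp [circInt, ha, hb]
  rw [← h1]
  refine intervalIntegral.integral_mono_on hab ((circInt_continuous hG).intervalIntegrable _ _)
    ((circInt_continuous hU.pt.continuous).intervalIntegrable _ _) fun t ht => ?_
  have h2 : circInt (pt U) t = circInt (fun t θ => pt U t θ + pth K t θ) t := by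
    have := circInt_pth_eq_zero hK hKp t
    unfold circInt at *
    rw [intervalIntegral.integral_add ((hU.pt.continuous_snd t).intervalIntegrable _ _)
      ((hK.pth.continuous_snd t).intervalIntegrable _ _), this, add_zero]
  rw [h2]
  refine intervalIntegral.integral_mono_on (by positivity) ?_ ?_ fun θ _ => h t ht θ
  · exact (hG.comp (by fun_prop : Continuous fun θ : ℝ => (t, θ))).intervalIntegrable _ _
  · exact ((hU.pt.continuous_snd t).add (hK.pth.continuous_snd t)).intervalIntegrable _ _

end Calculus

section Cutoff

/-- Smooth cutoff functions with uniformly bounded derivative. -/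
lemma exists_cutoff : ∃ K : ℝ, 1 ≤ K ∧ ∀ a b : ℝ, a + 2 ≤ b → ∃ η : ℝ → ℝ,
    ContDiff ℝ (⊤ : ℕ∞) η ∧ (∀ t, 0 ≤ η t) ∧ (∀ t, η t ≤ 1) ∧ η a = 0 ∧ η b = 0 ∧
    (∀ t ∈ Icc (a + 1) (b - 1), η t = 1 ∧ deriv η t = 0) ∧ ∀ t, |deriv η t| ≤ K := by
  have hc : ContDiff ℝ (⊤ : ℕ∞) smoothTransition := smoothTransition.contDiff
  have hd : Continuous (deriv smoothTransition) := hc.continuous_deriv (by simp)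
  obtain ⟨M, hM⟩ := (isCompact_Icc (a := (0 : ℝ)) (b := 1)).exists_bound_of_continuousOn
    hd.continuousOn
  have hmax : ∀ x, 1 ≤ x → deriv smoothTransition x = 0 := fun x hx =>
    IsLocalMax.deriv_eq_zero (Eventually.of_forall fun y => by
      rw [smoothTransition.one_of_one_le hx]; exact smoothTransition.le_one y)
  have hmin : ∀ x, x ≤ 0 → deriv smoothTransition x = 0 := fun x hx =>
    IsLocalMin.deriv_eq_zero (Eventually.of_forall fun y => by
      rw [smoothTransition.zero_of_nonpos hx]; exact smoothTransition.nonneg y)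
  have hbd : ∀ x, |deriv smoothTransition x| ≤ max M 1 := by
    intro x
    rcases le_total x 0 with h | h
    · rw [hmin x h, abs_zero]; positivity
    rcases le_total 1 x with h' | h'
    · rw [hmax x h', abs_zero]; positivity
    exact (hM x ⟨h, h'⟩).trans (le_max_left _ _)
  refine ⟨2 * max M 1, by linarith [le_max_right M 1], fun a b hab => ?_⟩
  have h1 : ContDiff ℝ (⊤ : ℕ∞) fun t : ℝ => smoothTransition (t - a) :=
    hc.comp (by fun_prop)
  have h2 : ContDiff ℝ (⊤ : ℕ∞) fun t : ℝ => smoothTransition (b - t) :=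
    hc.comp (by fun_prop)
  have hnn : ∀ t, 0 ≤ smoothTransition (t - a) * smoothTransition (b - t) := fun t =>
    mul_nonneg (smoothTransition.nonneg _) (smoothTransition.nonneg _)
  have hle : ∀ t, smoothTransition (t - a) * smoothTransition (b - t) ≤ 1 := fun t =>
    mul_le_one₀ (smoothTransition.le_one _) (smoothTransition.nonneg _)
      (smoothTransition.le_one _)
  refine ⟨fun t => smoothTransition (t - a) * smoothTransition (b - t), h1.mul h2, hnn, hle,
    by simp, by simp, fun t ht => ?_, fun t => ?_⟩
  · have h : smoothTransition (t - a) * smoothTransition (b - t) = 1 := by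
      rw [smoothTransition.one_of_one_le (by linarith [ht.1]),
        smoothTransition.one_of_one_le (by linarith [ht.2]), one_mul]
    exact ⟨h, IsLocalMax.deriv_eq_zero (Eventually.of_forall fun y => by
      show _ ≤ smoothTransition (t - a) * smoothTransition (b - t)
      rw [h]; exact hle y)⟩
  · have d1 : HasDerivAt (fun t : ℝ => smoothTransition (t - a))
        (deriv smoothTransition (t - a)) t := by
      simpa using HasDerivAt.comp_sub_const t a (hc.differentiable (by simp) (t - a)).hasDerivAt
    have d2 : HasDerivAt (fun t : ℝ => smoothTransition (b - t))
        (-deriv smoothTransition (b - t)) t := by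
      simpa using HasDerivAt.comp_const_sub b t (hc.differentiable (by simp) (b - t)).hasDerivAt
    have d3 := (d1.mul d2).deriv
    rw [show (fun t : ℝ => smoothTransition (t - a) * smoothTransition (b - t)) =
      (fun t : ℝ => smoothTransition (t - a)) * fun t : ℝ => smoothTransition (b - t) from rfl, d3]
    refine (abs_add_le _ _).trans ?_
    rw [abs_mul, abs_mul, abs_neg, abs_of_nonneg (smoothTransition.nonneg (b - t)),
      abs_of_nonneg (smoothTransition.nonneg (t - a))]
    have e1 := mul_le_mul (hbd (t - a)) (smoothTransition.le_one (b - t))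
      (smoothTransition.nonneg _) (by positivity)
    have e2 := mul_le_mul (smoothTransition.le_one (t - a)) (hbd (b - t)) (abs_nonneg _)
      zero_le_one
    linarith

end Cutoff

section CircInt

variable {V : Type*} [NormedAddCommGroup V] [NormedSpace ℝ V]

/-- Continuity on the cylinder of a function in curried form. -/
def Cont2 {X : Type*} [TopologicalSpace X] (F : ℝ → ℝ → X) : Prop :=
  Continuous (fun p : ℝ × ℝ => F p.1 p.2)

lemma Smooth2.cont {F : ℝ → ℝ → V} (hF : Smooth2 F) : Cont2 F := hF.continuous

lemma Cont2.snd {X : Type*} [TopologicalSpace X] {F : ℝ → ℝ → X} (hF : Cont2 F) (t : ℝ) :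
    Continuous (F t) :=
  Continuous.comp (g := fun p : ℝ × ℝ => F p.1 p.2) hF
    (by fun_prop : Continuous fun θ : ℝ => (t, θ))

lemma Cont2.const {X : Type*} [TopologicalSpace X] (c : X) : Cont2 fun _ _ => c :=
  continuous_const

lemma Cont2.of_fst {X : Type*} [TopologicalSpace X] {c : ℝ → X} (hc : Continuous c) :
    Cont2 fun t _ => c t := hc.comp continuous_fst

lemma Cont2.of_snd {X : Type*} [TopologicalSpace X] {c : ℝ → X} (hc : Continuous c) :
    Cont2 fun _ θ => c θ := hc.comp continuous_snd

lemma Cont2.mul {F G : ℝ → ℝ → ℝ} (hF : Cont2 F) (hG : Cont2 G) :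
    Cont2 fun t θ => F t θ * G t θ :=
  Continuous.mul (f := fun p : ℝ × ℝ => F p.1 p.2) hF hG

lemma Cont2.abs {F : ℝ → ℝ → ℝ} (hF : Cont2 F) : Cont2 fun t θ => |F t θ| :=
  Continuous.abs (f := fun p : ℝ × ℝ => F p.1 p.2) hF

lemma Cont2.exp {F : ℝ → ℝ → ℝ} (hF : Cont2 F) : Cont2 fun t θ => Real.exp (F t θ) :=
  Real.continuous_exp.comp hF

lemma Cont2.pow {F : ℝ → ℝ → ℝ} (hF : Cont2 F) (k : ℕ) : Cont2 fun t θ => F t θ ^ k :=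
  Continuous.pow (f := fun p : ℝ × ℝ => F p.1 p.2) hF k

section
omit [NormedSpace ℝ V]

lemma Cont2.add {F G : ℝ → ℝ → V} (hF : Cont2 F) (hG : Cont2 G) :
    Cont2 fun t θ => F t θ + G t θ :=
  Continuous.add (f := fun p : ℝ × ℝ => F p.1 p.2) hF hG

lemma Cont2.sub {F G : ℝ → ℝ → V} (hF : Cont2 F) (hG : Cont2 G) :
    Cont2 fun t θ => F t θ - G t θ :=
  Continuous.sub (f := fun p : ℝ × ℝ => F p.1 p.2) hF hG

lemma Cont2.neg {F : ℝ → ℝ → V} (hF : Cont2 F) : Cont2 fun t θ => -F t θ :=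
  Continuous.neg (f := fun p : ℝ × ℝ => F p.1 p.2) hF

lemma Cont2.norm {F : ℝ → ℝ → V} (hF : Cont2 F) : Cont2 fun t θ => ‖F t θ‖ :=
  Continuous.norm (f := fun p : ℝ × ℝ => F p.1 p.2) hF

end

lemma Cont2.smul {c : ℝ → ℝ → ℝ} {F : ℝ → ℝ → V} (hc : Cont2 c) (hF : Cont2 F) :
    Cont2 fun t θ => c t θ • F t θ :=
  Continuous.smul (f := fun p : ℝ × ℝ => c p.1 p.2) hc hF

lemma Cont2.inner {V : Type*} [NormedAddCommGroup V] [InnerProductSpace ℝ V]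
    {F G : ℝ → ℝ → V} (hF : Cont2 F) (hG : Cont2 G) : Cont2 fun t θ => ⟪F t θ, G t θ⟫_ℝ :=
  Continuous.inner (f := fun p : ℝ × ℝ => F p.1 p.2) hF hG

omit [NormedSpace ℝ V] in
lemma Cont2.ii {F : ℝ → ℝ → V} (hF : Cont2 F) (t a b : ℝ) :
    IntervalIntegrable (F t) volume a b := (hF.snd t).intervalIntegrable _ _

lemma Cont2.circInt {F : ℝ → ℝ → V} (hF : Cont2 F) : Continuous (circInt F) :=
  circInt_continuous hF

lemma circInt_mono {F G : ℝ → ℝ → ℝ} (hF : Cont2 F) (hG : Cont2 G) {t : ℝ}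
    (h : ∀ θ, F t θ ≤ G t θ) : circInt F t ≤ circInt G t :=
  intervalIntegral.integral_mono (by positivity) (hF.ii _ _ _) (hG.ii _ _ _) h

lemma circInt_nonneg {F : ℝ → ℝ → ℝ} {t : ℝ} (h : ∀ θ, 0 ≤ F t θ) : 0 ≤ circInt F t :=
  intervalIntegral.integral_nonneg (by positivity) fun θ _ => h θ

lemma circInt_add {F G : ℝ → ℝ → V} (hF : Cont2 F) (hG : Cont2 G) (t : ℝ) :
    circInt (fun t θ => F t θ + G t θ) t = circInt F t + circInt G t :=
  intervalIntegral.integral_add (hF.ii _ _ _) (hG.ii _ _ _)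

lemma circInt_sub {F G : ℝ → ℝ → V} (hF : Cont2 F) (hG : Cont2 G) (t : ℝ) :
    circInt (fun t θ => F t θ - G t θ) t = circInt F t - circInt G t :=
  intervalIntegral.integral_sub (hF.ii _ _ _) (hG.ii _ _ _)

lemma circInt_const_mul (c : ℝ) (F : ℝ → ℝ → ℝ) (t : ℝ) :
    circInt (fun t θ => c * F t θ) t = c * circInt F t :=
  intervalIntegral.integral_const_mul _ _

lemma circInt_fst_mul (c : ℝ → ℝ) (F : ℝ → ℝ → ℝ) (t : ℝ) :
    circInt (fun t θ => c t * F t θ) t = c t * circInt F t :=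
  intervalIntegral.integral_const_mul _ _

lemma circInt_smul (c : ℝ) (F : ℝ → ℝ → V) (t : ℝ) :
    circInt (fun t θ => c • F t θ) t = c • circInt F t :=
  intervalIntegral.integral_smul _ _

lemma circInt_congr {F G : ℝ → ℝ → V} {t : ℝ} (h : ∀ θ, F t θ = G t θ) :
    circInt F t = circInt G t := by
  unfold circInt
  congr 1
  ext θ
  exact h θ

lemma norm_circInt_le (F : ℝ → ℝ → V) (t : ℝ) :
    ‖circInt F t‖ ≤ circInt (fun t θ => ‖F t θ‖) t :=
  intervalIntegral.norm_integral_le_integral_norm (by positivity)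

/-- Cauchy-Schwarz on the circle. -/
lemma circInt_sq_le {F : ℝ → ℝ → ℝ} (hF : Cont2 F) (t : ℝ) :
    circInt F t ^ 2 ≤ 2 * π * circInt (fun t θ => F t θ ^ 2) t := by
  set a := circInt F t / (2 * π) with ha
  have hF2 : Cont2 fun t θ => F t θ ^ 2 := hF.pow 2
  have hFa : Cont2 fun t θ => (2 * a) * F t θ := (Cont2.const _).mul hF
  have h := circInt_nonneg (F := fun t θ => F t θ ^ 2 - (2 * a) * F t θ + a ^ 2) (t := t)
    fun θ => by nlinarith [sq_nonneg (F t θ - a)]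
  rw [circInt_add (hF2.sub hFa) (Cont2.const _), circInt_sub hF2 hFa,
    circInt_const_mul] at h
  have h3 : circInt (fun _ _ => a ^ 2) t = 2 * π * a ^ 2 := by
    unfold circInt; simp
  have hpi := pi_pos
  have h4 : circInt F t = 2 * π * a := by rw [ha]; field_simp
  rw [h3] at h
  rw [h4] at h ⊢
  nlinarith

lemma inner_circInt_right {V : Type*} [NormedAddCommGroup V] [InnerProductSpace ℝ V]
    [CompleteSpace V] {F : ℝ → ℝ → V} (hF : Cont2 F) (x : V) (t : ℝ) :
    ⟪x, circInt F t⟫_ℝ = circInt (fun t θ => ⟪x, F t θ⟫_ℝ) t := by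
  exact ((innerSL ℝ x).intervalIntegral_comp_comm (hF.ii t _ _)).symm

end CircInt

section OneDim

lemma le_add_two_sqrt {y a E X : ℝ} (hE : 0 ≤ E) (hX : 0 ≤ X)
    (h : ∀ κ > 0, y ≤ a + κ⁻¹ * E + κ * X) : y ≤ a + 2 * √(E * X) := by
  rcases hE.eq_or_lt with rfl | hE'
  · rw [zero_mul, sqrt_zero, mul_zero, add_zero]
    refine le_of_forall_pos_le_add fun ε hε => ?_
    have h1 := h (ε / (X + 1)) (by positivity)
    have h2 : ε / (X + 1) * X ≤ ε := by
      rw [div_mul_eq_mul_div, div_le_iff₀ (by positivity)]; nlinarith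
    linarith
  rcases hX.eq_or_lt with rfl | hX'
  · rw [mul_zero, sqrt_zero, mul_zero, add_zero]
    refine le_of_forall_pos_le_add fun ε hε => ?_
    have h1 := h (E / ε) (by positivity)
    have h2 : (E / ε)⁻¹ * E = ε := by field_simp
    linarith
  have h1 := h (√E / √X) (by positivity)
  have h2 : (√E / √X)⁻¹ * E = √E * √X := by
    rw [inv_div, div_mul_eq_mul_div, div_eq_iff (by positivity)]
    linear_combination (-√X) * mul_self_sqrt hE
  have h3 : √E / √X * X = √E * √X := by
    rw [div_mul_eq_mul_div, div_eq_iff (by positivity)]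
    linear_combination (-√E) * mul_self_sqrt hX
  rw [sqrt_mul hE]
  linarith

/-- Weighted estimate for a non-resonant mode. -/
lemma mode_estimate {V : Type*} [NormedAddCommGroup V] [InnerProductSpace ℝ V]
    {a b μ c : ℝ} (hab : a ≤ b) (hc : 0 < c) {y s : ℝ → V} {ρ ρ' η η' : ℝ → ℝ}
    (hy : ∀ t ∈ Icc a b, HasDerivAt y (μ • y t + s t) t)
    (hyc : Continuous y) (hs : Continuous s)
    (hρ : ∀ t, HasDerivAt ρ (ρ' t) t) (hρ'c : Continuous ρ') (hρ0 : ∀ t, 0 < ρ t)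
    (hη : ∀ t, HasDerivAt η (η' t) t) (hη'c : Continuous η') (ha : η a = 0) (hb : η b = 0)
    (hres : (∀ t ∈ Icc a b, c * ρ t ≤ ρ' t + 2 * μ * ρ t) ∨
      (∀ t ∈ Icc a b, ρ' t + 2 * μ * ρ t ≤ -c * ρ t)) :
    ∫ t in a..b, ρ t * η t ^ 2 * ‖y t‖ ^ 2 ≤
      8 / c ^ 2 * ∫ t in a..b, ρ t * (η t ^ 2 * ‖s t‖ ^ 2 + η' t ^ 2 * ‖y t‖ ^ 2) := by
  have hρc : Continuous ρ := continuous_iff_continuousAt.2 fun t => (hρ t).continuousAt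
  have hηc : Continuous η := continuous_iff_continuousAt.2 fun t => (hη t).continuousAt
  set U' : ℝ → ℝ := fun t => (ρ' t * η t ^ 2 + ρ t * (2 * η t * η' t)) * ‖y t‖ ^ 2 +
    ρ t * η t ^ 2 * (2 * ⟪y t, μ • y t + s t⟫_ℝ) with hU'
  have hU'c : Continuous U' := by fun_prop
  have hder : ∀ t ∈ Icc a b, HasDerivAt (fun t => ρ t * η t ^ 2 * ‖y t‖ ^ 2) (U' t) t := by
    intro t ht
    have h : HasDerivAt (fun t => ρ t * η t ^ 2 * ‖y t‖ ^ 2) _ t :=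
      ((hρ t).mul ((hη t).pow 2)).mul (hy t ht).norm_sq
    refine h.congr_deriv ?_
    simp [hU']
  have h0 : ∫ t in a..b, U' t = 0 := by
    rw [intervalIntegral.integral_eq_sub_of_hasDerivAt
      (fun t ht => hder t (by rwa [uIcc_of_le hab] at ht)) (hU'c.intervalIntegrable _ _)]
    simp [ha, hb]
  have key : ∀ t ∈ Icc a b, |ρ t * η t * ‖y t‖ * (2 * η' t * ‖y t‖) +
      2 * (ρ t * η t ^ 2 * ⟪y t, s t⟫_ℝ)| ≤ c / 2 * (ρ t * η t ^ 2 * ‖y t‖ ^ 2) +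
      4 / c * (ρ t * (η t ^ 2 * ‖s t‖ ^ 2 + η' t ^ 2 * ‖y t‖ ^ 2)) := by
    intro t ht
    have hin : |⟪y t, s t⟫_ℝ| ≤ ‖y t‖ * ‖s t‖ := abs_real_inner_le_norm _ _
    have hr := hρ0 t
    have e1 : |ρ t * η t * ‖y t‖ * (2 * η' t * ‖y t‖)| =
        ρ t * (2 * (|η t| * ‖y t‖) * (|η' t| * ‖y t‖)) := by
      simp only [abs_mul, abs_of_pos hr, abs_norm, abs_two]; ring
    have e2 : |2 * (ρ t * η t ^ 2 * ⟪y t, s t⟫_ℝ)| ≤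
        ρ t * (2 * (|η t| * ‖y t‖) * (|η t| * ‖s t‖)) := by
      simp only [abs_mul, abs_of_pos hr, abs_two, abs_pow]
      have : 2 * (ρ t * |η t| ^ 2 * |⟪y t, s t⟫_ℝ|) ≤ 2 * (ρ t * |η t| ^ 2 * (‖y t‖ * ‖s t‖)) := by
        gcongr
      linarith
    refine (abs_add_le _ _).trans ((add_le_add e1.le e2).trans ?_)
    have am : ∀ p r : ℝ, 2 * p * r ≤ c / 4 * p ^ 2 + 4 / c * r ^ 2 := by
      intro p r
      have : 0 ≤ (c / 2 * p - 2 * r) ^ 2 / c := by positivity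
      have e : (c / 2 * p - 2 * r) ^ 2 / c = c / 4 * p ^ 2 + 4 / c * r ^ 2 - 2 * p * r := by
        field_simp; ring
      linarith
    have f1 := am (|η t| * ‖y t‖) (|η' t| * ‖y t‖)
    have f2 := am (|η t| * ‖y t‖) (|η t| * ‖s t‖)
    have := mul_le_mul_of_nonneg_left (add_le_add f1 f2) hr.le
    simp only [mul_pow, sq_abs] at this
    linarith
  have hsum : c / 2 * ∫ t in a..b, ρ t * η t ^ 2 * ‖y t‖ ^ 2 ≤
      4 / c * ∫ t in a..b, ρ t * (η t ^ 2 * ‖s t‖ ^ 2 + η' t ^ 2 * ‖y t‖ ^ 2) := by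
    rw [← intervalIntegral.integral_const_mul, ← intervalIntegral.integral_const_mul]
    have hexp : ∀ t, U' t = (ρ' t + 2 * μ * ρ t) * (η t ^ 2 * ‖y t‖ ^ 2) +
        (ρ t * η t * ‖y t‖ * (2 * η' t * ‖y t‖) + 2 * (ρ t * η t ^ 2 * ⟪y t, s t⟫_ℝ)) := by
      intro t
      simp only [hU', inner_add_right, real_inner_smul_right, real_inner_self_eq_norm_sq]
      ring
    rcases hres with hres | hres
    · have : ∫ t in a..b, c / 2 * (ρ t * η t ^ 2 * ‖y t‖ ^ 2) ≤
          ∫ t in a..b, (4 / c * (ρ t * (η t ^ 2 * ‖s t‖ ^ 2 + η' t ^ 2 * ‖y t‖ ^ 2)) + U' t) := by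
        refine intervalIntegral.integral_mono_on hab (Continuous.intervalIntegrable (by fun_prop) _ _)
          (Continuous.intervalIntegrable (by fun_prop) _ _) fun t ht => ?_
        have h1 := neg_le_of_abs_le (key t ht)
        have h2 := mul_le_mul_of_nonneg_right (hres t ht) (by positivity : 0 ≤ η t ^ 2 * ‖y t‖ ^ 2)
        rw [hexp t]
        linarith
      rwa [intervalIntegral.integral_add (Continuous.intervalIntegrable (by fun_prop) _ _)
        (hU'c.intervalIntegrable _ _), h0, add_zero] at this
    · have : ∫ t in a..b, c / 2 * (ρ t * η t ^ 2 * ‖y t‖ ^ 2) ≤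
          ∫ t in a..b, (4 / c * (ρ t * (η t ^ 2 * ‖s t‖ ^ 2 + η' t ^ 2 * ‖y t‖ ^ 2)) - U' t) := by
        refine intervalIntegral.integral_mono_on hab (Continuous.intervalIntegrable (by fun_prop) _ _)
          (Continuous.intervalIntegrable (by fun_prop) _ _) fun t ht => ?_
        have h1 := le_of_abs_le (key t ht)
        have h2 := mul_le_mul_of_nonneg_right (hres t ht) (by positivity : 0 ≤ η t ^ 2 * ‖y t‖ ^ 2)
        rw [hexp t]
        linarith
      rwa [intervalIntegral.integral_sub (Continuous.intervalIntegrable (by fun_prop) _ _)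
        (hU'c.intervalIntegrable _ _), h0, sub_zero] at this
  have h8 : 8 / c ^ 2 = 2 / c * (4 / c) := by field_simp; norm_num
  rw [h8, mul_assoc]
  calc _ = 2 / c * (c / 2 * ∫ t in a..b, ρ t * η t ^ 2 * ‖y t‖ ^ 2) := by field_simp
    _ ≤ _ := by gcongr

/-- Summation of local estimates against a slowly varying weight. -/
lemma sum_windows {F G ω : ℝ → ℝ} {c K : ℝ} (hc : 0 ≤ c) (hK : 0 ≤ K)
    (hF : Continuous F) (hG : Continuous G)
    (hω : Continuous ω) (hF0 : ∀ t, 0 ≤ F t) (hG0 : ∀ t, 0 ≤ G t) (hω0 : ∀ t, 0 ≤ ω t)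
    (hωK : ∀ x y, |x - y| ≤ 3 → ω x ≤ K * ω y) (a l : ℕ)
    (h : ∀ j : ℕ, a ≤ j → j + 3 ≤ a + 2 + l →
      ∫ t in (j + 1 : ℝ)..(j + 2 : ℝ), F t ≤ c * ∫ t in (j : ℝ)..(j + 3 : ℝ), G t) :
    ∫ t in (a + 1 : ℝ)..(a + 1 + l : ℝ), ω t * F t ≤
      3 * (c * K ^ 2) * ∫ t in (a : ℝ)..(a + 2 + l : ℝ), ω t * G t := by
  have hi : ∀ x y, IntervalIntegrable (fun t => ω t * G t) volume x y := fun x y =>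
    (hω.mul hG).intervalIntegrable _ _
  have hi' : ∀ x y, IntervalIntegrable (fun t => ω t * F t) volume x y := fun x y =>
    (hω.mul hF).intervalIntegrable _ _
  have hone : ∀ j : ℕ, a ≤ j → j + 3 ≤ a + 2 + l →
      ∫ t in (j + 1 : ℝ)..(j + 2 : ℝ), ω t * F t ≤
        c * K ^ 2 * ∫ t in (j : ℝ)..(j + 3 : ℝ), ω t * G t := by
    intro j h1 h2
    calc ∫ t in (j + 1 : ℝ)..(j + 2 : ℝ), ω t * F t
        ≤ ∫ t in (j + 1 : ℝ)..(j + 2 : ℝ), K * ω (j + 1) * F t := by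
          refine intervalIntegral.integral_mono_on (by linarith) (hi' _ _)
            (Continuous.intervalIntegrable (by fun_prop) _ _) fun t ht => ?_
          exact mul_le_mul_of_nonneg_right (hωK _ _ (by
            rw [abs_le]; constructor <;> linarith [ht.1, ht.2])) (hF0 t)
      _ = K * ω (j + 1) * ∫ t in (j + 1 : ℝ)..(j + 2 : ℝ), F t :=
          intervalIntegral.integral_const_mul _ _
      _ ≤ K * ω (j + 1) * (c * ∫ t in (j : ℝ)..(j + 3 : ℝ), G t) := by
          have := hω0 (j + 1)
          exact mul_le_mul_of_nonneg_left (h j h1 h2) (by positivity)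
      _ = c * K * ∫ t in (j : ℝ)..(j + 3 : ℝ), ω (j + 1) * G t := by
          rw [intervalIntegral.integral_const_mul]; ring
      _ ≤ c * K * ∫ t in (j : ℝ)..(j + 3 : ℝ), K * (ω t * G t) := by
          refine mul_le_mul_of_nonneg_left ?_ (by positivity)
          refine intervalIntegral.integral_mono_on (by linarith)
            (Continuous.intervalIntegrable (by fun_prop) _ _)
            (Continuous.intervalIntegrable (by fun_prop) _ _) fun t ht => ?_
          rw [← mul_assoc]
          exact mul_le_mul_of_nonneg_right (hωK _ _ (by
            rw [abs_le]; constructor <;> linarith [ht.1, ht.2])) (hG0 t)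
      _ = _ := by rw [intervalIntegral.integral_const_mul]; ring
  have hind : ∀ i : ℕ, i ≤ l → ∫ t in (a + 1 : ℝ)..(a + 1 + i : ℝ), ω t * F t ≤
      c * K ^ 2 * ((∫ t in (a : ℝ)..(a + i : ℝ), ω t * G t) +
        (∫ t in (a + 1 : ℝ)..(a + 1 + i : ℝ), ω t * G t) +
        ∫ t in (a + 2 : ℝ)..(a + 2 + i : ℝ), ω t * G t) := by
    intro i
    induction i with
    | zero => intro _; simp
    | succ i ih =>
      intro hil
      have h1 := ih (by omega)
      have h2 := hone (a + i) (by omega) (by omega)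
      have e := fun x y z => intervalIntegral.integral_add_adjacent_intervals (hi x y) (hi y z)
      have e' := intervalIntegral.integral_add_adjacent_intervals (hi' (a + 1) (a + 1 + i))
        (hi' (a + 1 + i) (a + 1 + i + 1))
      push_cast at h2 ⊢
      have q1 := e (a : ℝ) (a + i) (a + i + 1)
      have q2 := e (a + 1 : ℝ) (a + 1 + i) (a + 1 + i + 1)
      have q3 := e (a + 2 : ℝ) (a + 2 + i) (a + 2 + i + 1)
      have q4 := e (a + i : ℝ) (a + i + 1) (a + i + 2)
      have q5 := e (a + i : ℝ) (a + i + 2) (a + i + 3)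
      rw [show (a + i + 1 : ℝ) = a + 1 + i by ring, show (a + i + 2 : ℝ) = a + 2 + i by ring] at *
      rw [show (a + 1 + i + 1 : ℝ) = a + 2 + i by ring, show (a + i + 3 : ℝ) = a + 2 + i + 1 by ring] at *
      rw [show (a + (i + 1) : ℝ) = a + 1 + i by ring, show (a + 1 + (i + 1) : ℝ) = a + 2 + i by ring,
        show (a + 2 + (i + 1) : ℝ) = a + 2 + i + 1 by ring, ← e', ← q1, ← q2, ← q3]
      rw [← q5, ← q4] at h2
      linarith
  have hmono : ∀ x y : ℝ, (a : ℝ) ≤ x → x ≤ y → y ≤ a + 2 + l →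
      ∫ t in x..y, ω t * G t ≤ ∫ t in (a : ℝ)..(a + 2 + l : ℝ), ω t * G t := fun x y h1 h2 h3 =>
    intervalIntegral.integral_mono_interval h1 h2 h3
      (Eventually.of_forall fun t => mul_nonneg (hω0 t) (hG0 t)) (hi _ _)
  refine (hind l le_rfl).trans ?_
  have hl : (0 : ℝ) ≤ l := Nat.cast_nonneg l
  rw [show 3 * (c * K ^ 2) * ∫ t in (a : ℝ)..(a + 2 + l : ℝ), ω t * G t =
    c * K ^ 2 * (3 * ∫ t in (a : ℝ)..(a + 2 + l : ℝ), ω t * G t) by ring]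
  refine mul_le_mul_of_nonneg_left ?_ (by positivity)
  linarith [hmono a (a + l) le_rfl (by linarith) (by linarith),
    hmono (a + 1) (a + 1 + l) (by linarith) (by linarith) (by linarith),
    hmono (a + 2) (a + 2 + l) (by linarith) (by linarith) (by linarith)]

end OneDim

section Sobolev

lemma circInt_mono_on {F G : ℝ → ℝ → ℝ} (hF : Cont2 F) (hG : Cont2 G) {t : ℝ}
    (h : ∀ θ ∈ Icc 0 (2 * π), F t θ ≤ G t θ) : circInt F t ≤ circInt G t :=
  intervalIntegral.integral_mono_on (by positivity) (hF.ii _ _ _) (hG.ii _ _ _) h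

lemma le_average_add {Z : ℝ → ℝ → ℝ} (hZ : Smooth2 Z) (Z0 : ∀ t θ, 0 ≤ Z t θ) (t θ : ℝ)
    (hθ : θ ∈ Icc 0 (2 * π)) :
    Z t θ ≤ circInt Z t + circInt (fun t θ => |pth Z t θ|) t := by
  have hc : Continuous fun θ => |pth Z t θ| := (hZ.pth.cont.snd t).abs
  have hosc : ∀ θ' ∈ Icc 0 (2 * π), Z t θ - Z t θ' ≤ circInt (fun t θ => |pth Z t θ|) t := by
    intro θ' hθ'
    have h1 : ∫ x in θ'..θ, pth Z t x = Z t θ - Z t θ' :=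
      intervalIntegral.integral_eq_sub_of_hasDerivAt (fun x _ => hZ.dth t x) (hZ.pth.cont.ii _ _ _)
    rw [← h1]
    refine (le_abs_self _).trans ?_
    refine (intervalIntegral.norm_integral_le_integral_norm_uIoc (f := pth Z t)).trans ?_
    unfold circInt
    rw [intervalIntegral.integral_of_le (by positivity)]
    refine setIntegral_mono_set ?_ (Eventually.of_forall fun x => norm_nonneg _)
      (LE.le.eventuallyLE ?_ : _ ≤ᵐ[volume] _)
    · exact (hc.intervalIntegrable 0 (2 * π)).1
    · rw [uIoc]
      exact Ioc_subset_Ioc (le_min hθ'.1 hθ.1) (max_le hθ'.2 hθ.2)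
  have h2 : circInt (fun _ _ => Z t θ) t ≤
      circInt (fun t θ => Z t θ + circInt (fun t θ => |pth Z t θ|) t) t :=
    circInt_mono_on (Cont2.const _)
      (hZ.cont.add (Cont2.of_fst hZ.pth.cont.abs.circInt))
      fun θ' hθ' => by linarith [hosc θ' hθ']
  have hcst : ∀ x : ℝ, circInt (fun _ _ => x) t = 2 * π * x := fun x => by
    unfold circInt; simp
  have h3 : circInt (fun t θ => Z t θ + circInt (fun t θ => |pth Z t θ|) t) t =
      circInt Z t + 2 * π * circInt (fun t θ => |pth Z t θ|) t := by
    rw [circInt_add hZ.cont (Cont2.of_fst hZ.pth.cont.abs.circInt)]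
    congr 1
    unfold circInt; simp
  rw [hcst, h3] at h2
  have hJ : 0 ≤ circInt Z t := circInt_nonneg fun θ => Z0 t θ
  have hpi : 1 ≤ 2 * π := by linarith [pi_gt_three]
  have : 2 * π * Z t θ ≤ 2 * π * (circInt Z t + circInt (fun t θ => |pth Z t θ|) t) := by
    nlinarith
  exact le_of_mul_le_mul_left this (by positivity)

/-- Interior Sobolev-type inequality on a piece of the cylinder. -/
lemma sobolev_strip {Z D : ℝ → ℝ → ℝ} {a b c K : ℝ} (hab : a ≤ b) (hc : 0 ≤ c) (hK : 1 ≤ K)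
    (hZ : Smooth2 Z) (hD : Cont2 D) (Z0 : ∀ t θ, 0 ≤ Z t θ) (D0 : ∀ t θ, 0 ≤ D t θ)
    (ht : ∀ t ∈ Icc a b, ∀ θ, ∀ κ > 0, |pt Z t θ| ≤ (c + κ⁻¹) * Z t θ + κ * D t θ)
    (hth : ∀ t ∈ Icc a b, ∀ θ, ∀ κ > 0, |pth Z t θ| ≤ (c + κ⁻¹) * Z t θ + κ * D t θ)
    {η : ℝ → ℝ} (hη : ContDiff ℝ (⊤ : ℕ∞) η) (η0 : ∀ t, 0 ≤ η t) (η1 : ∀ t, η t ≤ 1)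
    (ηa : η a = 0) (ηK : ∀ t, |deriv η t| ≤ K) {E X : ℝ} (hE : E = ∫ t in a..b, circInt Z t)
    (hX : X = ∫ t in a..b, η t ^ 2 * circInt D t) :
    (∀ t ∈ Icc a b, η t * circInt Z t ≤ (K + c) * E + 2 * √(E * X)) ∧
      ∫ t in a..b, η t ^ 2 * circInt (fun t θ => Z t θ ^ 2) t ≤
        ((K + c) * E + 2 * √(E * X)) ^ 2 := by
  have hηc := hη.continuous
  have hη'c : Continuous (deriv η) := hη.continuous_deriv (by simp)
  have hη2 : Continuous fun t => η t ^ 2 := by fun_prop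
  have hJZ := hZ.cont.circInt
  have hJD := hD.circInt
  have hJZ0 : ∀ t, 0 ≤ circInt Z t := fun t => circInt_nonneg fun θ => Z0 t θ
  have hJD0 : ∀ t, 0 ≤ circInt D t := fun t => circInt_nonneg fun θ => D0 t θ
  have hE0 : 0 ≤ E := hE ▸ intervalIntegral.integral_nonneg hab fun t _ => hJZ0 t
  have hX0 : 0 ≤ X := hX ▸ intervalIntegral.integral_nonneg hab fun t _ =>
    mul_nonneg (sq_nonneg _) (hJD0 t)
  have cut : ∀ t, ∀ x z d : ℝ, 0 ≤ z → (∀ κ > 0, |x| ≤ (c + κ⁻¹) * z + κ * d) → ∀ κ > 0,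
      η t * |x| ≤ (c + κ⁻¹) * z + κ * (η t ^ 2 * d) := by
    intro t x z d hz h κ hκ
    rcases (η0 t).eq_or_lt with h0 | h0
    · rw [← h0]; simp; positivity
    · have h1 := mul_le_mul_of_nonneg_left (h (κ * η t) (by positivity)) h0.le
      have h2 : η t * ((c + (κ * η t)⁻¹) * z + κ * η t * d) =
          η t * c * z + κ⁻¹ * z + κ * (η t ^ 2 * d) := by field_simp
      have h3 : η t * c * z ≤ c * z := by
        have := mul_le_mul_of_nonneg_right (η1 t) (by positivity : 0 ≤ c * z)
        linarith
      linarith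
  have lift : ∀ κ > 0, ∀ G : ℝ → ℝ → ℝ, Smooth2 G → ∀ t, (∀ θ, ∀ κ > 0, |G t θ| ≤
      (c + κ⁻¹) * Z t θ + κ * D t θ) → η t * circInt (fun t θ => |G t θ|) t ≤
        (c + κ⁻¹) * circInt Z t + κ * (η t ^ 2 * circInt D t) := by
    intro κ hκ G hG t h
    rw [← circInt_fst_mul, ← circInt_fst_mul (fun t => η t ^ 2), ← circInt_const_mul,
      ← circInt_const_mul, ← circInt_add ((Cont2.const _).mul hZ.cont)
        ((Cont2.const _).mul ((Cont2.of_fst hη2).mul hD))]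
    exact circInt_mono ((Cont2.of_fst hηc).mul hG.cont.abs)
      (((Cont2.const _).mul hZ.cont).add ((Cont2.const _).mul
        ((Cont2.of_fst hη2).mul hD)))
      fun θ => cut t _ _ _ (Z0 t θ) (h θ) κ hκ
  have intKE : ∀ κ C₀ : ℝ, ∫ t in a..b, (C₀ * circInt Z t + κ * (η t ^ 2 * circInt D t)) =
      C₀ * E + κ * X := by
    intro κ C₀
    rw [intervalIntegral.integral_add (Continuous.intervalIntegrable (by fun_prop) _ _)
      (Continuous.intervalIntegrable (by fun_prop) _ _), intervalIntegral.integral_const_mul,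
      intervalIntegral.integral_const_mul, hE, hX]
  have hM : ∀ t ∈ Icc a b, η t * circInt Z t ≤ (K + c) * E + 2 * √(E * X) := by
    intro t htab
    refine le_add_two_sqrt hE0 hX0 fun κ hκ => ?_
    have hder : ∀ s, HasDerivAt (fun s => η s * circInt Z s)
        (deriv η s * circInt Z s + η s * circInt (pt Z) s) s := fun s =>
      (hη.differentiable (by simp) s).hasDerivAt.mul (circInt_hasDerivAt hZ s)
    have hpt := hZ.pt.cont.circInt
    have h1 : ∫ s in a..t, (deriv η s * circInt Z s + η s * circInt (pt Z) s) =
        η t * circInt Z t := by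
      rw [intervalIntegral.integral_eq_sub_of_hasDerivAt (fun s _ => hder s)
        (Continuous.intervalIntegrable (by fun_prop) _ _), ηa, zero_mul, sub_zero]
    rw [← h1]
    calc ∫ s in a..t, (deriv η s * circInt Z s + η s * circInt (pt Z) s)
        ≤ ∫ s in a..t, ((K + (c + κ⁻¹)) * circInt Z s + κ * (η s ^ 2 * circInt D s)) := by
          refine intervalIntegral.integral_mono_on htab.1
            (Continuous.intervalIntegrable (by fun_prop) _ _)
            (Continuous.intervalIntegrable (by fun_prop) _ _) fun s hs => ?_
          have e1 := lift κ hκ (pt Z) hZ.pt s (fun θ => ht s ⟨hs.1, hs.2.trans htab.2⟩ θ)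
          have e2 : circInt (pt Z) s ≤ circInt (fun t θ => |pt Z t θ|) s :=
            circInt_mono hZ.pt.cont hZ.pt.cont.abs fun θ => le_abs_self _
          have e3 := mul_le_mul_of_nonneg_left e2 (η0 s)
          have e4 := mul_le_mul_of_nonneg_right ((le_abs_self _).trans (ηK s)) (hJZ0 s)
          linarith
      _ ≤ ∫ s in a..b, ((K + (c + κ⁻¹)) * circInt Z s + κ * (η s ^ 2 * circInt D s)) := by
          refine intervalIntegral.integral_mono_interval le_rfl htab.1 htab.2
            (Eventually.of_forall fun s => ?_) (Continuous.intervalIntegrable (by fun_prop) _ _)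
          have := hJZ0 s
          have := hJD0 s
          show 0 ≤ (K + (c + κ⁻¹)) * circInt Z s + κ * (η s ^ 2 * circInt D s)
          positivity
      _ = _ := by rw [intKE]; ring
  refine ⟨hM, ?_⟩
  set M := (K + c) * E + 2 * √(E * X) with hMdef
  have hM0 : 0 ≤ M := by positivity
  have hZ2 := (hZ.cont.pow 2).circInt
  have key : ∀ κ > 0, ∫ t in a..b, η t ^ 2 * circInt (fun t θ => Z t θ ^ 2) t ≤
      (K + c) * E * M + κ⁻¹ * (E * M) + κ * (X * M) := by
    intro κ hκ
    have : (K + c) * E * M + κ⁻¹ * (E * M) + κ * (X * M) =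
        ∫ t in a..b, ((K + c + κ⁻¹) * circInt Z t + κ * (η t ^ 2 * circInt D t)) * M := by
      rw [intervalIntegral.integral_mul_const, intKE]; ring
    rw [this]
    refine intervalIntegral.integral_mono_on hab (Continuous.intervalIntegrable (by fun_prop) _ _)
      (Continuous.intervalIntegrable (by fun_prop) _ _) fun t htab => ?_
    set φ := (K + c + κ⁻¹) * circInt Z t + κ * (η t ^ 2 * circInt D t) with hφ
    have hφ0 : 0 ≤ φ := by
      have := hJZ0 t
      have := hJD0 t
      positivity
    have hsup : ∀ θ ∈ Icc 0 (2 * π), η t * Z t θ ≤ φ := by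
      intro θ hθ
      have e1 := mul_le_mul_of_nonneg_left (le_average_add hZ Z0 t θ hθ) (η0 t)
      have e2 := lift κ hκ (pth Z) hZ.pth t (fun θ => hth t htab θ)
      have e3 := mul_le_mul_of_nonneg_right ((η1 t).trans hK) (hJZ0 t)
      rw [hφ]
      linarith
    have e4 : η t ^ 2 * circInt (fun t θ => Z t θ ^ 2) t ≤ φ * (η t * circInt Z t) := by
      rw [← circInt_fst_mul (fun t => η t ^ 2), ← mul_assoc, ← circInt_const_mul (φ * η t)]
      refine circInt_mono_on ((Cont2.of_fst hη2).mul (hZ.cont.pow 2))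
        ((Cont2.const _).mul hZ.cont) fun θ hθ => ?_
      have := mul_le_mul_of_nonneg_right (hsup θ hθ) (mul_nonneg (η0 t) (Z0 t θ))
      linarith
    exact e4.trans (mul_le_mul_of_nonneg_left (hM t htab) hφ0)
  have h2 := le_add_two_sqrt (by positivity) (by positivity) key
  have h3 : √(E * M * (X * M)) = √(E * X) * M := by
    rw [show E * M * (X * M) = (E * X) * M ^ 2 by ring, sqrt_mul (by positivity), sqrt_sq hM0]
  rw [h3] at h2
  calc _ ≤ _ := h2
    _ = M ^ 2 := by rw [hMdef]; ring

end Sobolev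

section Fourier

variable {V : Type*} [NormedAddCommGroup V] [InnerProductSpace ℝ V]

/-- Weighted estimate for finitely many modes, one of which is resonant. -/
lemma spectral_estimate {a b c : ℝ} (hab : a ≤ b) (hc : 0 < c) {y₁ y₂ s₁ s₂ : ℤ → ℝ → V}
    {ρ ρ' η η' S N R : ℝ → ℝ} (κ : ℤ)
    (hy₁ : ∀ k, ∀ t ∈ Icc a b, HasDerivAt (y₁ k) ((k : ℝ) • y₁ k t + s₁ k t) t)
    (hy₂ : ∀ k, ∀ t ∈ Icc a b, HasDerivAt (y₂ k) ((k : ℝ) • y₂ k t + s₂ k t) t)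
    (hy₁c : ∀ k, Continuous (y₁ k)) (hy₂c : ∀ k, Continuous (y₂ k))
    (hs₁c : ∀ k, Continuous (s₁ k)) (hs₂c : ∀ k, Continuous (s₂ k))
    (hρ : ∀ t, HasDerivAt ρ (ρ' t) t) (hρ'c : Continuous ρ') (hρ0 : ∀ t, 0 < ρ t)
    (hη : ∀ t, HasDerivAt η (η' t) t) (hη'c : Continuous η') (ha : η a = 0) (hb : η b = 0)
    (hres : ∀ k, k ≠ κ → (∀ t ∈ Icc a b, c * ρ t ≤ ρ' t + 2 * (k : ℝ) * ρ t) ∨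
      (∀ t ∈ Icc a b, ρ' t + 2 * (k : ℝ) * ρ t ≤ -c * ρ t))
    (hSc : Continuous S) (hNc : Continuous N) (hRc : Continuous R)
    (hS : ∀ F : Finset ℤ, ∀ t ∈ Icc a b, ∑ k ∈ F, (‖s₁ k t‖ ^ 2 + ‖s₂ k t‖ ^ 2) ≤ S t)
    (hN : ∀ F : Finset ℤ, ∀ t ∈ Icc a b, ∑ k ∈ F, (‖y₁ k t‖ ^ 2 + ‖y₂ k t‖ ^ 2) ≤ N t)
    (hR : ∀ t ∈ Icc a b, ‖y₁ κ t‖ ^ 2 + ‖y₂ κ t‖ ^ 2 ≤ R t) (F : Finset ℤ) :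
    ∫ t in a..b, ρ t * η t ^ 2 * ∑ k ∈ F, (‖y₁ k t‖ ^ 2 + ‖y₂ k t‖ ^ 2) ≤
      (∫ t in a..b, ρ t * η t ^ 2 * R t) +
        8 / c ^ 2 * ∫ t in a..b, ρ t * (η t ^ 2 * S t + η' t ^ 2 * N t) := by
  have hρc : Continuous ρ := continuous_iff_continuousAt.2 fun t => (hρ t).continuousAt
  have hηc : Continuous η := continuous_iff_continuousAt.2 fun t => (hη t).continuousAt
  have hG : ∀ k, Continuous fun t => ‖y₁ k t‖ ^ 2 + ‖y₂ k t‖ ^ 2 := fun k =>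
    ((hy₁c k).norm.pow 2).add ((hy₂c k).norm.pow 2)
  have hGs : ∀ k, Continuous fun t => ‖s₁ k t‖ ^ 2 + ‖s₂ k t‖ ^ 2 := fun k =>
    ((hs₁c k).norm.pow 2).add ((hs₂c k).norm.pow 2)
  have hR0 : ∀ t ∈ Icc a b, 0 ≤ R t := fun t ht =>
    (by positivity : 0 ≤ ‖y₁ κ t‖ ^ 2 + ‖y₂ κ t‖ ^ 2).trans (hR t ht)
  have hmode : ∀ k ∈ F.erase κ, ∫ t in a..b, ρ t * η t ^ 2 * (‖y₁ k t‖ ^ 2 + ‖y₂ k t‖ ^ 2) ≤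
      8 / c ^ 2 * ∫ t in a..b, ρ t * (η t ^ 2 * (‖s₁ k t‖ ^ 2 + ‖s₂ k t‖ ^ 2) +
        η' t ^ 2 * (‖y₁ k t‖ ^ 2 + ‖y₂ k t‖ ^ 2)) := by
    intro k hk
    have hk' := Finset.ne_of_mem_erase hk
    have e1 := mode_estimate hab hc (hy₁ k) (hy₁c k) (hs₁c k) hρ hρ'c hρ0 hη hη'c ha hb (hres k hk')
    have e2 := mode_estimate hab hc (hy₂ k) (hy₂c k) (hs₂c k) hρ hρ'c hρ0 hη hη'c ha hb (hres k hk')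
    have := hy₁c k
    have := hy₂c k
    have := hs₁c k
    have := hs₂c k
    have e3 := add_le_add e1 e2
    rw [← mul_add, ← intervalIntegral.integral_add, ← intervalIntegral.integral_add] at e3
    · refine le_of_eq_of_le ?_ (e3.trans_eq ?_)
      · congr 1; funext t; ring
      · congr 2; funext t; ring
    all_goals exact Continuous.intervalIntegrable (by fun_prop) _ _
  have hsplit : ∀ t ∈ Icc a b, ρ t * η t ^ 2 * ∑ k ∈ F, (‖y₁ k t‖ ^ 2 + ‖y₂ k t‖ ^ 2) ≤
      ρ t * η t ^ 2 * R t + ∑ k ∈ F.erase κ, ρ t * η t ^ 2 * (‖y₁ k t‖ ^ 2 + ‖y₂ k t‖ ^ 2) := by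
    intro t ht
    have hw : 0 ≤ ρ t * η t ^ 2 := mul_nonneg (hρ0 t).le (sq_nonneg _)
    rw [← Finset.mul_sum, ← mul_add]
    refine mul_le_mul_of_nonneg_left ?_ hw
    by_cases hκ : κ ∈ F
    · rw [← Finset.add_sum_erase _ _ hκ]
      linarith [hR t ht]
    · rw [Finset.erase_eq_of_notMem hκ]
      linarith [hR0 t ht]
  have hcs : ∀ k, Continuous fun t => ρ t * η t ^ 2 * (‖y₁ k t‖ ^ 2 + ‖y₂ k t‖ ^ 2) := fun k =>
    (hρc.mul (hηc.pow 2)).mul (hG k)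
  calc ∫ t in a..b, ρ t * η t ^ 2 * ∑ k ∈ F, (‖y₁ k t‖ ^ 2 + ‖y₂ k t‖ ^ 2)
      ≤ ∫ t in a..b, (ρ t * η t ^ 2 * R t +
          ∑ k ∈ F.erase κ, ρ t * η t ^ 2 * (‖y₁ k t‖ ^ 2 + ‖y₂ k t‖ ^ 2)) := by
        refine intervalIntegral.integral_mono_on hab
          (Continuous.intervalIntegrable ?_ _ _) (Continuous.intervalIntegrable ?_ _ _) hsplit
        · exact (hρc.mul (hηc.pow 2)).mul (continuous_finsetSum _ fun k _ => hG k)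
        · exact ((hρc.mul (hηc.pow 2)).mul hRc).add (continuous_finsetSum _ fun k _ => hcs k)
    _ = (∫ t in a..b, ρ t * η t ^ 2 * R t) + ∑ k ∈ F.erase κ,
          ∫ t in a..b, ρ t * η t ^ 2 * (‖y₁ k t‖ ^ 2 + ‖y₂ k t‖ ^ 2) := by
        rw [intervalIntegral.integral_add, intervalIntegral.integral_finsetSum]
        · exact fun k _ => (hcs k).intervalIntegrable _ _
        · exact Continuous.intervalIntegrable (by fun_prop) _ _
        · exact (continuous_finsetSum _ fun k _ => hcs k).intervalIntegrable _ _
    _ ≤ (∫ t in a..b, ρ t * η t ^ 2 * R t) + ∑ k ∈ F.erase κ,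
          8 / c ^ 2 * ∫ t in a..b, ρ t * (η t ^ 2 * (‖s₁ k t‖ ^ 2 + ‖s₂ k t‖ ^ 2) +
            η' t ^ 2 * (‖y₁ k t‖ ^ 2 + ‖y₂ k t‖ ^ 2)) := by
        gcongr with k hk
        exact hmode k hk
    _ ≤ _ := by
        rw [← Finset.mul_sum, ← intervalIntegral.integral_finsetSum]
        · gcongr
          refine intervalIntegral.integral_mono_on hab
            (Continuous.intervalIntegrable ?_ _ _) (Continuous.intervalIntegrable ?_ _ _) ?_
          · exact continuous_finsetSum _ fun k _ => hρc.mul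
              (((hηc.pow 2).mul (hGs k)).add ((hη'c.pow 2).mul (hG k)))
          · fun_prop
          · intro t ht
            rw [← Finset.mul_sum, Finset.sum_add_distrib, ← Finset.mul_sum, ← Finset.mul_sum]
            have := (hρ0 t).le
            have e1 := hS (F.erase κ) t ht
            have e2 := hN (F.erase κ) t ht
            gcongr
        · exact fun k _ => Continuous.intervalIntegrable (hρc.mul
              (((hηc.pow 2).mul (hGs k)).add ((hη'c.pow 2).mul (hG k)))) _ _

/-- Fourier coefficient `∮ (cos kθ A + sin kθ B) dθ` of a pair of vector-valued functions. -/
def fc (k : ℤ) (A B : ℝ → ℝ → V) (t : ℝ) : V :=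
  circInt (fun t θ => cos (k * θ) • A t θ + sin (k * θ) • B t θ) t

lemma cont2_cos (k : ℤ) : Cont2 fun _ θ => cos ((k : ℝ) * θ) :=
  Cont2.of_snd (by fun_prop)

lemma cont2_sin (k : ℤ) : Cont2 fun _ θ => sin ((k : ℝ) * θ) :=
  Cont2.of_snd (by fun_prop)

lemma fc_continuous (k : ℤ) {A B : ℝ → ℝ → V} (hA : Cont2 A) (hB : Cont2 B) :
    Continuous (fc k A B) :=
  (((cont2_cos k).smul hA).add ((cont2_sin k).smul hB)).circInt

lemma fc_add (k : ℤ) {A B A' B' : ℝ → ℝ → V} (hA : Cont2 A) (hB : Cont2 B) (hA' : Cont2 A')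
    (hB' : Cont2 B') (t : ℝ) :
    fc k (fun t θ => A t θ + A' t θ) (fun t θ => B t θ + B' t θ) t =
      fc k A B t + fc k A' B' t := by
  unfold fc
  rw [← circInt_add (((cont2_cos k).smul hA).add ((cont2_sin k).smul hB))
    (((cont2_cos k).smul hA').add ((cont2_sin k).smul hB'))]
  refine circInt_congr fun θ => ?_
  module

lemma fc_congr (k : ℤ) {A B A' B' : ℝ → ℝ → V} {t : ℝ} (hA : ∀ θ, A t θ = A' t θ)
    (hB : ∀ θ, B t θ = B' t θ) : fc k A B t = fc k A' B' t :=
  circInt_congr fun θ => by rw [hA, hB]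

lemma fc_neg (k : ℤ) (A B : ℝ → ℝ → V) (t : ℝ) :
    fc k (fun t θ => -A t θ) (fun t θ => -B t θ) t = -fc k A B t := by
  unfold fc
  rw [← neg_one_smul ℝ (circInt _ _), ← circInt_smul]
  refine circInt_congr fun θ => ?_
  module

lemma smooth2_cos (k : ℤ) : Smooth2 fun _ θ => cos ((k : ℝ) * θ) :=
  Smooth2.of_snd (by fun_prop)

lemma smooth2_sin (k : ℤ) : Smooth2 fun _ θ => sin ((k : ℝ) * θ) :=
  Smooth2.of_snd (by fun_prop)

lemma fc_hasDerivAt [CompleteSpace V] (k : ℤ) {A B : ℝ → ℝ → V} (hA : Smooth2 A)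
    (hB : Smooth2 B) (t : ℝ) : HasDerivAt (fc k A B) (fc k (pt A) (pt B) t) t := by
  have h := circInt_hasDerivAt (((smooth2_cos k).smul hA).add ((smooth2_sin k).smul hB)) t
  refine h.congr_deriv (circInt_congr fun θ => ?_)
  exact ((hA.dt t θ).const_smul _ |>.add ((hB.dt t θ).const_smul _)).deriv

lemma fc_pth [CompleteSpace V] (k : ℤ) {A B : ℝ → ℝ → V} (hA : Smooth2 A) (hB : Smooth2 B)
    (pA : Periodic2 A) (pB : Periodic2 B) (t : ℝ) :
    fc k (pth A) (pth B) t = -(k : ℝ) • fc k B (fun t θ => -A t θ) t := by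
  have hsm := ((smooth2_cos k).smul hA).add ((smooth2_sin k).smul hB)
  have hp : Periodic2 fun t θ => cos ((k : ℝ) * θ) • A t θ + sin ((k : ℝ) * θ) • B t θ := by
    intro t θ
    have e : (k : ℝ) * (θ + 2 * π) = k * θ + k * (2 * π) := by ring
    simp only [pA t θ, pB t θ, e, cos_add_int_mul_two_pi, sin_add_int_mul_two_pi]
  have h := circInt_pth_eq_zero hsm hp t
  have hd : ∀ θ, pth (fun t θ => cos ((k : ℝ) * θ) • A t θ + sin ((k : ℝ) * θ) • B t θ) t θ =
      (cos (k * θ) • pth A t θ + sin (k * θ) • pth B t θ) +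
        (k : ℝ) • (cos (k * θ) • B t θ + sin (k * θ) • (-A t θ)) := by
    intro θ
    have hk : HasDerivAt (fun θ : ℝ => (k : ℝ) * θ) k θ := by
      simpa using (hasDerivAt_id θ).const_mul (k : ℝ)
    have := ((hk.cos.smul (hA.dth t θ)).add (hk.sin.smul (hB.dth t θ))).deriv
    refine this.trans ?_
    module
  rw [circInt_congr (G := fun t θ => (cos (k * θ) • pth A t θ + sin (k * θ) • pth B t θ) +
    (k : ℝ) • (cos (k * θ) • B t θ + sin (k * θ) • (-A t θ))) hd, circInt_add (((cont2_cos k).smul hA.pth.cont).add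
    ((cont2_sin k).smul hB.pth.cont)) ((Cont2.const _).smul (((cont2_cos k).smul hB.cont).add
    ((cont2_sin k).smul hA.cont.neg))), circInt_smul] at h
  rw [neg_smul]
  exact eq_neg_of_add_eq_zero_left h

end Fourier

section Parseval

lemma parseval_scalar {A B : ℝ → ℝ} (hA : Continuous A) (hB : Continuous B) :
    HasSum (fun k : ℤ => (∫ θ in (0 : ℝ)..(2 * π), (cos (k * θ) * A θ + sin (k * θ) * B θ)) ^ 2 +
      (∫ θ in (0 : ℝ)..(2 * π), (cos (k * θ) * B θ + sin (k * θ) * -A θ)) ^ 2)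
      (2 * π * ∫ θ in (0 : ℝ)..(2 * π), (A θ ^ 2 + B θ ^ 2)) := by
  have hpi : (0 : ℝ) < 2 * π := by positivity
  set f : ℝ → ℂ := fun θ => (A θ : ℂ) + (B θ : ℂ) * Complex.I with hf
  have hfc : Continuous f := by fun_prop
  have hL : MemLp f 2 (volume.restrict (Ioc 0 (2 * π))) := by
    obtain ⟨M, hM⟩ := (isCompact_Icc (a := (0 : ℝ)) (b := 2 * π)).exists_bound_of_continuousOn
      hfc.continuousOn
    refine MemLp.of_bound hfc.aestronglyMeasurable M ?_
    exact (ae_restrict_mem measurableSet_Ioc).mono fun x hx => hM x (Ioc_subset_Icc_self hx)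
  have h := (hasSum_sq_fourierCoeffOn hpi hL).mul_left ((2 * π) ^ 2)
  have hnorm : ∀ θ, ‖f θ‖ ^ 2 = A θ ^ 2 + B θ ^ 2 := fun θ => by
    rw [hf, ← Complex.normSq_eq_norm_sq, Complex.normSq_add_mul_I]
  have hfun : (fun k : ℤ => (∫ θ in (0 : ℝ)..(2 * π), (cos (k * θ) * A θ + sin (k * θ) * B θ)) ^ 2 +
      (∫ θ in (0 : ℝ)..(2 * π), (cos (k * θ) * B θ + sin (k * θ) * -A θ)) ^ 2) =
      fun k => (2 * π) ^ 2 * ‖fourierCoeffOn hpi f k‖ ^ 2 := by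
    funext k
    have hint : fourierCoeffOn hpi f k = ((2 * π)⁻¹ : ℝ) •
        (((∫ θ in (0 : ℝ)..(2 * π), (cos (k * θ) * A θ + sin (k * θ) * B θ) : ℝ) : ℂ) +
          ((∫ θ in (0 : ℝ)..(2 * π), (cos (k * θ) * B θ + sin (k * θ) * -A θ) : ℝ) : ℂ) *
            Complex.I) := by
      rw [fourierCoeffOn_eq_integral, sub_zero, one_div]
      congr 1
      rw [← intervalIntegral.integral_ofReal, ← intervalIntegral.integral_ofReal,
        ← intervalIntegral.integral_mul_const, ← intervalIntegral.integral_add]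
      · refine intervalIntegral.integral_congr fun θ _ => ?_
        simp only [smul_eq_mul, hf]
        rw [fourier_coe_apply]
        have e : 2 * (π : ℂ) * Complex.I * ((-k : ℤ) : ℂ) * (θ : ℂ) / ((2 * π : ℝ) : ℂ) =
            (((-(k * θ) : ℝ)) : ℂ) * Complex.I := by
          have : (π : ℂ) ≠ 0 := by exact_mod_cast pi_ne_zero
          push_cast
          field_simp
        rw [e, Complex.exp_mul_I, ← Complex.ofReal_cos, ← Complex.ofReal_sin, cos_neg, sin_neg]
        push_cast
        linear_combination (-(Complex.sin (k * θ) * (B θ : ℂ))) * Complex.I_sq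
      · exact Continuous.intervalIntegrable (by fun_prop) _ _
      · exact Continuous.intervalIntegrable (by fun_prop) _ _
    rw [hint, norm_smul, mul_pow ‖((2 * π)⁻¹ : ℝ)‖, ← Complex.normSq_eq_norm_sq, Complex.normSq_add_mul_I,
      norm_eq_abs, sq_abs]
    field_simp
  have hval : 2 * π * ∫ θ in (0 : ℝ)..(2 * π), (A θ ^ 2 + B θ ^ 2) =
      (2 * π) ^ 2 * ((2 * π - 0)⁻¹ • ∫ θ in (0 : ℝ)..(2 * π), ‖f θ‖ ^ 2) := by
    rw [intervalIntegral.integral_congr (g := fun θ => A θ ^ 2 + B θ ^ 2) fun θ _ => hnorm θ,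
      smul_eq_mul, sub_zero]
    field_simp
  rw [hfun, hval]
  exact h

variable {ι : Type*} [Fintype ι]

lemma parseval {A B : ℝ → ℝ → EuclideanSpace ℝ ι} (hA : Cont2 A) (hB : Cont2 B) (t : ℝ) :
    HasSum (fun k : ℤ => ‖fc k A B t‖ ^ 2 + ‖fc k B (fun t θ => -A t θ) t‖ ^ 2)
      (2 * π * circInt (fun t θ => ‖A t θ‖ ^ 2 + ‖B t θ‖ ^ 2) t) := by
  have hco : ∀ i, Continuous fun θ => A t θ i := fun i =>
    (EuclideanSpace.proj (𝕜 := ℝ) i).continuous.comp (hA.snd t)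
  have hco' : ∀ i, Continuous fun θ => B t θ i := fun i =>
    (EuclideanSpace.proj (𝕜 := ℝ) i).continuous.comp (hB.snd t)
  have h := hasSum_sum (s := Finset.univ) fun i (_ : i ∈ Finset.univ) =>
    parseval_scalar (hco i) (hco' i)
  have hcomp : ∀ k : ℤ, ∀ F G : ℝ → ℝ → EuclideanSpace ℝ ι, Cont2 F → Cont2 G → ∀ i,
      (fc k F G t) i = ∫ θ in (0 : ℝ)..(2 * π), (cos (k * θ) * F t θ i + sin (k * θ) * G t θ i) := by
    intro k F G hF hG i
    have := (EuclideanSpace.proj (𝕜 := ℝ) i).intervalIntegral_comp_comm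
      ((((cont2_cos k).smul hF).add ((cont2_sin k).smul hG)).ii t 0 (2 * π))
    exact this.symm
  convert h using 1
  · ext k
    rw [EuclideanSpace.norm_sq_eq, EuclideanSpace.norm_sq_eq, ← Finset.sum_add_distrib]
    refine Finset.sum_congr rfl fun i _ => ?_
    rw [hcomp k A B hA hB i, hcomp k B _ hB hA.neg i]
    simp [sq_abs]
  · rw [← Finset.mul_sum, ← intervalIntegral.integral_finsetSum]
    · congr 1
      refine circInt_congr (G := fun t θ => ∑ i, ((A t θ i) ^ 2 + (B t θ i) ^ 2)) fun θ => ?_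
      rw [EuclideanSpace.norm_sq_eq, EuclideanSpace.norm_sq_eq, ← Finset.sum_add_distrib]
      simp [sq_abs]
    · exact fun i _ => (((hco i).pow 2).add ((hco' i).pow 2)).intervalIntegrable _ _

lemma sum_modes_le {A B : ℝ → ℝ → EuclideanSpace ℝ ι} (hA : Cont2 A) (hB : Cont2 B) (t : ℝ)
    (F : Finset ℤ) : ∑ k ∈ F, (‖fc k A B t‖ ^ 2 + ‖fc k B (fun t θ => -A t θ) t‖ ^ 2) ≤
      2 * π * circInt (fun t θ => ‖A t θ‖ ^ 2 + ‖B t θ‖ ^ 2) t :=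
  sum_le_hasSum F (fun k _ => by positivity) (parseval hA hB t)

/-- A bound for all finite sums of modes gives a bound for the full integral. -/
lemma integral_le_of_modes {A B : ℝ → ℝ → EuclideanSpace ℝ ι} (hA : Cont2 A) (hB : Cont2 B)
    {w : ℝ → ℝ} (hw : Continuous w) (hw0 : ∀ t, 0 ≤ w t) {a b M : ℝ}
    (h : ∀ F : Finset ℤ, ∫ t in a..b, w t *
      ∑ k ∈ F, (‖fc k A B t‖ ^ 2 + ‖fc k B (fun t θ => -A t θ) t‖ ^ 2) ≤ M) :
    ∫ t in a..b, w t * (2 * π * circInt (fun t θ => ‖A t θ‖ ^ 2 + ‖B t θ‖ ^ 2) t) ≤ M := by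
  have hAn : Cont2 fun t θ => ‖A t θ‖ ^ 2 + ‖B t θ‖ ^ 2 := (hA.norm.pow 2).add (hB.norm.pow 2)
  have hc : Continuous fun t => w t * (2 * π * circInt (fun t θ => ‖A t θ‖ ^ 2 + ‖B t θ‖ ^ 2) t) :=
    hw.mul (continuous_const.mul hAn.circInt)
  refine le_of_tendsto' (intervalIntegral.tendsto_integral_filter_of_dominated_convergence
    (l := (atTop : Filter (Finset ℤ)))
    (F := fun F t => w t * ∑ k ∈ F, (‖fc k A B t‖ ^ 2 + ‖fc k B (fun t θ => -A t θ) t‖ ^ 2))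
    (fun t => w t * (2 * π * circInt (fun t θ => ‖A t θ‖ ^ 2 + ‖B t θ‖ ^ 2) t)) ?_ ?_ ?_ ?_) h
  · refine Eventually.of_forall fun F => Continuous.aestronglyMeasurable ?_
    exact hw.mul (continuous_finsetSum _ fun k _ => ((fc_continuous k hA hB).norm.pow 2).add
      ((fc_continuous k hB hA.neg).norm.pow 2))
  · refine Eventually.of_forall fun F => Eventually.of_forall fun t _ => ?_
    rw [norm_of_nonneg (mul_nonneg (hw0 t) (Finset.sum_nonneg fun k _ => by positivity))]
    exact mul_le_mul_of_nonneg_left (sum_modes_le hA hB t F) (hw0 t)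
  · exact hc.intervalIntegrable _ _
  · exact Eventually.of_forall fun t _ => (parseval hA hB t).const_mul (w t)

end Parseval

section Geometry

local notation "𝔼" n => EuclideanSpace ℝ (Fin n)

lemma pt_congr {V : Type*} [NormedAddCommGroup V] [NormedSpace ℝ V] {F G : ℝ → ℝ → V}
    {s : Set ℝ} {t : ℝ} (hs : s ∈ nhds t) {θ : ℝ} (h : ∀ x ∈ s, F x θ = G x θ) :
    pt F t θ = pt G t θ :=
  Filter.EventuallyEq.deriv_eq (mem_of_superset hs h)

lemma pth_congr {V : Type*} [NormedAddCommGroup V] [NormedSpace ℝ V] {F G : ℝ → ℝ → V}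
    {t : ℝ} (h : ∀ θ, F t θ = G t θ) (θ : ℝ) : pth F t θ = pth G t θ := by
  unfold pth
  congr 1
  exact funext h

/-- The trace-free part of the second fundamental form: diagonal component. -/
def trf₁ (f : ℝ → ℝ → 𝔼 n) (u : ℝ → ℝ → ℝ) : ℝ → ℝ → 𝔼 n :=
  fun t θ => Att f u t θ - Athth f u t θ

/-- The trace-free part of the second fundamental form: off-diagonal component. -/
def trf₂ (f : ℝ → ℝ → 𝔼 n) (u : ℝ → ℝ → ℝ) : ℝ → ℝ → 𝔼 n :=
  fun t θ => (2 : ℝ) • Atth f u t θ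

/-- The quadratic part of the `t`-component of the Willmore current. -/
def curQ₁ (f : ℝ → ℝ → 𝔼 n) (u : ℝ → ℝ → ℝ) : ℝ → ℝ → 𝔼 n :=
  fun t θ => (2 : ℝ) • Real.exp (-(2 * u t θ)) • (⟪Hmc f u t θ, Att f u t θ⟫_ℝ • pt f t θ +
    ⟪Hmc f u t θ, Atth f u t θ⟫_ℝ • pth f t θ) - (2⁻¹ : ℝ) • ‖Hmc f u t θ‖ ^ 2 • pt f t θ

/-- The quadratic part of the `θ`-component of the Willmore current. -/
def curQ₂ (f : ℝ → ℝ → 𝔼 n) (u : ℝ → ℝ → ℝ) : ℝ → ℝ → 𝔼 n :=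
  fun t θ => (2 : ℝ) • Real.exp (-(2 * u t θ)) • (⟪Hmc f u t θ, Atth f u t θ⟫_ℝ • pt f t θ +
    ⟪Hmc f u t θ, Athth f u t θ⟫_ℝ • pth f t θ) - (2⁻¹ : ℝ) • ‖Hmc f u t θ‖ ^ 2 • pth f t θ

/-- The `t`-component of the Willmore current. -/
def cur₁ (f : ℝ → ℝ → 𝔼 n) (u : ℝ → ℝ → ℝ) : ℝ → ℝ → 𝔼 n :=
  fun t θ => pt (Hmc f u) t θ + curQ₁ f u t θ

/-- The `θ`-component of the Willmore current. -/
def cur₂ (f : ℝ → ℝ → 𝔼 n) (u : ℝ → ℝ → ℝ) : ℝ → ℝ → 𝔼 n :=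
  fun t θ => pth (Hmc f u) t θ + curQ₂ f u t θ

/-- The flat Laplacian of the logarithm of the conformal factor. -/
def lapl (u : ℝ → ℝ → ℝ) : ℝ → ℝ → ℝ := fun t θ => pt (pt u) t θ + pth (pth u) t θ

section Smoothness

variable {f : ℝ → ℝ → 𝔼 n} {u : ℝ → ℝ → ℝ}

lemma smooth2_expfac (hu : Smooth2 u) (c : ℝ) : Smooth2 fun t θ => Real.exp (c * u t θ) :=
  ((Smooth2.const c).mul hu).exp

lemma smooth2_expfac_neg (hu : Smooth2 u) (c : ℝ) : Smooth2 fun t θ => Real.exp (-(c * u t θ)) :=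
  ((Smooth2.const c).mul hu).neg.exp

lemma smooth2_Hmc (hf : Smooth2 f) (hu : Smooth2 u) : Smooth2 (Hmc f u) :=
  (smooth2_expfac_neg hu 2).smul (hf.pt.pt.add hf.pth.pth)

lemma smooth2_Att (hf : Smooth2 f) (hu : Smooth2 u) : Smooth2 (Att f u) :=
  (hf.pt.pt.sub (hu.pt.smul hf.pt)).add (hu.pth.smul hf.pth)

lemma smooth2_Atth (hf : Smooth2 f) (hu : Smooth2 u) : Smooth2 (Atth f u) :=
  (hf.pth.pt.sub (hu.pth.smul hf.pt)).sub (hu.pt.smul hf.pth)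

lemma smooth2_Athth (hf : Smooth2 f) (hu : Smooth2 u) : Smooth2 (Athth f u) :=
  (hf.pth.pth.add (hu.pt.smul hf.pt)).sub (hu.pth.smul hf.pth)

lemma smooth2_trf₁ (hf : Smooth2 f) (hu : Smooth2 u) : Smooth2 (trf₁ f u) :=
  (smooth2_Att hf hu).sub (smooth2_Athth hf hu)

lemma smooth2_trf₂ (hf : Smooth2 f) (hu : Smooth2 u) : Smooth2 (trf₂ f u) :=
  (Smooth2.const 2).smul (smooth2_Atth hf hu)

lemma smooth2_curQ₁ (hf : Smooth2 f) (hu : Smooth2 u) : Smooth2 (curQ₁ f u) :=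
  ((Smooth2.const 2).smul ((smooth2_expfac_neg hu 2).smul
    ((((smooth2_Hmc hf hu).inner (smooth2_Att hf hu)).smul hf.pt).add
      (((smooth2_Hmc hf hu).inner (smooth2_Atth hf hu)).smul hf.pth)))).sub
    ((Smooth2.const 2⁻¹).smul ((smooth2_Hmc hf hu).norm_sq.smul hf.pt))

lemma smooth2_curQ₂ (hf : Smooth2 f) (hu : Smooth2 u) : Smooth2 (curQ₂ f u) :=
  ((Smooth2.const 2).smul ((smooth2_expfac_neg hu 2).smul
    ((((smooth2_Hmc hf hu).inner (smooth2_Atth hf hu)).smul hf.pt).add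
      (((smooth2_Hmc hf hu).inner (smooth2_Athth hf hu)).smul hf.pth)))).sub
    ((Smooth2.const 2⁻¹).smul ((smooth2_Hmc hf hu).norm_sq.smul hf.pth))

lemma smooth2_cur₁ (hf : Smooth2 f) (hu : Smooth2 u) : Smooth2 (cur₁ f u) :=
  (smooth2_Hmc hf hu).pt.add (smooth2_curQ₁ hf hu)

lemma smooth2_cur₂ (hf : Smooth2 f) (hu : Smooth2 u) : Smooth2 (cur₂ f u) :=
  (smooth2_Hmc hf hu).pth.add (smooth2_curQ₂ hf hu)

lemma smooth2_Adens (hf : Smooth2 f) (hu : Smooth2 u) : Smooth2 (Adens f u) :=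
  ((smooth2_expfac_neg hu 4).mul (((smooth2_Att hf hu).norm_sq.add
    ((Smooth2.const 2).mul (smooth2_Atth hf hu).norm_sq)).add
      (smooth2_Athth hf hu).norm_sq)).mul (smooth2_expfac hu 2)

lemma periodic2_Hmc (hf : Periodic2 f) (hu : Periodic2 u) : Periodic2 (Hmc f u) := fun t θ => by
  simp only [Hmc, hu t θ, hf.pt.pt t θ, hf.pth.pth t θ]

lemma periodic2_Att (hf : Periodic2 f) (hu : Periodic2 u) : Periodic2 (Att f u) := fun t θ => by
  simp only [Att, hf.pt.pt t θ, hu.pt t θ, hu.pth t θ, hf.pt t θ, hf.pth t θ]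

lemma periodic2_Atth (hf : Periodic2 f) (hu : Periodic2 u) : Periodic2 (Atth f u) := fun t θ => by
  simp only [Atth, hf.pth.pt t θ, hu.pt t θ, hu.pth t θ, hf.pt t θ, hf.pth t θ]

lemma periodic2_Athth (hf : Periodic2 f) (hu : Periodic2 u) : Periodic2 (Athth f u) :=
  fun t θ => by
    simp only [Athth, hf.pth.pth t θ, hu.pt t θ, hu.pth t θ, hf.pt t θ, hf.pth t θ]

lemma periodic2_trf₁ (hf : Periodic2 f) (hu : Periodic2 u) : Periodic2 (trf₁ f u) := fun t θ => by
  simp only [trf₁, periodic2_Att hf hu t θ, periodic2_Athth hf hu t θ]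

lemma periodic2_trf₂ (hf : Periodic2 f) (hu : Periodic2 u) : Periodic2 (trf₂ f u) := fun t θ => by
  simp only [trf₂, periodic2_Atth hf hu t θ]

lemma periodic2_cur₂ (hf : Periodic2 f) (hu : Periodic2 u) : Periodic2 (cur₂ f u) := fun t θ => by
  simp only [cur₂, curQ₂, (periodic2_Hmc hf hu).pth t θ, hu t θ, periodic2_Hmc hf hu t θ,
    periodic2_Athth hf hu t θ, periodic2_Atth hf hu t θ, hf.pt t θ, hf.pth t θ]

/-- The Codazzi equation in the `t` direction. -/
lemma codazzi₁ (hf : Smooth2 f) (hu : Smooth2 u) (t θ : ℝ) :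
    pt (trf₁ f u) t θ + pth (trf₂ f u) t θ =
      Real.exp (2 * u t θ) • pt (Hmc f u) t θ - (2 * lapl u t θ) • pt f t θ := by
  have h1 := (((hf.pt.pt.dt t θ).sub ((hu.pt.dt t θ).smul (hf.pt.dt t θ))).add
    ((hu.pth.dt t θ).smul (hf.pth.dt t θ))).sub
    (((hf.pth.pth.dt t θ).add ((hu.pt.dt t θ).smul (hf.pt.dt t θ))).sub
    ((hu.pth.dt t θ).smul (hf.pth.dt t θ)))
  have h2 := (((hf.pth.pt.dth t θ).sub ((hu.pth.dth t θ).smul (hf.pt.dth t θ))).sub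
    ((hu.pt.dth t θ).smul (hf.pth.dth t θ))).const_smul (2 : ℝ)
  have h3 := (((hu.dt t θ).const_mul 2).neg.exp).smul ((hf.pt.pt.dt t θ).add (hf.pth.pth.dt t θ))
  have e1 : pt (trf₁ f u) t θ = _ := h1.deriv
  have e2 : pth (trf₂ f u) t θ = _ := h2.deriv
  have e3 : pt (Hmc f u) t θ = _ := h3.deriv
  rw [e1, e2, e3, hf.pth.pth_pt, hf.pth_pt, hu.pth_pt, lapl, smul_add, smul_smul,
    ← Real.exp_add, smul_smul]
  have e4 : Real.exp (2 * u t θ) * (Real.exp (-(2 * u t θ)) * -(2 * pt u t θ)) =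
      -(2 * pt u t θ) := by
    rw [← mul_assoc, ← Real.exp_add]; simp
  simp only [Pi.neg_apply, Pi.add_apply]
  rw [e4]
  simp only [add_neg_cancel, Real.exp_zero]
  module

/-- The Codazzi equation in the `θ` direction. -/
lemma codazzi₂ (hf : Smooth2 f) (hu : Smooth2 u) (t θ : ℝ) :
    pth (trf₁ f u) t θ - pt (trf₂ f u) t θ =
      -(Real.exp (2 * u t θ) • pth (Hmc f u) t θ) + (2 * lapl u t θ) • pth f t θ := by
  have h1 := (((hf.pt.pt.dth t θ).sub ((hu.pt.dth t θ).smul (hf.pt.dth t θ))).add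
    ((hu.pth.dth t θ).smul (hf.pth.dth t θ))).sub
    (((hf.pth.pth.dth t θ).add ((hu.pt.dth t θ).smul (hf.pt.dth t θ))).sub
    ((hu.pth.dth t θ).smul (hf.pth.dth t θ)))
  have h2 := (((hf.pth.pt.dt t θ).sub ((hu.pth.dt t θ).smul (hf.pt.dt t θ))).sub
    ((hu.pt.dt t θ).smul (hf.pth.dt t θ))).const_smul (2 : ℝ)
  have h3 := (((hu.dth t θ).const_mul 2).neg.exp).smul
    ((hf.pt.pt.dth t θ).add (hf.pth.pth.dth t θ))
  have e1 : pth (trf₁ f u) t θ = _ := h1.deriv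
  have e2 : pt (trf₂ f u) t θ = _ := h2.deriv
  have e3 : pth (Hmc f u) t θ = _ := h3.deriv
  have e5 : pth (pt (pt f)) t θ = pt (pt (pth f)) t θ := by
    rw [hf.pt.pth_pt]
    have : pth (pt f) = pt (pth f) := funext fun t => funext fun θ => hf.pth_pt t θ
    rw [this]
  rw [e1, e2, e3, e5, hf.pth_pt, hu.pth_pt, lapl, smul_add, smul_smul,
    ← Real.exp_add, smul_smul]
  have e4 : Real.exp (2 * u t θ) * (Real.exp (-(2 * u t θ)) * -(2 * pth u t θ)) =
      -(2 * pth u t θ) := by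
    rw [← mul_assoc, ← Real.exp_add]; simp
  simp only [Pi.neg_apply, Pi.add_apply]
  rw [e4]
  simp only [add_neg_cancel, Real.exp_zero]
  module

lemma Att_add_Athth (t θ : ℝ) :
    Att f u t θ + Athth f u t θ = Real.exp (2 * u t θ) • Hmc f u t θ := by
  rw [Hmc, smul_smul, ← Real.exp_add, add_neg_cancel, Real.exp_zero, one_smul, Att, Athth]
  module

lemma Adens_eq (t θ : ℝ) : Adens f u t θ = Real.exp (-(2 * u t θ)) *
    (‖Att f u t θ‖ ^ 2 + 2 * ‖Atth f u t θ‖ ^ 2 + ‖Athth f u t θ‖ ^ 2) := by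
  have : Real.exp (-(2 * u t θ)) = Real.exp (-(4 * u t θ)) * Real.exp (2 * u t θ) := by
    rw [← Real.exp_add]; congr 1; ring
  rw [Adens, Asq, this]; ring

lemma Adens_nonneg (t θ : ℝ) : 0 ≤ Adens f u t θ := by
  rw [Adens_eq]; positivity

lemma Adens_eq_half (t θ : ℝ) : Adens f u t θ = 2⁻¹ * (Real.exp (2 * u t θ) * ‖Hmc f u t θ‖ ^ 2) +
    2⁻¹ * (Real.exp (-(2 * u t θ)) * (‖trf₁ f u t θ‖ ^ 2 + ‖trf₂ f u t θ‖ ^ 2)) := by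
  have h1 : ‖Att f u t θ + Athth f u t θ‖ ^ 2 =
      Real.exp (2 * u t θ) ^ 2 * ‖Hmc f u t θ‖ ^ 2 := by
    rw [Att_add_Athth, norm_smul, mul_pow, Real.norm_eq_abs, sq_abs]
  have h2 := parallelogram_law_with_norm ℝ (Att f u t θ) (Athth f u t θ)
  have h3 : ‖trf₂ f u t θ‖ ^ 2 = 4 * ‖Atth f u t θ‖ ^ 2 := by
    rw [trf₂, norm_smul, mul_pow]; norm_num
  have h4 : Real.exp (-(2 * u t θ)) * Real.exp (2 * u t θ) = 1 := by
    rw [← Real.exp_add]; simp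
  rw [Adens_eq, h3, trf₁]
  generalize Real.exp (2 * u t θ) = E at *
  generalize Real.exp (-(2 * u t θ)) = E' at *
  have h5 : E * ‖Hmc f u t θ‖ ^ 2 = E' * ‖Att f u t θ + Athth f u t θ‖ ^ 2 := by
    rw [h1]; linear_combination (-(E * ‖Hmc f u t θ‖ ^ 2)) * h4
  rw [h5]
  linear_combination (-(E' / 2)) * h2

/-- The Willmore equation is the conservation law for the current. -/
lemma willmoreOp_eq (hf : Smooth2 f) (hu : Smooth2 u) (t θ : ℝ) :
    willmoreOp f u t θ = (2 : ℝ) • (pt (cur₁ f u) t θ + pth (cur₂ f u) t θ) := by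
  have s1 := (smooth2_expfac_neg hu 2).smul
    ((((smooth2_Hmc hf hu).inner (smooth2_Att hf hu)).smul hf.pt).add
      (((smooth2_Hmc hf hu).inner (smooth2_Atth hf hu)).smul hf.pth))
  have s2 := (smooth2_expfac_neg hu 2).smul
    ((((smooth2_Hmc hf hu).inner (smooth2_Atth hf hu)).smul hf.pt).add
      (((smooth2_Hmc hf hu).inner (smooth2_Athth hf hu)).smul hf.pth))
  have s3 := (smooth2_Hmc hf hu).norm_sq.smul hf.pt
  have s4 := (smooth2_Hmc hf hu).norm_sq.smul hf.pth
  have h1 := ((smooth2_Hmc hf hu).pt.dt t θ).add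
    (((s1.dt t θ).const_smul (2 : ℝ)).sub ((s3.dt t θ).const_smul (2⁻¹ : ℝ)))
  have h2 := ((smooth2_Hmc hf hu).pth.dth t θ).add
    (((s2.dth t θ).const_smul (2 : ℝ)).sub ((s4.dth t θ).const_smul (2⁻¹ : ℝ)))
  have e1 : pt (cur₁ f u) t θ = _ := h1.deriv
  have e2 : pth (cur₂ f u) t θ = _ := h2.deriv
  rw [e1, e2, willmoreOp]
  module

end Smoothness

end Geometry

section Conformal

local notation "𝔼" n => EuclideanSpace ℝ (Fin n)

variable {f : ℝ → ℝ → 𝔼 n} {u : ℝ → ℝ → ℝ} {s : Set ℝ} {t : ℝ}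

namespace ConfImm

lemma s2f (hc : ConfImm f u s) : Smooth2 f := hc.smooth_f

lemma s2u (hc : ConfImm f u s) : Smooth2 u := hc.smooth_u

lemma pf (hc : ConfImm f u s) : Periodic2 f := hc.periodic_f

lemma pu (hc : ConfImm f u s) : Periodic2 u := hc.periodic_u

lemma t_tt (hc : ConfImm f u s) (hs : s ∈ nhds t) (θ : ℝ) :
    ⟪pt f t θ, pt (pt f) t θ⟫_ℝ = pt u t θ * Real.exp (2 * u t θ) := by
  have h1 := (hc.s2f.pt.dt t θ).norm_sq.deriv
  have h2 := ((hc.s2u.dt t θ).const_mul 2).exp.deriv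
  have h3 : pt (fun t θ => ‖pt f t θ‖ ^ 2) t θ = pt (fun t θ => Real.exp (2 * u t θ)) t θ :=
    pt_congr hs fun x hx => hc.conf_t x hx θ
  have h4 := (h1.symm.trans h3).trans h2
  linarith

lemma t_tth (hc : ConfImm f u s) (hs : s ∈ nhds t) (θ : ℝ) :
    ⟪pt f t θ, pt (pth f) t θ⟫_ℝ = pth u t θ * Real.exp (2 * u t θ) := by
  have h1 := (hc.s2f.pt.dth t θ).norm_sq.deriv
  have h2 := ((hc.s2u.dth t θ).const_mul 2).exp.deriv
  have h3 : pth (fun t θ => ‖pt f t θ‖ ^ 2) t θ = pth (fun t θ => Real.exp (2 * u t θ)) t θ :=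
    pth_congr (fun x => hc.conf_t t (mem_of_mem_nhds hs) x) θ
  have h4 := (h1.symm.trans h3).trans h2
  rw [hc.s2f.pth_pt] at h4
  linarith

lemma th_tth (hc : ConfImm f u s) (hs : s ∈ nhds t) (θ : ℝ) :
    ⟪pth f t θ, pt (pth f) t θ⟫_ℝ = pt u t θ * Real.exp (2 * u t θ) := by
  have h1 := (hc.s2f.pth.dt t θ).norm_sq.deriv
  have h2 := ((hc.s2u.dt t θ).const_mul 2).exp.deriv
  have h3 : pt (fun t θ => ‖pth f t θ‖ ^ 2) t θ = pt (fun t θ => Real.exp (2 * u t θ)) t θ :=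
    pt_congr hs fun x hx => hc.conf_th x hx θ
  have h4 := (h1.symm.trans h3).trans h2
  linarith

lemma th_thth (hc : ConfImm f u s) (hs : s ∈ nhds t) (θ : ℝ) :
    ⟪pth f t θ, pth (pth f) t θ⟫_ℝ = pth u t θ * Real.exp (2 * u t θ) := by
  have h1 := (hc.s2f.pth.dth t θ).norm_sq.deriv
  have h2 := ((hc.s2u.dth t θ).const_mul 2).exp.deriv
  have h3 : pth (fun t θ => ‖pth f t θ‖ ^ 2) t θ = pth (fun t θ => Real.exp (2 * u t θ)) t θ :=
    pth_congr (fun x => hc.conf_th t (mem_of_mem_nhds hs) x) θ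
  have h4 := (h1.symm.trans h3).trans h2
  linarith

lemma th_tt (hc : ConfImm f u s) (hs : s ∈ nhds t) (θ : ℝ) :
    ⟪pth f t θ, pt (pt f) t θ⟫_ℝ = -(pth u t θ * Real.exp (2 * u t θ)) := by
  have h1 := ((hc.s2f.pt.dt t θ).inner ℝ (hc.s2f.pth.dt t θ)).deriv
  have h3 : pt (fun t θ => ⟪pt f t θ, pth f t θ⟫_ℝ) t θ = pt (fun _ _ => (0 : ℝ)) t θ :=
    pt_congr hs fun x hx => hc.conf_orth x hx θ
  have h4 := (h1.symm.trans h3).trans (deriv_const t (0 : ℝ))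
  rw [hc.t_tth hs, real_inner_comm] at h4
  linarith

lemma t_thth (hc : ConfImm f u s) (hs : s ∈ nhds t) (θ : ℝ) :
    ⟪pt f t θ, pth (pth f) t θ⟫_ℝ = -(pt u t θ * Real.exp (2 * u t θ)) := by
  have h1 := ((hc.s2f.pt.dth t θ).inner ℝ (hc.s2f.pth.dth t θ)).deriv
  have h3 : pth (fun t θ => ⟪pt f t θ, pth f t θ⟫_ℝ) t θ = pth (fun _ _ => (0 : ℝ)) t θ :=
    pth_congr (fun x => hc.conf_orth t (mem_of_mem_nhds hs) x) θ
  have h4 := (h1.symm.trans h3).trans (deriv_const θ (0 : ℝ))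
  rw [hc.s2f.pth_pt, real_inner_comm (pth f t θ), hc.th_tth hs] at h4
  linarith

lemma orth_th (hc : ConfImm f u s) (hs : s ∈ nhds t) (θ : ℝ) :
    ⟪pth f t θ, pt f t θ⟫_ℝ = 0 := by
  rw [real_inner_comm]; exact hc.conf_orth t (mem_of_mem_nhds hs) θ

lemma nt (hc : ConfImm f u s) (hs : s ∈ nhds t) (θ : ℝ) :
    ⟪pt f t θ, pt f t θ⟫_ℝ = Real.exp (2 * u t θ) := by
  rw [real_inner_self_eq_norm_sq]; exact hc.conf_t t (mem_of_mem_nhds hs) θ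

lemma nth (hc : ConfImm f u s) (hs : s ∈ nhds t) (θ : ℝ) :
    ⟪pth f t θ, pth f t θ⟫_ℝ = Real.exp (2 * u t θ) := by
  rw [real_inner_self_eq_norm_sq]; exact hc.conf_th t (mem_of_mem_nhds hs) θ

lemma orth (hc : ConfImm f u s) (hs : s ∈ nhds t) (θ : ℝ) :
    ⟪pt f t θ, pth f t θ⟫_ℝ = 0 := hc.conf_orth t (mem_of_mem_nhds hs) θ

lemma t_Att (hc : ConfImm f u s) (hs : s ∈ nhds t) (θ : ℝ) : ⟪pt f t θ, Att f u t θ⟫_ℝ = 0 := by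
  simp only [Att, inner_add_right, inner_sub_right, inner_smul_right, hc.t_tt hs, hc.nt hs,
    hc.orth hs]
  ring

lemma th_Att (hc : ConfImm f u s) (hs : s ∈ nhds t) (θ : ℝ) : ⟪pth f t θ, Att f u t θ⟫_ℝ = 0 := by
  simp only [Att, inner_add_right, inner_sub_right, inner_smul_right, hc.th_tt hs, hc.nth hs,
    hc.orth_th hs]
  ring

lemma t_Atth (hc : ConfImm f u s) (hs : s ∈ nhds t) (θ : ℝ) :
    ⟪pt f t θ, Atth f u t θ⟫_ℝ = 0 := by
  simp only [Atth, inner_sub_right, inner_smul_right, hc.t_tth hs, hc.nt hs, hc.orth hs]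
  ring

lemma th_Atth (hc : ConfImm f u s) (hs : s ∈ nhds t) (θ : ℝ) :
    ⟪pth f t θ, Atth f u t θ⟫_ℝ = 0 := by
  simp only [Atth, inner_sub_right, inner_smul_right, hc.th_tth hs, hc.nth hs, hc.orth_th hs]
  ring

lemma t_Athth (hc : ConfImm f u s) (hs : s ∈ nhds t) (θ : ℝ) :
    ⟪pt f t θ, Athth f u t θ⟫_ℝ = 0 := by
  simp only [Athth, inner_add_right, inner_sub_right, inner_smul_right, hc.t_thth hs, hc.nt hs,
    hc.orth hs]
  ring

lemma th_Athth (hc : ConfImm f u s) (hs : s ∈ nhds t) (θ : ℝ) :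
    ⟪pth f t θ, Athth f u t θ⟫_ℝ = 0 := by
  simp only [Athth, inner_add_right, inner_sub_right, inner_smul_right, hc.th_thth hs, hc.nth hs,
    hc.orth_th hs]
  ring

lemma t_trf₁ (hc : ConfImm f u s) (hs : s ∈ nhds t) (θ : ℝ) :
    ⟪pt f t θ, trf₁ f u t θ⟫_ℝ = 0 := by
  rw [trf₁, inner_sub_right, hc.t_Att hs, hc.t_Athth hs, sub_zero]

lemma th_trf₁ (hc : ConfImm f u s) (hs : s ∈ nhds t) (θ : ℝ) :
    ⟪pth f t θ, trf₁ f u t θ⟫_ℝ = 0 := by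
  rw [trf₁, inner_sub_right, hc.th_Att hs, hc.th_Athth hs, sub_zero]

lemma t_trf₂ (hc : ConfImm f u s) (hs : s ∈ nhds t) (θ : ℝ) :
    ⟪pt f t θ, trf₂ f u t θ⟫_ℝ = 0 := by
  rw [trf₂, inner_smul_right, hc.t_Atth hs, mul_zero]

lemma th_trf₂ (hc : ConfImm f u s) (hs : s ∈ nhds t) (θ : ℝ) :
    ⟪pth f t θ, trf₂ f u t θ⟫_ℝ = 0 := by
  rw [trf₂, inner_smul_right, hc.th_Atth hs, mul_zero]

lemma t_Hmc (hc : ConfImm f u s) (hs : s ∈ nhds t) (θ : ℝ) :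
    ⟪pt f t θ, Hmc f u t θ⟫_ℝ = 0 := by
  rw [Hmc, inner_smul_right, inner_add_right, hc.t_tt hs, hc.t_thth hs]
  ring

lemma th_Hmc (hc : ConfImm f u s) (hs : s ∈ nhds t) (θ : ℝ) :
    ⟪pth f t θ, Hmc f u t θ⟫_ℝ = 0 := by
  rw [Hmc, inner_smul_right, inner_add_right, hc.th_tt hs, hc.th_thth hs]
  ring

/-- The Gauss equation. -/
lemma gauss (hc : ConfImm f u s) (hs : s ∈ nhds t) (θ : ℝ) :
    lapl u t θ * Real.exp (2 * u t θ) =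
      ‖Atth f u t θ‖ ^ 2 - ⟪Att f u t θ, Athth f u t θ⟫_ℝ := by
  have hE : HasDerivAt (fun θ => Real.exp (2 * u t θ)) _ θ :=
    ((hc.s2u.dth t θ).const_mul 2).exp
  have hE' : HasDerivAt (fun t => Real.exp (2 * u t θ)) _ t :=
    ((hc.s2u.dt t θ).const_mul 2).exp
  have h1 := ((hc.s2f.pt.dth t θ).inner ℝ (hc.s2f.pth.pt.dth t θ)).deriv
  have h2 := ((hc.s2u.pth.dth t θ).mul hE).deriv
  have h3 : pth (fun t θ => ⟪pt f t θ, pt (pth f) t θ⟫_ℝ) t θ =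
      pth (fun t θ => pth u t θ * Real.exp (2 * u t θ)) t θ :=
    pth_congr (fun x => hc.t_tth hs x) θ
  have h4 := (h1.symm.trans h3).trans h2
  have k1 := ((hc.s2f.pt.dt t θ).inner ℝ (hc.s2f.pth.pth.dt t θ)).deriv
  have k2 := ((hc.s2u.pt.dt t θ).mul hE').neg.deriv
  have k3 : pt (fun t θ => ⟪pt f t θ, pth (pth f) t θ⟫_ℝ) t θ =
      pt (fun t θ => -(pt u t θ * Real.exp (2 * u t θ))) t θ :=
    pt_congr (s := interior s) (interior_mem_nhds.2 hs) fun x hx =>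
      hc.t_thth (mem_interior_iff_mem_nhds.1 hx) θ
  have k4 := (k1.symm.trans k3).trans k2
  rw [hc.s2f.pth.pth_pt, hc.s2f.pth_pt, real_inner_self_eq_norm_sq] at h4
  have e1 : ‖Atth f u t θ‖ ^ 2 = ‖pt (pth f) t θ‖ ^ 2 -
      (pth u t θ ^ 2 + pt u t θ ^ 2) * Real.exp (2 * u t θ) := by
    have : ∀ Z, ⟪pt f t θ, Z⟫_ℝ = 0 → ⟪pth f t θ, Z⟫_ℝ = 0 →
        ⟪Atth f u t θ, Z⟫_ℝ = ⟪pt (pth f) t θ, Z⟫_ℝ := fun Z h1 h2 => by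
      rw [Atth, inner_sub_left, inner_sub_left, inner_smul_left, inner_smul_left, h1, h2]
      simp
    rw [← real_inner_self_eq_norm_sq, this _ (hc.t_Atth hs θ) (hc.th_Atth hs θ), Atth, inner_sub_right, inner_sub_right,
      inner_smul_right, inner_smul_right, real_inner_comm (pt f t θ), real_inner_comm (pth f t θ),
      hc.t_tth hs, hc.th_tth hs, real_inner_self_eq_norm_sq]
    ring
  have e2 : ⟪Att f u t θ, Athth f u t θ⟫_ℝ = ⟪pt (pt f) t θ, pth (pth f) t θ⟫_ℝ +
      (pth u t θ ^ 2 + pt u t θ ^ 2) * Real.exp (2 * u t θ) := by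
    have : ⟪Att f u t θ, Athth f u t θ⟫_ℝ = ⟪pt (pt f) t θ, Athth f u t θ⟫_ℝ := by
      rw [Att, inner_add_left, inner_sub_left, inner_smul_left, inner_smul_left, hc.t_Athth hs,
        hc.th_Athth hs]
      simp
    rw [this, Athth, inner_sub_right, inner_add_right, inner_smul_right, inner_smul_right,
      real_inner_comm (pt f t θ), real_inner_comm (pth f t θ), hc.t_tt hs, hc.th_tt hs]
    ring
  rw [e1, e2, lapl]
  linear_combination k4 - h4

lemma abs_lapl_le (hc : ConfImm f u s) (hs : s ∈ nhds t) (θ : ℝ) :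
    |lapl u t θ| ≤ Adens f u t θ := by
  have h := hc.gauss hs θ
  have h1 := abs_real_inner_le_norm (Att f u t θ) (Athth f u t θ)
  have h4 : Real.exp (-(2 * u t θ)) * Real.exp (2 * u t θ) = 1 := by
    rw [← Real.exp_add]; simp
  have h5 : lapl u t θ = Real.exp (-(2 * u t θ)) *
      (‖Atth f u t θ‖ ^ 2 - ⟪Att f u t θ, Athth f u t θ⟫_ℝ) := by
    rw [← h]; linear_combination (-lapl u t θ) * h4
  rw [h5, abs_mul, abs_of_pos (Real.exp_pos _), Adens_eq]
  refine mul_le_mul_of_nonneg_left ?_ (Real.exp_pos _).le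
  rw [abs_le] at h1 ⊢
  constructor <;> nlinarith [sq_nonneg (‖Att f u t θ‖ - ‖Athth f u t θ‖),
    sq_nonneg (‖Atth f u t θ‖), sq_nonneg (‖Att f u t θ‖), sq_nonneg (‖Athth f u t θ‖)]

lemma norm_t (hc : ConfImm f u s) (hs : s ∈ nhds t) (θ : ℝ) :
    ‖pt f t θ‖ = Real.exp (u t θ) := by
  have h := hc.conf_t t (mem_of_mem_nhds hs) θ
  rw [two_mul, Real.exp_add, ← sq] at h
  exact (pow_left_inj₀ (norm_nonneg _) (Real.exp_pos _).le two_ne_zero).1 h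

lemma norm_th (hc : ConfImm f u s) (hs : s ∈ nhds t) (θ : ℝ) :
    ‖pth f t θ‖ = Real.exp (u t θ) := by
  have h := hc.conf_th t (mem_of_mem_nhds hs) θ
  rw [two_mul, Real.exp_add, ← sq] at h
  exact (pow_left_inj₀ (norm_nonneg _) (Real.exp_pos _).le two_ne_zero).1 h

end ConfImm

lemma norm_le_exp_mul_sqrt {V : Type*} [NormedAddCommGroup V] {x : V} {a z : ℝ}
    (h : Real.exp (-(2 * a)) * ‖x‖ ^ 2 ≤ z) : ‖x‖ ≤ Real.exp a * √z := by
  have h1 : ‖x‖ ^ 2 ≤ Real.exp a ^ 2 * z := by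
    have h2 : Real.exp a ^ 2 * Real.exp (-(2 * a)) = 1 := by
      rw [sq, ← Real.exp_add, ← Real.exp_add]; ring_nf; exact Real.exp_zero
    calc ‖x‖ ^ 2 = Real.exp a ^ 2 * (Real.exp (-(2 * a)) * ‖x‖ ^ 2) := by
          linear_combination (-‖x‖ ^ 2) * h2
      _ ≤ _ := mul_le_mul_of_nonneg_left h (by positivity)
  have hz : 0 ≤ z := le_trans (by positivity) h
  rw [← Real.sqrt_sq (Real.exp_pos a).le, ← Real.sqrt_mul (by positivity)]
  exact Real.le_sqrt_of_sq_le h1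

lemma norm_Att_le (θ : ℝ) : ‖Att f u t θ‖ ≤ Real.exp (u t θ) * √(Adens f u t θ) := by
  refine norm_le_exp_mul_sqrt ?_
  rw [Adens_eq]
  refine mul_le_mul_of_nonneg_left ?_ (Real.exp_pos _).le
  nlinarith [sq_nonneg (‖Atth f u t θ‖),
    sq_nonneg (‖Athth f u t θ‖)]

lemma norm_Atth_le (θ : ℝ) : ‖Atth f u t θ‖ ≤ Real.exp (u t θ) * √(Adens f u t θ) := by
  refine norm_le_exp_mul_sqrt ?_
  rw [Adens_eq]
  refine mul_le_mul_of_nonneg_left ?_ (Real.exp_pos _).le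
  nlinarith [sq_nonneg (‖Atth f u t θ‖),
    sq_nonneg (‖Athth f u t θ‖), sq_nonneg (‖Att f u t θ‖)]

lemma norm_Athth_le (θ : ℝ) : ‖Athth f u t θ‖ ≤ Real.exp (u t θ) * √(Adens f u t θ) := by
  refine norm_le_exp_mul_sqrt ?_
  rw [Adens_eq]
  refine mul_le_mul_of_nonneg_left ?_ (Real.exp_pos _).le
  nlinarith [sq_nonneg (‖Atth f u t θ‖),
    sq_nonneg (‖Att f u t θ‖)]

lemma exp_mul_norm_Hmc_le (θ : ℝ) :
    Real.exp (u t θ) * ‖Hmc f u t θ‖ ≤ 3 / 2 * √(Adens f u t θ) := by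
  refine le_of_sq_le_sq ?_ (by positivity)
  have h := Adens_eq_half (f := f) (u := u) t θ
  have h1 : 0 ≤ 2⁻¹ * (Real.exp (-(2 * u t θ)) * (‖trf₁ f u t θ‖ ^ 2 + ‖trf₂ f u t θ‖ ^ 2)) := by
    positivity
  have h0 := Adens_nonneg (f := f) (u := u) t θ
  have h2 : Real.exp (2 * u t θ) = Real.exp (u t θ) ^ 2 := by rw [two_mul, Real.exp_add, sq]
  rw [mul_pow, mul_pow, Real.sq_sqrt h0, ← h2]
  linarith

/-- A bilinear bound for products with the mean curvature. -/
lemma abs_inner_Hmc_le {X : 𝔼 n} {θ : ℝ}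
    (h : ‖X‖ ≤ Real.exp (u t θ) * √(Adens f u t θ)) :
    |⟪Hmc f u t θ, X⟫_ℝ| ≤ 3 / 2 * Adens f u t θ := by
  have h1 := exp_mul_norm_Hmc_le (f := f) (u := u) (t := t) θ
  calc |⟪Hmc f u t θ, X⟫_ℝ| ≤ ‖Hmc f u t θ‖ * ‖X‖ := abs_real_inner_le_norm _ _
    _ ≤ ‖Hmc f u t θ‖ * (Real.exp (u t θ) * √(Adens f u t θ)) := by gcongr
    _ = (Real.exp (u t θ) * ‖Hmc f u t θ‖) * √(Adens f u t θ) := by ring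
    _ ≤ (3 / 2 * √(Adens f u t θ)) * √(Adens f u t θ) := by gcongr
    _ = _ := by rw [mul_assoc, Real.mul_self_sqrt (Adens_nonneg _ _)]

lemma quadratic_current_bound {x y : 𝔼 n} {a p r h z E : ℝ} (hz : 0 ≤ z)
    (hx : ‖x‖ = E) (hy : ‖y‖ = E) (hE : E * E * a = 1) (ha : 0 ≤ a)
    (hp : |p| ≤ 3 / 2 * z) (hr : |r| ≤ 3 / 2 * z) (hh : E * h ≤ 3 / 2 * √z) (hh0 : 0 ≤ E * h)
    (w : 𝔼 n) (hw : ‖w‖ = E) :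
    E * ‖(2 : ℝ) • a • (p • x + r • y) - (2⁻¹ : ℝ) • h ^ 2 • w‖ ≤ 8 * z := by
  have hE0 : 0 ≤ E := hx ▸ norm_nonneg x
  have h1 : ‖(2 : ℝ) • a • (p • x + r • y) - (2⁻¹ : ℝ) • h ^ 2 • w‖ ≤
      2 * (a * (|p| * E + |r| * E)) + 2⁻¹ * (h ^ 2 * E) := by
    refine (norm_sub_le _ _).trans (add_le_add ?_ ?_)
    · rw [norm_smul, norm_smul, Real.norm_eq_abs a, abs_of_nonneg ha]
      norm_num only [Real.norm_eq_abs, abs_two]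
      refine mul_le_mul_of_nonneg_left (mul_le_mul_of_nonneg_left ?_ ha) two_pos.le
      refine (norm_add_le _ _).trans (le_of_eq ?_)
      rw [norm_smul, norm_smul, hx, hy, Real.norm_eq_abs, Real.norm_eq_abs]
    · rw [norm_smul, norm_smul, hw, Real.norm_eq_abs, Real.norm_eq_abs, abs_of_pos (by norm_num),
        abs_of_nonneg (sq_nonneg h)]
  have h2 : (E * h) ^ 2 ≤ (3 / 2 * √z) ^ 2 := pow_le_pow_left₀ hh0 hh 2
  rw [mul_pow (3 / 2 : ℝ), Real.sq_sqrt hz] at h2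
  calc _ ≤ E * (2 * (a * (|p| * E + |r| * E)) + 2⁻¹ * (h ^ 2 * E)) :=
        mul_le_mul_of_nonneg_left h1 hE0
    _ = 2 * (|p| + |r|) * (E * E * a) + 2⁻¹ * (E * h) ^ 2 := by ring
    _ ≤ _ := by rw [hE]; linarith

namespace ConfImm

lemma norm_curQ₁_le (hc : ConfImm f u s) (hs : s ∈ nhds t) (θ : ℝ) :
    Real.exp (u t θ) * ‖curQ₁ f u t θ‖ ≤ 8 * Adens f u t θ := by
  refine quadratic_current_bound (Adens_nonneg _ _) (hc.norm_t hs θ) (hc.norm_th hs θ) ?_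
    (Real.exp_pos _).le (abs_inner_Hmc_le (norm_Att_le θ)) (abs_inner_Hmc_le (norm_Atth_le θ))
    (exp_mul_norm_Hmc_le θ) (by positivity) _ (hc.norm_t hs θ)
  rw [← Real.exp_add, ← Real.exp_add]; ring_nf; exact Real.exp_zero

lemma norm_curQ₂_le (hc : ConfImm f u s) (hs : s ∈ nhds t) (θ : ℝ) :
    Real.exp (u t θ) * ‖curQ₂ f u t θ‖ ≤ 8 * Adens f u t θ := by
  refine quadratic_current_bound (Adens_nonneg _ _) (hc.norm_t hs θ) (hc.norm_th hs θ) ?_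
    (Real.exp_pos _).le (abs_inner_Hmc_le (norm_Atth_le θ)) (abs_inner_Hmc_le (norm_Athth_le θ))
    (exp_mul_norm_Hmc_le θ) (by positivity) _ (hc.norm_th hs θ)
  rw [← Real.exp_add, ← Real.exp_add]; ring_nf; exact Real.exp_zero

lemma curQ_sq_le (hc : ConfImm f u s) (hs : s ∈ nhds t) (θ : ℝ) :
    Real.exp (2 * u t θ) * (‖curQ₁ f u t θ‖ ^ 2 + ‖curQ₂ f u t θ‖ ^ 2) ≤
      128 * Adens f u t θ ^ 2 := by
  have h1 := pow_le_pow_left₀ (by positivity) (hc.norm_curQ₁_le hs θ) 2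
  have h2 := pow_le_pow_left₀ (by positivity) (hc.norm_curQ₂_le hs θ) 2
  have h3 : Real.exp (2 * u t θ) = Real.exp (u t θ) ^ 2 := by rw [two_mul, Real.exp_add, sq]
  rw [h3]
  nlinarith

lemma codazzi_sq_le (hc : ConfImm f u s) (hs : s ∈ nhds t) (θ : ℝ) :
    Real.exp (-(2 * u t θ)) * (‖pt (trf₁ f u) t θ + pth (trf₂ f u) t θ‖ ^ 2 +
      ‖pth (trf₁ f u) t θ - pt (trf₂ f u) t θ‖ ^ 2) ≤
    2 * (Real.exp (2 * u t θ) * (‖pt (Hmc f u) t θ‖ ^ 2 + ‖pth (Hmc f u) t θ‖ ^ 2)) +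
      16 * Adens f u t θ ^ 2 := by
  have hz := sq_le_sq' (by have := abs_le.1 (hc.abs_lapl_le hs θ); linarith)
    (abs_le.1 (hc.abs_lapl_le hs θ)).2
  have h4 : Real.exp (-(2 * u t θ)) * Real.exp (2 * u t θ) = 1 := by
    rw [← Real.exp_add]; simp
  have key : ∀ x y : 𝔼 n, ‖x - y‖ ^ 2 ≤ 2 * ‖x‖ ^ 2 + 2 * ‖y‖ ^ 2 := fun x y => by
    have := parallelogram_law_with_norm ℝ x y
    nlinarith [sq_nonneg (‖x + y‖)]
  have k1 := key (Real.exp (2 * u t θ) • pt (Hmc f u) t θ) ((2 * lapl u t θ) • pt f t θ)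
  have k2 := key ((2 * lapl u t θ) • pth f t θ) (Real.exp (2 * u t θ) • pth (Hmc f u) t θ)
  have e2 : pth (trf₁ f u) t θ - pt (trf₂ f u) t θ =
      (2 * lapl u t θ) • pth f t θ - Real.exp (2 * u t θ) • pth (Hmc f u) t θ := by
    rw [codazzi₂ hc.s2f hc.s2u]; abel
  rw [codazzi₁ hc.s2f hc.s2u, e2]
  simp only [norm_smul, mul_pow, Real.norm_eq_abs, sq_abs,
    hc.conf_t t (mem_of_mem_nhds hs), hc.conf_th t (mem_of_mem_nhds hs)] at k1 k2
  refine (mul_le_mul_of_nonneg_left (add_le_add k1 k2) (Real.exp_pos _).le).trans ?_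
  generalize Real.exp (2 * u t θ) = E at *
  generalize Real.exp (-(2 * u t θ)) = E' at *
  have e3 : E' * (2 * (E ^ 2 * ‖pt (Hmc f u) t θ‖ ^ 2) + 2 * (2 ^ 2 * lapl u t θ ^ 2 * E) +
      (2 * (2 ^ 2 * lapl u t θ ^ 2 * E) + 2 * (E ^ 2 * ‖pth (Hmc f u) t θ‖ ^ 2))) =
      2 * (E * (‖pt (Hmc f u) t θ‖ ^ 2 + ‖pth (Hmc f u) t θ‖ ^ 2)) + 16 * lapl u t θ ^ 2 := by
    linear_combination (2 * E * (‖pt (Hmc f u) t θ‖ ^ 2 + ‖pth (Hmc f u) t θ‖ ^ 2) +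
      16 * lapl u t θ ^ 2) * h4
  rw [e3]
  linarith

end ConfImm

lemma ConfWillmore.div_cur (hc : ConfWillmore f u s) (hs : t ∈ s) (θ : ℝ) :
    pt (cur₁ f u) t θ + pth (cur₂ f u) t θ = 0 := by
  have h := hc.willmore t hs θ
  rw [willmoreOp_eq hc.smooth_f hc.smooth_u] at h
  exact (smul_eq_zero.1 h).resolve_left two_ne_zero

end Conformal

section Energy

/-- The integral over the strip `[a,b] × S¹`. -/
def stripInt (F : ℝ → ℝ → ℝ) (a b : ℝ) : ℝ := ∫ t in a..b, circInt F t

lemma stripInt_add {F G : ℝ → ℝ → ℝ} (hF : Cont2 F) (hG : Cont2 G) (a b : ℝ) :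
    stripInt (fun t θ => F t θ + G t θ) a b = stripInt F a b + stripInt G a b := by
  unfold stripInt
  rw [← intervalIntegral.integral_add (hF.circInt.intervalIntegrable _ _)
    (hG.circInt.intervalIntegrable _ _)]
  exact intervalIntegral.integral_congr fun t _ => circInt_add hF hG t

lemma stripInt_const_mul (c : ℝ) (F : ℝ → ℝ → ℝ) (a b : ℝ) :
    stripInt (fun t θ => c * F t θ) a b = c * stripInt F a b := by
  unfold stripInt
  rw [← intervalIntegral.integral_const_mul]
  exact intervalIntegral.integral_congr fun t _ => circInt_const_mul c F t

lemma stripInt_mono {F G : ℝ → ℝ → ℝ} {a b : ℝ} (hab : a ≤ b) (hF : Cont2 F) (hG : Cont2 G)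
    (h : ∀ t ∈ Icc a b, ∀ θ, F t θ ≤ G t θ) : stripInt F a b ≤ stripInt G a b :=
  intervalIntegral.integral_mono_on hab (hF.circInt.intervalIntegrable _ _)
    (hG.circInt.intervalIntegrable _ _) fun t ht => circInt_mono hF hG (h t ht)

lemma stripInt_nonneg {F : ℝ → ℝ → ℝ} {a b : ℝ} (hab : a ≤ b) (h : ∀ t θ, 0 ≤ F t θ) :
    0 ≤ stripInt F a b :=
  intervalIntegral.integral_nonneg hab fun t _ => circInt_nonneg (h t)

lemma stripInt_fst_mul (c : ℝ → ℝ) (F : ℝ → ℝ → ℝ) (a b : ℝ) :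
    stripInt (fun t θ => c t * F t θ) a b = ∫ t in a..b, c t * circInt F t :=
  intervalIntegral.integral_congr fun t _ => circInt_fst_mul c F t

lemma stripInt_mono_interval {F : ℝ → ℝ → ℝ} {a b a' b' : ℝ} (hF : Cont2 F) (h0 : ∀ t θ, 0 ≤ F t θ)
    (h1 : a ≤ a') (h2 : a' ≤ b') (h3 : b' ≤ b) : stripInt F a' b' ≤ stripInt F a b :=
  intervalIntegral.integral_mono_interval h1 h2 h3
    (ae_of_all _ fun t => circInt_nonneg (h0 t)) (hF.circInt.intervalIntegrable _ _)

variable {V : Type*} [NormedAddCommGroup V] [InnerProductSpace ℝ V]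

lemma caccioppoli_pointwise (p q h : V) (x a : ℝ) :
    2⁻¹ * (x ^ 2 * ‖p‖ ^ 2) - 2 * (x ^ 2 * ‖q‖ ^ 2) - 5 * (a ^ 2 * ‖h‖ ^ 2) ≤
      2 * x * a * ⟪h, p + q⟫_ℝ + x ^ 2 * ⟪p, p + q⟫_ℝ := by
  have h1 := sq_nonneg ‖(2⁻¹ * x) • p + x • q‖
  have h2 := sq_nonneg ‖(2⁻¹ * x) • p + (2 * a) • h‖
  have h3 := sq_nonneg ‖x • q + a • h‖
  rw [norm_add_sq_real] at h1 h2 h3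
  simp only [norm_smul, inner_smul_left, inner_smul_right, mul_pow, Real.norm_eq_abs, sq_abs,
    conj_trivial] at h1 h2 h3
  rw [inner_add_right, inner_add_right, real_inner_self_eq_norm_sq]
  rw [real_inner_comm] at h2 h3
  nlinarith

lemma caccioppoli_div {H P W : ℝ → ℝ → V} {χ : ℝ → ℝ → ℝ} {a b : ℝ} (hab : a ≤ b)
    (hH : Smooth2 H) (hP : Smooth2 P) (hW : Smooth2 W) (hχ : Smooth2 χ)
    (pH : Periodic2 H) (pW : Periodic2 W) (pχ : Periodic2 χ)
    (ha : ∀ θ, χ a θ = 0) (hb : ∀ θ, χ b θ = 0)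
    (hdiv : ∀ t ∈ Icc a b, ∀ θ, pt P t θ + pth W t θ = 0) :
    stripInt (fun t θ => χ t θ ^ 2 * (‖pt H t θ‖ ^ 2 + ‖pth H t θ‖ ^ 2)) a b ≤
      4 * stripInt (fun t θ => χ t θ ^ 2 *
        (‖P t θ - pt H t θ‖ ^ 2 + ‖W t θ - pth H t θ‖ ^ 2)) a b +
      10 * stripInt (fun t θ => (pt χ t θ ^ 2 + pth χ t θ ^ 2) * ‖H t θ‖ ^ 2) a b := by
  have c1 : Cont2 fun t θ => χ t θ ^ 2 * (‖pt H t θ‖ ^ 2 + ‖pth H t θ‖ ^ 2) :=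
    ((hχ.pow 2).mul (hH.pt.norm_sq.add hH.pth.norm_sq)).cont
  have c2 : Cont2 fun t θ => χ t θ ^ 2 * (‖P t θ - pt H t θ‖ ^ 2 + ‖W t θ - pth H t θ‖ ^ 2) :=
    ((hχ.pow 2).mul ((hP.sub hH.pt).norm_sq.add (hW.sub hH.pth).norm_sq)).cont
  have c3 : Cont2 fun t θ => (pt χ t θ ^ 2 + pth χ t θ ^ 2) * ‖H t θ‖ ^ 2 :=
    (((hχ.pt.pow 2).add (hχ.pth.pow 2)).mul hH.norm_sq).cont
  have cG := ((Cont2.const (2⁻¹ : ℝ)).mul c1).add (((Cont2.const (-2 : ℝ)).mul c2).add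
    ((Cont2.const (-5 : ℝ)).mul c3))
  have key := integral_div_nonpos (U := fun t θ => χ t θ ^ 2 * ⟪H t θ, P t θ⟫_ℝ)
    (K := fun t θ => χ t θ ^ 2 * ⟪H t θ, W t θ⟫_ℝ)
    (G := fun t θ => 2⁻¹ * (χ t θ ^ 2 * (‖pt H t θ‖ ^ 2 + ‖pth H t θ‖ ^ 2)) +
      ((-2) * (χ t θ ^ 2 * (‖P t θ - pt H t θ‖ ^ 2 + ‖W t θ - pth H t θ‖ ^ 2)) +
      (-5) * ((pt χ t θ ^ 2 + pth χ t θ ^ 2) * ‖H t θ‖ ^ 2))) hab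
    ((hχ.pow 2).mul (hH.inner hP)) ((hχ.pow 2).mul (hH.inner hW))
    (fun t θ => by simp only [pχ t θ, pH t θ, pW t θ]) (fun θ => by simp [ha])
    (fun θ => by simp [hb])
    cG ?_
  · have e := stripInt_add ((Cont2.const 2⁻¹).mul c1)
      (((Cont2.const (-2)).mul c2).add ((Cont2.const (-5)).mul c3)) a b
    rw [stripInt_add ((Cont2.const (-2)).mul c2) ((Cont2.const (-5)).mul c3),
      stripInt_const_mul, stripInt_const_mul, stripInt_const_mul] at e
    change stripInt _ a b ≤ 0 at key
    linarith
  · intro t ht θ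
    have e1 : pt (fun t θ => χ t θ ^ 2 * ⟪H t θ, P t θ⟫_ℝ) t θ = _ :=
      (((hχ.dt t θ).pow 2).mul ((hH.dt t θ).inner ℝ (hP.dt t θ))).deriv
    have e2 : pth (fun t θ => χ t θ ^ 2 * ⟪H t θ, W t θ⟫_ℝ) t θ = _ :=
      (((hχ.dth t θ).pow 2).mul ((hH.dth t θ).inner ℝ (hW.dth t θ))).deriv
    rw [e1, e2]
    have h1 := caccioppoli_pointwise (pt H t θ) (P t θ - pt H t θ) (H t θ) (χ t θ) (pt χ t θ)
    have h2 := caccioppoli_pointwise (pth H t θ) (W t θ - pth H t θ) (H t θ) (χ t θ) (pth χ t θ)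
    rw [add_sub_cancel] at h1 h2
    have h3 : ⟪H t θ, pt P t θ⟫_ℝ + ⟪H t θ, pth W t θ⟫_ℝ = 0 := by
      rw [← inner_add_right, hdiv t ht, inner_zero_right]
    have h4 : χ t θ ^ 2 * (⟪H t θ, pt P t θ⟫_ℝ + ⟪H t θ, pth W t θ⟫_ℝ) = 0 := by
      rw [h3, mul_zero]
    simp only [Pi.pow_apply] at *
    push_cast
    linarith

lemma curl_pointwise (a b c d h : V) (x p q : ℝ) :
    4⁻¹ * (x ^ 2 * (‖a‖ ^ 2 + ‖b‖ ^ 2 + ‖c‖ ^ 2 + ‖d‖ ^ 2)) -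
      2⁻¹ * (x ^ 2 * (‖a + d‖ ^ 2 + ‖b - c‖ ^ 2)) - 4 * ((p ^ 2 + q ^ 2) * ‖h‖ ^ 2) ≤
      -(2 * x * p * ⟪h, d⟫_ℝ + x ^ 2 * ⟪a, d⟫_ℝ) + (2 * x * q * ⟪h, c⟫_ℝ + x ^ 2 * ⟪b, c⟫_ℝ) := by
  have h1 := sq_nonneg ‖(2⁻¹ * x) • d - (2 * p) • h‖
  have h2 := sq_nonneg ‖(2⁻¹ * x) • c + (2 * q) • h‖
  rw [norm_sub_sq_real] at h1
  rw [norm_add_sq_real] at h2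
  simp only [norm_smul, inner_smul_left, inner_smul_right, mul_pow, Real.norm_eq_abs, sq_abs,
    conj_trivial] at h1 h2
  rw [norm_add_sq_real, norm_sub_sq_real]
  rw [real_inner_comm] at h1 h2
  nlinarith [mul_nonneg (sq_nonneg x) (sq_nonneg ‖a‖), mul_nonneg (sq_nonneg x) (sq_nonneg ‖b‖)]

lemma caccioppoli_curl {A B : ℝ → ℝ → V} {χ : ℝ → ℝ → ℝ} {a b : ℝ} (hab : a ≤ b)
    (hA : Smooth2 A) (hB : Smooth2 B) (hχ : Smooth2 χ)
    (pA : Periodic2 A) (pB : Periodic2 B) (pχ : Periodic2 χ)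
    (ha : ∀ θ, χ a θ = 0) (hb : ∀ θ, χ b θ = 0) :
    stripInt (fun t θ => χ t θ ^ 2 * (‖pt A t θ‖ ^ 2 + ‖pth A t θ‖ ^ 2 + ‖pt B t θ‖ ^ 2 +
        ‖pth B t θ‖ ^ 2)) a b ≤
      2 * stripInt (fun t θ => χ t θ ^ 2 *
        (‖pt A t θ + pth B t θ‖ ^ 2 + ‖pth A t θ - pt B t θ‖ ^ 2)) a b +
      16 * stripInt (fun t θ => (pt χ t θ ^ 2 + pth χ t θ ^ 2) * ‖A t θ‖ ^ 2) a b := by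
  have c1 : Cont2 fun t θ => χ t θ ^ 2 * (‖pt A t θ‖ ^ 2 + ‖pth A t θ‖ ^ 2 + ‖pt B t θ‖ ^ 2 +
      ‖pth B t θ‖ ^ 2) :=
    ((hχ.pow 2).mul (((hA.pt.norm_sq.add hA.pth.norm_sq).add hB.pt.norm_sq).add
      hB.pth.norm_sq)).cont
  have c2 : Cont2 fun t θ => χ t θ ^ 2 *
      (‖pt A t θ + pth B t θ‖ ^ 2 + ‖pth A t θ - pt B t θ‖ ^ 2) :=
    ((hχ.pow 2).mul ((hA.pt.add hB.pth).norm_sq.add (hA.pth.sub hB.pt).norm_sq)).cont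
  have c3 : Cont2 fun t θ => (pt χ t θ ^ 2 + pth χ t θ ^ 2) * ‖A t θ‖ ^ 2 :=
    (((hχ.pt.pow 2).add (hχ.pth.pow 2)).mul hA.norm_sq).cont
  have cG := ((Cont2.const (4⁻¹ : ℝ)).mul c1).add (((Cont2.const (-2⁻¹ : ℝ)).mul c2).add
    ((Cont2.const (-4 : ℝ)).mul c3))
  have key := integral_div_nonpos (U := fun t θ => -(χ t θ ^ 2 * ⟪A t θ, pth B t θ⟫_ℝ))
    (K := fun t θ => χ t θ ^ 2 * ⟪A t θ, pt B t θ⟫_ℝ)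
    (G := fun t θ => 4⁻¹ * (χ t θ ^ 2 * (‖pt A t θ‖ ^ 2 + ‖pth A t θ‖ ^ 2 + ‖pt B t θ‖ ^ 2 +
        ‖pth B t θ‖ ^ 2)) +
      ((-2⁻¹) * (χ t θ ^ 2 * (‖pt A t θ + pth B t θ‖ ^ 2 + ‖pth A t θ - pt B t θ‖ ^ 2)) +
      (-4) * ((pt χ t θ ^ 2 + pth χ t θ ^ 2) * ‖A t θ‖ ^ 2))) hab
    (((hχ.pow 2).mul (hA.inner hB.pth)).neg) ((hχ.pow 2).mul (hA.inner hB.pt))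
    (fun t θ => by simp only [pχ t θ, pA t θ, pB.pt t θ]) (fun θ => by simp [ha])
    (fun θ => by simp [hb])
    cG ?_
  · have e := stripInt_add ((Cont2.const 4⁻¹).mul c1)
      (((Cont2.const (-2⁻¹)).mul c2).add ((Cont2.const (-4)).mul c3)) a b
    rw [stripInt_add ((Cont2.const (-2⁻¹)).mul c2) ((Cont2.const (-4)).mul c3),
      stripInt_const_mul, stripInt_const_mul, stripInt_const_mul] at e
    change stripInt _ a b ≤ 0 at key
    linarith
  · intro t ht θ
    have e1 : pt (fun t θ => -(χ t θ ^ 2 * ⟪A t θ, pth B t θ⟫_ℝ)) t θ = _ :=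
      (((hχ.dt t θ).pow 2).mul ((hA.dt t θ).inner ℝ (hB.pth.dt t θ))).neg.deriv
    have e2 : pth (fun t θ => χ t θ ^ 2 * ⟪A t θ, pt B t θ⟫_ℝ) t θ = _ :=
      (((hχ.dth t θ).pow 2).mul ((hA.dth t θ).inner ℝ (hB.pt.dth t θ))).deriv
    rw [e1, e2, hB.pth_pt]
    have h1 := curl_pointwise (pt A t θ) (pth A t θ) (pt B t θ) (pth B t θ) (A t θ) (χ t θ)
      (pt χ t θ) (pth χ t θ)
    simp only [Pi.pow_apply] at *
    push_cast
    linarith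

end Energy

section Local

local notation "𝔼" n => EuclideanSpace ℝ (Fin n)

/-- The trace-free part of the second fundamental form, as a density. -/
def Bdens (f : ℝ → ℝ → 𝔼 n) (u : ℝ → ℝ → ℝ) (t θ : ℝ) : ℝ :=
  Real.exp (-(2 * u t θ)) * (‖trf₁ f u t θ‖ ^ 2 + ‖trf₂ f u t θ‖ ^ 2)

/-- The density of the gradient of the mean curvature vector, at the scale of the cylinder. -/
def Gdens (f : ℝ → ℝ → 𝔼 n) (u : ℝ → ℝ → ℝ) (t θ : ℝ) : ℝ :=
  Real.exp (2 * u t θ) * (‖pt (Hmc f u) t θ‖ ^ 2 + ‖pth (Hmc f u) t θ‖ ^ 2)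

/-- The density of the gradient of the trace-free second fundamental form. -/
def dBdens (f : ℝ → ℝ → 𝔼 n) (u : ℝ → ℝ → ℝ) (t θ : ℝ) : ℝ :=
  Real.exp (-(2 * u t θ)) * (‖pt (trf₁ f u) t θ‖ ^ 2 + ‖pth (trf₁ f u) t θ‖ ^ 2 +
    ‖pt (trf₂ f u) t θ‖ ^ 2 + ‖pth (trf₂ f u) t θ‖ ^ 2)

variable {f : ℝ → ℝ → 𝔼 n} {u : ℝ → ℝ → ℝ} {s : Set ℝ} {t a b M K : ℝ}

lemma Adens_eq_dens (t θ : ℝ) :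
    Adens f u t θ = 2⁻¹ * Hdens f u t θ + 2⁻¹ * Bdens f u t θ := by
  rw [Adens_eq_half, Hdens, Bdens]; ring

lemma Hdens_nonneg (t θ : ℝ) : 0 ≤ Hdens f u t θ := by unfold Hdens; positivity
lemma Bdens_nonneg (t θ : ℝ) : 0 ≤ Bdens f u t θ := by unfold Bdens; positivity
lemma Gdens_nonneg (t θ : ℝ) : 0 ≤ Gdens f u t θ := by unfold Gdens; positivity
lemma dBdens_nonneg (t θ : ℝ) : 0 ≤ dBdens f u t θ := by unfold dBdens; positivity

lemma smooth2_Hdens (hf : Smooth2 f) (hu : Smooth2 u) : Smooth2 (Hdens f u) :=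
  (smooth2_Hmc hf hu).norm_sq.mul (smooth2_expfac hu 2)

lemma smooth2_Bdens (hf : Smooth2 f) (hu : Smooth2 u) : Smooth2 (Bdens f u) :=
  (smooth2_expfac_neg hu 2).mul ((smooth2_trf₁ hf hu).norm_sq.add (smooth2_trf₂ hf hu).norm_sq)

lemma smooth2_Gdens (hf : Smooth2 f) (hu : Smooth2 u) : Smooth2 (Gdens f u) :=
  (smooth2_expfac hu 2).mul
    ((smooth2_Hmc hf hu).pt.norm_sq.add (smooth2_Hmc hf hu).pth.norm_sq)

lemma smooth2_dBdens (hf : Smooth2 f) (hu : Smooth2 u) : Smooth2 (dBdens f u) :=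
  (smooth2_expfac_neg hu 2).mul
    ((((smooth2_trf₁ hf hu).pt.norm_sq.add (smooth2_trf₁ hf hu).pth.norm_sq).add
      (smooth2_trf₂ hf hu).pt.norm_sq).add (smooth2_trf₂ hf hu).pth.norm_sq)

lemma two_mul_abs_inner_le {V : Type*} [NormedAddCommGroup V] [InnerProductSpace ℝ V] (x y : V)
    {κ : ℝ} (hκ : 0 < κ) : 2 * |⟪x, y⟫_ℝ| ≤ κ⁻¹ * ‖x‖ ^ 2 + κ * ‖y‖ ^ 2 := by
  have h1 := abs_real_inner_le_norm x y
  have h2 := sq_nonneg (‖x‖ - κ * ‖y‖)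
  have h3 : κ⁻¹ * (‖x‖ - κ * ‖y‖) ^ 2 = κ⁻¹ * ‖x‖ ^ 2 + κ * ‖y‖ ^ 2 - 2 * (‖x‖ * ‖y‖) := by
    field_simp; ring
  have h4 := mul_nonneg (inv_pos.2 hκ).le h2
  linarith

lemma energy_deriv_bound {V : Type*} [NormedAddCommGroup V] [InnerProductSpace ℝ V]
    (H H' A A' B B' : V) {e e' w M κ : ℝ} (he : 0 ≤ e) (he' : 0 ≤ e') (hw : |w| ≤ M)
    (hκ : 0 < κ) :
    |2⁻¹ * (e * (2 * w) * ‖H‖ ^ 2 + e * (2 * ⟪H, H'⟫_ℝ)) +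
      2⁻¹ * (e' * (-(2 * w)) * (‖A‖ ^ 2 + ‖B‖ ^ 2) +
        e' * (2 * ⟪A, A'⟫_ℝ + 2 * ⟪B, B'⟫_ℝ))| ≤
    (2 * M + κ⁻¹) * (2⁻¹ * (e * ‖H‖ ^ 2) + 2⁻¹ * (e' * (‖A‖ ^ 2 + ‖B‖ ^ 2))) +
      κ * (e * ‖H'‖ ^ 2 + e' * (‖A'‖ ^ 2 + ‖B'‖ ^ 2)) := by
  have h1 := two_mul_abs_inner_le H H' hκ
  have h2 := two_mul_abs_inner_le A A' hκ
  have h3 := two_mul_abs_inner_le B B' hκ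
  obtain ⟨w1, w2⟩ := abs_le.1 hw
  have hH := abs_le.1 (le_refl |⟪H, H'⟫_ℝ|)
  have hA := abs_le.1 (le_refl |⟪A, A'⟫_ℝ|)
  have hB := abs_le.1 (le_refl |⟪B, B'⟫_ℝ|)
  have k1 := mul_le_mul_of_nonneg_left h1 he
  have k2 := mul_le_mul_of_nonneg_left h2 he'
  have k3 := mul_le_mul_of_nonneg_left h3 he'
  have m1 := mul_le_mul_of_nonneg_left hH.1 he
  have m2 := mul_le_mul_of_nonneg_left hH.2 he
  have m3 := mul_le_mul_of_nonneg_left hA.1 he'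
  have m4 := mul_le_mul_of_nonneg_left hA.2 he'
  have m5 := mul_le_mul_of_nonneg_left hB.1 he'
  have m6 := mul_le_mul_of_nonneg_left hB.2 he'
  have n1 : 0 ≤ e * ‖H‖ ^ 2 := by positivity
  have n2 : 0 ≤ e' * (‖A‖ ^ 2 + ‖B‖ ^ 2) := by positivity
  have n3 := mul_le_mul_of_nonneg_right w1 n1
  have n4 := mul_le_mul_of_nonneg_right w2 n1
  have n5 := mul_le_mul_of_nonneg_right w1 n2
  have n6 := mul_le_mul_of_nonneg_right w2 n2
  have M0 : 0 ≤ M := (abs_nonneg w).trans hw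
  have n7 := mul_nonneg M0 n1
  have n8 := mul_nonneg M0 n2
  have p1 : 0 ≤ κ * (e * ‖H'‖ ^ 2 + e' * (‖A'‖ ^ 2 + ‖B'‖ ^ 2)) := by positivity
  rw [abs_le]
  constructor <;> nlinarith

lemma pt_Adens (hf : Smooth2 f) (hu : Smooth2 u) (t θ : ℝ) : pt (Adens f u) t θ =
    2⁻¹ * (Real.exp (2 * u t θ) * (2 * pt u t θ) * ‖Hmc f u t θ‖ ^ 2 +
      Real.exp (2 * u t θ) * (2 * ⟪Hmc f u t θ, pt (Hmc f u) t θ⟫_ℝ)) +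
    2⁻¹ * (Real.exp (-(2 * u t θ)) * (-(2 * pt u t θ)) * (‖trf₁ f u t θ‖ ^ 2 +
        ‖trf₂ f u t θ‖ ^ 2) + Real.exp (-(2 * u t θ)) *
      (2 * ⟪trf₁ f u t θ, pt (trf₁ f u) t θ⟫_ℝ + 2 * ⟪trf₂ f u t θ, pt (trf₂ f u) t θ⟫_ℝ)) := by
  have e : Adens f u = fun t θ => 2⁻¹ * (Real.exp (2 * u t θ) * ‖Hmc f u t θ‖ ^ 2) +
      2⁻¹ * (Real.exp (-(2 * u t θ)) * (‖trf₁ f u t θ‖ ^ 2 + ‖trf₂ f u t θ‖ ^ 2)) := by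
    funext t θ; exact Adens_eq_half t θ
  rw [e]
  exact (((((hu.dt t θ).const_mul 2).exp.mul ((smooth2_Hmc hf hu).dt t θ).norm_sq).const_mul
    2⁻¹).add ((((hu.dt t θ).const_mul 2).fun_neg.exp.mul (((smooth2_trf₁ hf hu).dt t θ).norm_sq.add
      ((smooth2_trf₂ hf hu).dt t θ).norm_sq)).const_mul 2⁻¹)).deriv

lemma pth_Adens (hf : Smooth2 f) (hu : Smooth2 u) (t θ : ℝ) : pth (Adens f u) t θ =
    2⁻¹ * (Real.exp (2 * u t θ) * (2 * pth u t θ) * ‖Hmc f u t θ‖ ^ 2 +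
      Real.exp (2 * u t θ) * (2 * ⟪Hmc f u t θ, pth (Hmc f u) t θ⟫_ℝ)) +
    2⁻¹ * (Real.exp (-(2 * u t θ)) * (-(2 * pth u t θ)) * (‖trf₁ f u t θ‖ ^ 2 +
        ‖trf₂ f u t θ‖ ^ 2) + Real.exp (-(2 * u t θ)) *
      (2 * ⟪trf₁ f u t θ, pth (trf₁ f u) t θ⟫_ℝ +
        2 * ⟪trf₂ f u t θ, pth (trf₂ f u) t θ⟫_ℝ)) := by
  have e : Adens f u = fun t θ => 2⁻¹ * (Real.exp (2 * u t θ) * ‖Hmc f u t θ‖ ^ 2) +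
      2⁻¹ * (Real.exp (-(2 * u t θ)) * (‖trf₁ f u t θ‖ ^ 2 + ‖trf₂ f u t θ‖ ^ 2)) := by
    funext t θ; exact Adens_eq_half t θ
  rw [e]
  exact (((((hu.dth t θ).const_mul 2).exp.mul ((smooth2_Hmc hf hu).dth t θ).norm_sq).const_mul
    2⁻¹).add ((((hu.dth t θ).const_mul 2).fun_neg.exp.mul
      (((smooth2_trf₁ hf hu).dth t θ).norm_sq.add
      ((smooth2_trf₂ hf hu).dth t θ).norm_sq)).const_mul 2⁻¹)).deriv

lemma abs_pt_Adens_le (hf : Smooth2 f) (hu : Smooth2 u) {θ κ : ℝ} (hM : |pt u t θ| ≤ M)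
    (hκ : 0 < κ) : |pt (Adens f u) t θ| ≤ (2 * M + κ⁻¹) * Adens f u t θ +
      κ * (Gdens f u t θ + dBdens f u t θ) := by
  rw [pt_Adens hf hu, Adens_eq_half]
  refine (energy_deriv_bound _ _ _ _ _ _ (Real.exp_pos _).le (Real.exp_pos _).le hM hκ).trans ?_
  refine add_le_add_right (mul_le_mul_of_nonneg_left (add_le_add ?_ ?_) hκ.le) _
  · exact mul_le_mul_of_nonneg_left (le_add_of_nonneg_right (sq_nonneg _)) (Real.exp_pos _).le
  · refine mul_le_mul_of_nonneg_left ?_ (Real.exp_pos _).le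
    nlinarith [sq_nonneg ‖pth (trf₁ f u) t θ‖, sq_nonneg ‖pth (trf₂ f u) t θ‖]

lemma abs_pth_Adens_le (hf : Smooth2 f) (hu : Smooth2 u) {θ κ : ℝ} (hM : |pth u t θ| ≤ M)
    (hκ : 0 < κ) : |pth (Adens f u) t θ| ≤ (2 * M + κ⁻¹) * Adens f u t θ +
      κ * (Gdens f u t θ + dBdens f u t θ) := by
  rw [pth_Adens hf hu, Adens_eq_half]
  refine (energy_deriv_bound _ _ _ _ _ _ (Real.exp_pos _).le (Real.exp_pos _).le hM hκ).trans ?_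
  refine add_le_add_right (mul_le_mul_of_nonneg_left (add_le_add ?_ ?_) hκ.le) _
  · exact mul_le_mul_of_nonneg_left (le_add_of_nonneg_left (sq_nonneg _)) (Real.exp_pos _).le
  · refine mul_le_mul_of_nonneg_left ?_ (Real.exp_pos _).le
    nlinarith [sq_nonneg ‖pt (trf₁ f u) t θ‖, sq_nonneg ‖pt (trf₂ f u) t θ‖]

/-- A cutoff on the strip with controlled derivative. -/
structure IsCutoff (η : ℝ → ℝ) (K a b : ℝ) : Prop where
  smooth : ContDiff ℝ (⊤ : ℕ∞) η
  nonneg : ∀ t, 0 ≤ η t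
  le_one : ∀ t, η t ≤ 1
  left : η a = 0
  right : η b = 0
  deriv_le : ∀ t, |deriv η t| ≤ K

lemma cutoff_weight_le {η : ℝ → ℝ} (hη : IsCutoff η K a b) (t : ℝ) {e p r : ℝ} (he : 0 ≤ e)
    (hp : |p| ≤ M) (hr : |r| ≤ M) :
    e * (deriv η t + η t * p) ^ 2 + e * (η t * r) ^ 2 ≤ (2 * K ^ 2 + 3 * M ^ 2) * e := by
  have h1 : η t ^ 2 ≤ 1 := pow_le_one₀ (hη.nonneg t) (hη.le_one t)
  have h2 : deriv η t ^ 2 ≤ K ^ 2 := by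
    rw [← sq_abs]; exact pow_le_pow_left₀ (abs_nonneg _) (hη.deriv_le t) 2
  have h3 : p ^ 2 ≤ M ^ 2 := by rw [← sq_abs]; exact pow_le_pow_left₀ (abs_nonneg _) hp 2
  have h4 : r ^ 2 ≤ M ^ 2 := by rw [← sq_abs]; exact pow_le_pow_left₀ (abs_nonneg _) hr 2
  have h5 : η t ^ 2 * p ^ 2 ≤ 1 * M ^ 2 := mul_le_mul h1 h3 (sq_nonneg _) zero_le_one
  have h6 : η t ^ 2 * r ^ 2 ≤ 1 * M ^ 2 := mul_le_mul h1 h4 (sq_nonneg _) zero_le_one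
  have h7 := sq_nonneg (deriv η t - η t * p)
  rw [← mul_add, mul_comm _ e]
  refine mul_le_mul_of_nonneg_left ?_ he
  nlinarith

lemma gradient_H_estimate (hc : ConfWillmore f u s) (hab : a ≤ b)
    (hs : ∀ t ∈ Icc a b, s ∈ nhds t) (hM₁ : ∀ t ∈ Icc a b, ∀ θ, |pt u t θ| ≤ M)
    (hM₂ : ∀ t ∈ Icc a b, ∀ θ, |pth u t θ| ≤ M) {η : ℝ → ℝ} (hη : IsCutoff η K a b) :
    stripInt (fun t θ => η t ^ 2 * Gdens f u t θ) a b ≤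
      512 * stripInt (fun t θ => η t ^ 2 * Adens f u t θ ^ 2) a b +
      10 * (2 * K ^ 2 + 3 * M ^ 2) * stripInt (Hdens f u) a b := by
  have hf := hc.toConfImm.s2f
  have hu := hc.toConfImm.s2u
  have pf := hc.toConfImm.pf
  have pu := hc.toConfImm.pu
  have hη2 : Smooth2 fun t _ => η t := Smooth2.of_fst hη.smooth
  have hχ : Smooth2 fun t θ => η t * Real.exp (u t θ) := hη2.mul hu.exp
  have hH := smooth2_Hmc hf hu
  have key := caccioppoli_div (χ := fun t θ => η t * Real.exp (u t θ)) hab hH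
    (smooth2_cur₁ hf hu) (smooth2_cur₂ hf hu) hχ (periodic2_Hmc pf pu) (periodic2_cur₂ pf pu)
    (fun t θ => by simp only [pu t θ]) (fun θ => by simp [hη.left]) (fun θ => by simp [hη.right])
    (fun t ht θ => hc.div_cur (mem_of_mem_nhds (hs t ht)) θ)
  have e1 : ∀ t θ, pt (fun t θ => η t * Real.exp (u t θ)) t θ =
      deriv η t * Real.exp (u t θ) + η t * (Real.exp (u t θ) * pt u t θ) := fun t θ =>
    (((hη.smooth.differentiable (by simp)) t).hasDerivAt.mul (hu.dt t θ).exp).deriv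
  have e2 : ∀ t θ, pth (fun t θ => η t * Real.exp (u t θ)) t θ =
      η t * (Real.exp (u t θ) * pth u t θ) := fun t θ =>
    ((hu.dth t θ).exp.const_mul (η t)).deriv
  have ee : ∀ t θ, Real.exp (2 * u t θ) = Real.exp (u t θ) ^ 2 := fun t θ => by
    rw [two_mul, Real.exp_add, sq]
  have i1 : stripInt (fun t θ => (η t * Real.exp (u t θ)) ^ 2 *
      (‖cur₁ f u t θ - pt (Hmc f u) t θ‖ ^ 2 + ‖cur₂ f u t θ - pth (Hmc f u) t θ‖ ^ 2)) a b ≤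
      stripInt (fun t θ => 128 * (η t ^ 2 * Adens f u t θ ^ 2)) a b := by
    refine stripInt_mono hab ((hχ.pow 2).mul (((smooth2_cur₁ hf hu).sub hH.pt).norm_sq.add
      ((smooth2_cur₂ hf hu).sub hH.pth).norm_sq)).cont
      ((Smooth2.const 128).mul ((hη2.pow 2).mul ((smooth2_Adens hf hu).pow 2))).cont
      fun t ht θ => ?_
    have h1 := hc.toConfImm.curQ_sq_le (hs t ht) θ
    have h2 : cur₁ f u t θ - pt (Hmc f u) t θ = curQ₁ f u t θ := by simp [cur₁]
    have h3 : cur₂ f u t θ - pth (Hmc f u) t θ = curQ₂ f u t θ := by simp [cur₂]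
    rw [h2, h3, mul_pow, ← ee]
    have := mul_le_mul_of_nonneg_left h1 (sq_nonneg (η t))
    linarith
  have i2 : stripInt (fun t θ => (pt (fun t θ => η t * Real.exp (u t θ)) t θ ^ 2 +
      pth (fun t θ => η t * Real.exp (u t θ)) t θ ^ 2) * ‖Hmc f u t θ‖ ^ 2) a b ≤
      stripInt (fun t θ => (2 * K ^ 2 + 3 * M ^ 2) * Hdens f u t θ) a b := by
    refine stripInt_mono hab (((hχ.pt.pow 2).add (hχ.pth.pow 2)).mul hH.norm_sq).cont
      ((Smooth2.const _).mul (smooth2_Hdens hf hu)).cont fun t ht θ => ?_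
    have h1 := cutoff_weight_le hη t (Real.exp_pos (2 * u t θ)).le (hM₁ t ht θ) (hM₂ t ht θ)
    have h2 := mul_le_mul_of_nonneg_right h1 (sq_nonneg ‖Hmc f u t θ‖)
    rw [e1, e2, Hdens]
    rw [ee] at h2 ⊢
    linarith
  have i3 : stripInt (fun t θ => (η t * Real.exp (u t θ)) ^ 2 *
      (‖pt (Hmc f u) t θ‖ ^ 2 + ‖pth (Hmc f u) t θ‖ ^ 2)) a b =
      stripInt (fun t θ => η t ^ 2 * Gdens f u t θ) a b := by
    congr 1; funext t θ; rw [mul_pow, ← ee, Gdens, mul_assoc]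
  rw [stripInt_const_mul] at i1 i2
  linarith

lemma gradient_B_estimate (hc : ConfWillmore f u s) (hab : a ≤ b)
    (hs : ∀ t ∈ Icc a b, s ∈ nhds t) (hM₁ : ∀ t ∈ Icc a b, ∀ θ, |pt u t θ| ≤ M)
    (hM₂ : ∀ t ∈ Icc a b, ∀ θ, |pth u t θ| ≤ M) {η : ℝ → ℝ} (hη : IsCutoff η K a b) :
    stripInt (fun t θ => η t ^ 2 * dBdens f u t θ) a b ≤
      4 * stripInt (fun t θ => η t ^ 2 * Gdens f u t θ) a b +
      32 * stripInt (fun t θ => η t ^ 2 * Adens f u t θ ^ 2) a b +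
      16 * (2 * K ^ 2 + 3 * M ^ 2) * stripInt (Bdens f u) a b := by
  have hf := hc.toConfImm.s2f
  have hu := hc.toConfImm.s2u
  have pf := hc.toConfImm.pf
  have pu := hc.toConfImm.pu
  have hη2 : Smooth2 fun t _ => η t := Smooth2.of_fst hη.smooth
  have hχ : Smooth2 fun t θ => η t * Real.exp (-u t θ) := hη2.mul hu.neg.exp
  have hA := smooth2_trf₁ hf hu
  have hB := smooth2_trf₂ hf hu
  have key := caccioppoli_curl (χ := fun t θ => η t * Real.exp (-u t θ)) hab hA hB hχ
    (periodic2_trf₁ pf pu) (periodic2_trf₂ pf pu)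
    (fun t θ => by simp only [pu t θ]) (fun θ => by simp [hη.left]) (fun θ => by simp [hη.right])
  have e1 : ∀ t θ, pt (fun t θ => η t * Real.exp (-u t θ)) t θ =
      deriv η t * Real.exp (-u t θ) + η t * (Real.exp (-u t θ) * -pt u t θ) := fun t θ =>
    (((hη.smooth.differentiable (by simp)) t).hasDerivAt.mul (hu.dt t θ).fun_neg.exp).deriv
  have e2 : ∀ t θ, pth (fun t θ => η t * Real.exp (-u t θ)) t θ =
      η t * (Real.exp (-u t θ) * -pth u t θ) := fun t θ =>
    ((hu.dth t θ).fun_neg.exp.const_mul (η t)).deriv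
  have ee : ∀ t θ, Real.exp (-(2 * u t θ)) = Real.exp (-u t θ) ^ 2 := fun t θ => by
    rw [sq, ← Real.exp_add]; ring_nf
  have i1 : stripInt (fun t θ => (η t * Real.exp (-u t θ)) ^ 2 *
      (‖pt (trf₁ f u) t θ + pth (trf₂ f u) t θ‖ ^ 2 +
        ‖pth (trf₁ f u) t θ - pt (trf₂ f u) t θ‖ ^ 2)) a b ≤
      stripInt (fun t θ => 2 * (η t ^ 2 * Gdens f u t θ) +
        16 * (η t ^ 2 * Adens f u t θ ^ 2)) a b := by
    refine stripInt_mono hab ((hχ.pow 2).mul ((hA.pt.add hB.pth).norm_sq.add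
      (hA.pth.sub hB.pt).norm_sq)).cont
      (((Smooth2.const 2).mul ((hη2.pow 2).mul (smooth2_Gdens hf hu))).add
        ((Smooth2.const 16).mul ((hη2.pow 2).mul ((smooth2_Adens hf hu).pow 2)))).cont
      fun t ht θ => ?_
    have h1 := hc.toConfImm.codazzi_sq_le (hs t ht) θ
    rw [mul_pow, ← ee]
    have := mul_le_mul_of_nonneg_left h1 (sq_nonneg (η t))
    rw [Gdens]
    linarith
  have i2 : stripInt (fun t θ => (pt (fun t θ => η t * Real.exp (-u t θ)) t θ ^ 2 +
      pth (fun t θ => η t * Real.exp (-u t θ)) t θ ^ 2) * ‖trf₁ f u t θ‖ ^ 2) a b ≤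
      stripInt (fun t θ => (2 * K ^ 2 + 3 * M ^ 2) * Bdens f u t θ) a b := by
    refine stripInt_mono hab (((hχ.pt.pow 2).add (hχ.pth.pow 2)).mul hA.norm_sq).cont
      ((Smooth2.const _).mul (smooth2_Bdens hf hu)).cont fun t ht θ => ?_
    have h1 := cutoff_weight_le hη t (Real.exp_pos (-(2 * u t θ))).le
      ((abs_neg _).trans_le (hM₁ t ht θ)) ((abs_neg _).trans_le (hM₂ t ht θ))
    have h2 := mul_le_mul_of_nonneg_right h1 (sq_nonneg ‖trf₁ f u t θ‖)
    have h3 : 0 ≤ (2 * K ^ 2 + 3 * M ^ 2) *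
        (Real.exp (-u t θ) ^ 2 * ‖trf₂ f u t θ‖ ^ 2) := by positivity
    rw [e1, e2, Bdens]
    rw [ee] at h2 ⊢
    linarith
  have i3 : stripInt (fun t θ => (η t * Real.exp (-u t θ)) ^ 2 *
      (‖pt (trf₁ f u) t θ‖ ^ 2 + ‖pth (trf₁ f u) t θ‖ ^ 2 + ‖pt (trf₂ f u) t θ‖ ^ 2 +
        ‖pth (trf₂ f u) t θ‖ ^ 2)) a b =
      stripInt (fun t θ => η t ^ 2 * dBdens f u t θ) a b := by
    congr 1; funext t θ; rw [mul_pow, ← ee, dBdens, mul_assoc]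
  rw [stripInt_add ((Smooth2.const 2).mul ((hη2.pow 2).mul (smooth2_Gdens hf hu))).cont
    ((Smooth2.const 16).mul ((hη2.pow 2).mul ((smooth2_Adens hf hu).pow 2))).cont,
    stripInt_const_mul, stripInt_const_mul] at i1
  rw [stripInt_const_mul] at i2
  linarith

end Local

section LocalEstimate

local notation "𝔼" n => EuclideanSpace ℝ (Fin n)

/-- Absorption of the quadratic terms in the local energy estimates. -/
lemma absorb_local {c₀ L E X Y G Hs Bs : ℝ} (hc₀ : 0 ≤ c₀) (hL : 1 ≤ L) (hE : 0 ≤ E) (hX : 0 ≤ X)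
    (hHs : Hs ≤ 2 * E) (hBs : Bs ≤ 2 * E) (hG : G ≤ 512 * Y + 10 * c₀ * Hs)
    (hXG : X ≤ 5 * G + 32 * Y + 16 * c₀ * Bs) (hY : Y ≤ (L * E + 2 * √(E * X)) ^ 2)
    (hsmall : 64000 * L ^ 2 * E ≤ 1) :
    L * E + 2 * √(E * X) ≤ (400 * c₀ + 5 * L + 4) * E ∧
      Y ≤ (400 * c₀ + 5 * L + 4) ^ 2 * E ^ 2 := by
  have hEX : 0 ≤ E * X := mul_nonneg hE hX
  have h1 : (√(E * X)) ^ 2 = E * X := Real.sq_sqrt hEX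
  have h2 : Y ≤ 2 * L ^ 2 * E ^ 2 + 8 * (E * X) := by
    nlinarith [sq_nonneg (L * E - 2 * √(E * X))]
  have hL2 : 1 ≤ L ^ 2 := one_le_pow₀ hL
  have h3 : 64000 * E ≤ 1 := by nlinarith
  have h4 : 64000 * (L ^ 2 * E ^ 2) ≤ E := by nlinarith
  have h5 : 64000 * (E * X) ≤ X := by nlinarith
  have h6 := mul_le_mul_of_nonneg_left hHs hc₀
  have h7 := mul_le_mul_of_nonneg_left hBs hc₀
  have h8 : X ≤ (400 * c₀ + 1) * E := by nlinarith
  have h9 : √(E * X) ≤ (200 * c₀ + 1) * E := by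
    rw [Real.sqrt_le_left (by positivity)]
    nlinarith [mul_le_mul_of_nonneg_left h8 hE, mul_nonneg (mul_nonneg hc₀ hc₀) (sq_nonneg E),
      sq_nonneg E, mul_nonneg hc₀ (sq_nonneg E)]
  have h10 : L * E + 2 * √(E * X) ≤ (400 * c₀ + 5 * L + 4) * E := by nlinarith
  refine ⟨h10, hY.trans ?_⟩
  rw [← mul_pow]
  exact pow_le_pow_left₀ (by positivity) h10 2

/-- Interior estimates on a strip of length three: small energy controls the circle energy, the
integral of the squared density, and the gradient of the mean curvature. -/
lemma local_estimate (M : ℝ) (hM : 0 ≤ M) : ∃ ε > 0, ∃ C ≥ 1, ∀ (f : ℝ → ℝ → 𝔼 n)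
    (u : ℝ → ℝ → ℝ) (s : Set ℝ) (a : ℝ), ConfWillmore f u s →
    (∀ t ∈ Icc a (a + 3), s ∈ nhds t) → (∀ t ∈ Icc a (a + 3), ∀ θ, |pt u t θ| ≤ M) →
    (∀ t ∈ Icc a (a + 3), ∀ θ, |pth u t θ| ≤ M) → stripInt (Adens f u) a (a + 3) ≤ ε →
    (∀ t ∈ Icc (a + 1) (a + 2),
      circInt (Adens f u) t ≤ C * stripInt (Adens f u) a (a + 3)) ∧
    stripInt (fun t θ => Adens f u t θ ^ 2) (a + 1) (a + 2) ≤
      C * stripInt (Adens f u) a (a + 3) ^ 2 ∧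
    stripInt (Gdens f u) (a + 1) (a + 2) ≤ C * (stripInt (Hdens f u) a (a + 3) +
      stripInt (Adens f u) a (a + 3) ^ 2) := by
  obtain ⟨K, hK, hcut⟩ := exists_cutoff
  set c₀ := 2 * K ^ 2 + 3 * M ^ 2 with hc₀
  set L := K + 2 * M with hL
  have L1 : 1 ≤ L := by linarith
  have c0 : 1 ≤ c₀ := by nlinarith
  set D := 400 * c₀ + 5 * L + 4 with hD
  have D1 : 1 ≤ D := by linarith
  have hD2 : D ≤ D ^ 2 := by nlinarith
  refine ⟨(64000 * L ^ 2)⁻¹, by positivity, 512 * D ^ 2, by nlinarith, ?_⟩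
  intro f u s a hc hs h₁ h₂ hsmall
  obtain ⟨η, e1, e2, e3, e4, e5, e6, e7⟩ := hcut a (a + 3) (by linarith)
  have hη : IsCutoff η K a (a + 3) := ⟨e1, e2, e3, e4, e5, e7⟩
  have hf := hc.toConfImm.s2f
  have hu := hc.toConfImm.s2u
  have hab : a ≤ a + 3 := by linarith
  have cA := (smooth2_Adens hf hu).cont
  have cA2 := ((smooth2_Adens hf hu).pow 2).cont
  have cH := (smooth2_Hdens hf hu).cont
  have cB := (smooth2_Bdens hf hu).cont
  have cG := (smooth2_Gdens hf hu).cont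
  have cdB := (smooth2_dBdens hf hu).cont
  have cη : Cont2 fun t _ => η t ^ 2 := ((Smooth2.of_fst e1).pow 2).cont
  have hG := gradient_H_estimate hc hab hs h₁ h₂ hη
  have hX := gradient_B_estimate hc hab hs h₁ h₂ hη
  rw [← hc₀] at hG hX
  have hE : stripInt (Adens f u) a (a + 3) =
      2⁻¹ * stripInt (Hdens f u) a (a + 3) + 2⁻¹ * stripInt (Bdens f u) a (a + 3) := by
    rw [← stripInt_const_mul, ← stripInt_const_mul,
      ← stripInt_add ((Cont2.const (2⁻¹ : ℝ)).mul cH) ((Cont2.const (2⁻¹ : ℝ)).mul cB)]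
    congr 1; funext t θ; exact Adens_eq_dens t θ
  have hH0 := stripInt_nonneg hab (Hdens_nonneg (f := f) (u := u))
  have hB0 := stripInt_nonneg hab (Bdens_nonneg (f := f) (u := u))
  have hXe : stripInt (fun t θ => η t ^ 2 * (Gdens f u t θ + dBdens f u t θ)) a (a + 3) =
      stripInt (fun t θ => η t ^ 2 * Gdens f u t θ) a (a + 3) +
      stripInt (fun t θ => η t ^ 2 * dBdens f u t θ) a (a + 3) := by
    rw [← stripInt_add (cη.mul cG) (cη.mul cdB)]
    congr 1; funext t θ; exact mul_add _ _ _
  have hX0 : 0 ≤ stripInt (fun t θ => η t ^ 2 * (Gdens f u t θ + dBdens f u t θ)) a (a + 3) :=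
    stripInt_nonneg hab fun t θ => mul_nonneg (sq_nonneg _)
      (add_nonneg (Gdens_nonneg t θ) (dBdens_nonneg t θ))
  obtain ⟨k1, k2⟩ := sobolev_strip (Z := Adens f u) (D := fun t θ => Gdens f u t θ + dBdens f u t θ)
    (c := 2 * M) hab (by linarith) hK (smooth2_Adens hf hu)
    (cG.add cdB) Adens_nonneg (fun t θ => add_nonneg (Gdens_nonneg t θ) (dBdens_nonneg t θ))
    (fun t ht θ κ hκ => abs_pt_Adens_le hf hu (h₁ t ht θ) hκ)
    (fun t ht θ κ hκ => abs_pth_Adens_le hf hu (h₂ t ht θ) hκ) e1 e2 e3 e4 e7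
    (E := stripInt (Adens f u) a (a + 3)) rfl
    (X := stripInt (fun t θ => η t ^ 2 * (Gdens f u t θ + dBdens f u t θ)) a (a + 3))
    (stripInt_fst_mul _ _ _ _)
  have hsm : 64000 * L ^ 2 * stripInt (Adens f u) a (a + 3) ≤ 1 := by
    have := mul_le_mul_of_nonneg_left hsmall (by positivity : 0 ≤ 64000 * L ^ 2)
    rwa [mul_inv_cancel₀ (by positivity)] at this
  rw [← stripInt_fst_mul (fun t => η t ^ 2) (fun t θ => Adens f u t θ ^ 2)] at k2
  obtain ⟨m1, m2⟩ := absorb_local (c₀ := c₀) (L := L)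
    (Bs := stripInt (Bdens f u) a (a + 3)) (by linarith) L1
    (by rw [hE]; linarith) hX0 (by linarith) (by linarith) hG (by linarith) k2 hsm
  set E := stripInt (Adens f u) a (a + 3)
  have hE0 : 0 ≤ E := by rw [hE]; linarith
  have one : ∀ t ∈ Icc (a + 1) (a + 2), η t = 1 := fun t ht =>
    (e6 t ⟨ht.1, by linarith [ht.2]⟩).1
  have restrict : ∀ F : ℝ → ℝ → ℝ, Cont2 F → (∀ t θ, 0 ≤ F t θ) →
      stripInt F (a + 1) (a + 2) ≤ stripInt (fun t θ => η t ^ 2 * F t θ) a (a + 3) := by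
    intro F cF F0
    refine le_trans ?_ (stripInt_mono_interval (cη.mul cF)
      (fun t θ => mul_nonneg (sq_nonneg _) (F0 t θ)) (a' := a + 1) (b' := a + 2)
      (by linarith) (by linarith) (by linarith))
    refine stripInt_mono (by linarith) cF (cη.mul cF) fun t ht θ => ?_
    rw [one t ht]; simp
  refine ⟨fun t ht => ?_, ?_, ?_⟩
  · have h := k1 t ⟨by linarith [ht.1], by linarith [ht.2]⟩
    rw [one t ht, one_mul] at h
    nlinarith
  · have h := restrict _ cA2 fun t θ => sq_nonneg _
    nlinarith [sq_nonneg E, sq_nonneg D]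
  · have h := restrict _ cG Gdens_nonneg
    have h3 : 10 * c₀ * stripInt (Hdens f u) a (a + 3) ≤
        512 * D ^ 2 * stripInt (Hdens f u) a (a + 3) :=
      mul_le_mul_of_nonneg_right (by nlinarith) hH0
    linarith

end LocalEstimate

section Frame

local notation "𝔼" n => EuclideanSpace ℝ (Fin n)

lemma norm_sub_le_circInt {V : Type*} [NormedAddCommGroup V] [NormedSpace ℝ V] [CompleteSpace V]
    {F : ℝ → ℝ → V} (hF : Smooth2 F) (t : ℝ) {θ : ℝ} (hθ : θ ∈ Icc 0 (2 * π)) :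
    ‖F t θ - F t 0‖ ≤ circInt (fun t θ => ‖pth F t θ‖) t := by
  rw [← intervalIntegral.integral_eq_sub_of_hasDerivAt (fun x _ => hF.dth t x)
    ((hF.pth.continuous_snd t).intervalIntegrable 0 θ)]
  refine (intervalIntegral.norm_integral_le_integral_norm hθ.1).trans ?_
  exact intervalIntegral.integral_mono_interval le_rfl hθ.1 hθ.2
    (ae_of_all _ fun x => norm_nonneg _) (hF.pth.cont.norm.ii _ _ _)

lemma circInt_const (c t : ℝ) : circInt (fun _ _ => c) t = 2 * π * c := by
  simp [circInt]

/-- On the circle `{t} × S¹` the immersion is `C¹`-close to an `m`-fold covered round circle. -/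
structure NearCircle (f : ℝ → ℝ → 𝔼 n) (u : ℝ → ℝ → ℝ) (s : Set ℝ) (m : ℕ) (t ε : ℝ) :
    Prop where
  conf : ConfImm f u s
  nhds : s ∈ nhds t
  pos : 0 < m
  abs_pt_le : ∀ θ, |pt u t θ + m| ≤ ε
  abs_pth_le : ∀ θ, |pth u t θ| ≤ ε
  small : ε ≤ 1 / 20
  energy_le : circInt (Adens f u) t ≤ ε ^ 2

variable {f : ℝ → ℝ → 𝔼 n} {u : ℝ → ℝ → ℝ} {s : Set ℝ} {m : ℕ} {t ε : ℝ}

namespace NearCircle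

lemma eps_nonneg (h : NearCircle f u s m t ε) : 0 ≤ ε := (abs_nonneg _).trans (h.abs_pt_le 0)

lemma abs_u_sub_le (h : NearCircle f u s m t ε) {θ : ℝ} (hθ : θ ∈ Icc 0 (2 * π)) :
    |u t θ - u t 0| ≤ 2 * π * ε := by
  rw [← Real.norm_eq_abs, ← circInt_const]
  refine (norm_sub_le_circInt h.conf.s2u t hθ).trans ?_
  exact circInt_mono h.conf.s2u.pth.cont.norm (Cont2.const _) h.abs_pth_le

lemma exp_le (h : NearCircle f u s m t ε) {θ : ℝ} (hθ : θ ∈ Icc 0 (2 * π)) :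
    Real.exp (u t θ) ≤ 3 * Real.exp (u t 0) := by
  have h1 := (abs_le.1 (h.abs_u_sub_le hθ)).2
  have h2 : Real.exp (u t θ) ≤ Real.exp (1 + u t 0) := Real.exp_le_exp.2 (by
    have := h.small; nlinarith [Real.pi_lt_d2, Real.pi_pos])
  rw [Real.exp_add] at h2
  nlinarith [Real.exp_one_lt_d9, Real.exp_pos (u t 0)]

lemma le_exp (h : NearCircle f u s m t ε) {θ : ℝ} (hθ : θ ∈ Icc 0 (2 * π)) :
    Real.exp (u t 0) ≤ 3 * Real.exp (u t θ) := by
  have h1 := (abs_le.1 (h.abs_u_sub_le hθ)).1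
  have h2 : Real.exp (u t 0) ≤ Real.exp (1 + u t θ) := Real.exp_le_exp.2 (by
    have := h.small; nlinarith [Real.pi_lt_d2, Real.pi_pos])
  rw [Real.exp_add] at h2
  nlinarith [Real.exp_one_lt_d9, Real.exp_pos (u t θ)]

lemma cont2_sqrt_Adens (h : NearCircle f u s m t ε) : Cont2 fun t θ => √(Adens f u t θ) :=
  Real.continuous_sqrt.comp (smooth2_Adens h.conf.s2f h.conf.s2u).continuous

lemma circInt_sqrt_le (h : NearCircle f u s m t ε) :
    circInt (fun t θ => √(Adens f u t θ)) t ≤ 13 / 5 * ε := by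
  have h1 := circInt_sq_le h.cont2_sqrt_Adens t
  have h2 : circInt (fun t θ => √(Adens f u t θ) ^ 2) t = circInt (Adens f u) t :=
    circInt_congr fun θ => Real.sq_sqrt (Adens_nonneg t θ)
  rw [h2] at h1
  have h3 := h.energy_le
  refine abs_le_of_sq_le_sq' ?_ (by linarith [h.eps_nonneg]) |>.2
  nlinarith [Real.pi_lt_d2, Real.pi_pos, sq_nonneg ε]

lemma tth_add (h : NearCircle f u s m t ε) (θ : ℝ) :
    ‖pth (pt f) t θ + (m : ℝ) • pth f t θ‖ ≤
      Real.exp (u t θ) * (√(Adens f u t θ) + 2 * ε) := by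
  have e : pth (pt f) t θ + (m : ℝ) • pth f t θ =
      Atth f u t θ + (pth u t θ • pt f t θ + (pt u t θ + m) • pth f t θ) := by
    rw [h.conf.s2f.pth_pt, Atth]; module
  have h1 := norm_add_le (pth u t θ • pt f t θ) ((pt u t θ + m) • pth f t θ)
  rw [norm_smul, norm_smul, h.conf.norm_t h.nhds, h.conf.norm_th h.nhds] at h1
  have h2 := mul_le_mul_of_nonneg_right (h.abs_pt_le θ) (Real.exp_pos (u t θ)).le
  have h3 := mul_le_mul_of_nonneg_right (h.abs_pth_le θ) (Real.exp_pos (u t θ)).le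
  have h4 : ‖Atth f u t θ‖ ≤ _ := norm_Atth_le θ
  rw [e]
  refine (norm_add_le _ _).trans ?_
  simp only [Real.norm_eq_abs] at h1
  linarith

lemma thth_sub (h : NearCircle f u s m t ε) (θ : ℝ) :
    ‖pth (pth f) t θ - (m : ℝ) • pt f t θ‖ ≤
      Real.exp (u t θ) * (√(Adens f u t θ) + 2 * ε) := by
  have e : pth (pth f) t θ - (m : ℝ) • pt f t θ =
      Athth f u t θ + (pth u t θ • pth f t θ - (pt u t θ + m) • pt f t θ) := by
    rw [Athth]; module
  have h1 := norm_sub_le (pth u t θ • pth f t θ) ((pt u t θ + m) • pt f t θ)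
  rw [norm_smul, norm_smul, h.conf.norm_t h.nhds, h.conf.norm_th h.nhds] at h1
  have h2 := mul_le_mul_of_nonneg_right (h.abs_pt_le θ) (Real.exp_pos (u t θ)).le
  have h3 := mul_le_mul_of_nonneg_right (h.abs_pth_le θ) (Real.exp_pos (u t θ)).le
  have h4 : ‖Athth f u t θ‖ ≤ _ := norm_Athth_le θ
  rw [e]
  refine (norm_add_le _ _).trans ?_
  simp only [Real.norm_eq_abs] at h1
  linarith

lemma circInt_norm_le_of_bound (h : NearCircle f u s m t ε) {X : ℝ → ℝ → 𝔼 n} (hX : Cont2 X)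
    (hb : ∀ θ, ‖X t θ‖ ≤ 2 * (Real.exp (u t θ) * (√(Adens f u t θ) + 2 * ε))) :
    circInt (fun t θ => ‖X t θ‖) t ≤ 100 * (Real.exp (u t 0) * ε) := by
  set l := Real.exp (u t 0) with hl
  have l0 : 0 < l := Real.exp_pos _
  have h0 := h.eps_nonneg
  have c1 : Cont2 fun t θ => (6 * l) * √(Adens f u t θ) :=
    (Cont2.const _).mul h.cont2_sqrt_Adens
  have h1 : circInt (fun t θ => ‖X t θ‖) t ≤
      circInt (fun t θ => (6 * l) * √(Adens f u t θ) + 12 * l * ε) t := by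
    refine circInt_mono_on hX.norm (c1.add (Cont2.const (12 * l * ε))) fun θ hθ => ?_
    refine (hb θ).trans ?_
    have h2 := mul_le_mul_of_nonneg_right (h.exp_le hθ)
      (by positivity : 0 ≤ √(Adens f u t θ) + 2 * ε)
    linarith
  rw [circInt_add c1 (Cont2.const (12 * l * ε)), circInt_const, circInt_const_mul] at h1
  refine h1.trans ?_
  have h3 := mul_le_mul_of_nonneg_left h.circInt_sqrt_le (by positivity : 0 ≤ 6 * l)
  have h4 : 0 ≤ l * ε := by positivity
  have h5 := mul_le_mul_of_nonneg_left Real.pi_lt_d2.le h4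
  norm_num at h5
  linarith

lemma frame₁ (h : NearCircle f u s m t ε) {θ : ℝ} (hθ : θ ∈ Icc 0 (2 * π)) :
    ‖cos (m * θ) • pt f t θ + sin (m * θ) • pth f t θ - pt f t 0‖ ≤
      100 * (Real.exp (u t 0) * ε) := by
  have hf := h.conf.s2f
  have sc : Smooth2 fun _ θ => cos ((m : ℝ) * θ) := smooth2_cos m
  have ss : Smooth2 fun _ θ => sin ((m : ℝ) * θ) := smooth2_sin m
  have hs := (sc.smul hf.pt).add (ss.smul hf.pth)
  have e : ∀ θ, pth (fun t θ => cos ((m : ℝ) * θ) • pt f t θ + sin ((m : ℝ) * θ) • pth f t θ) t θ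
      = cos (m * θ) • (pth (pt f) t θ + (m : ℝ) • pth f t θ) +
        sin (m * θ) • (pth (pth f) t θ - (m : ℝ) • pt f t θ) := by
    intro θ
    have k1 : HasDerivAt (fun θ : ℝ => (m : ℝ) * θ) m θ := by
      simpa using (hasDerivAt_id θ).const_mul (m : ℝ)
    refine ((k1.cos.smul (hf.pt.dth t θ)).add (k1.sin.smul (hf.pth.dth t θ))).deriv.trans ?_
    module
  have h1 := norm_sub_le_circInt hs t hθ
  simp only [mul_zero, cos_zero, sin_zero, one_smul, zero_smul, add_zero] at h1
  refine h1.trans (h.circInt_norm_le_of_bound hs.pth.cont fun θ => ?_)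
  rw [e]
  refine (norm_add_le _ _).trans ?_
  rw [norm_smul, norm_smul, Real.norm_eq_abs, Real.norm_eq_abs]
  have k1 := mul_le_mul (abs_cos_le_one (m * θ)) (h.tth_add θ) (norm_nonneg _) zero_le_one
  have k2 := mul_le_mul (abs_sin_le_one (m * θ)) (h.thth_sub θ) (norm_nonneg _) zero_le_one
  linarith

lemma frame₂ (h : NearCircle f u s m t ε) {θ : ℝ} (hθ : θ ∈ Icc 0 (2 * π)) :
    ‖cos (m * θ) • pth f t θ - sin (m * θ) • pt f t θ - pth f t 0‖ ≤
      100 * (Real.exp (u t 0) * ε) := by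
  have hf := h.conf.s2f
  have sc : Smooth2 fun _ θ => cos ((m : ℝ) * θ) := smooth2_cos m
  have ss : Smooth2 fun _ θ => sin ((m : ℝ) * θ) := smooth2_sin m
  have hs := (sc.smul hf.pth).sub (ss.smul hf.pt)
  have e : ∀ θ, pth (fun t θ => cos ((m : ℝ) * θ) • pth f t θ - sin ((m : ℝ) * θ) • pt f t θ) t θ
      = cos (m * θ) • (pth (pth f) t θ - (m : ℝ) • pt f t θ) -
        sin (m * θ) • (pth (pt f) t θ + (m : ℝ) • pth f t θ) := by
    intro θ
    have k1 : HasDerivAt (fun θ : ℝ => (m : ℝ) * θ) m θ := by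
      simpa using (hasDerivAt_id θ).const_mul (m : ℝ)
    refine ((k1.cos.smul (hf.pth.dth t θ)).sub (k1.sin.smul (hf.pt.dth t θ))).deriv.trans ?_
    module
  have h1 := norm_sub_le_circInt hs t hθ
  simp only [mul_zero, cos_zero, sin_zero, one_smul, zero_smul, sub_zero] at h1
  refine h1.trans (h.circInt_norm_le_of_bound hs.pth.cont fun θ => ?_)
  rw [e]
  refine (norm_sub_le _ _).trans ?_
  rw [norm_smul, norm_smul, Real.norm_eq_abs, Real.norm_eq_abs]
  have k1 := mul_le_mul (abs_cos_le_one (m * θ)) (h.thth_sub θ) (norm_nonneg _) zero_le_one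
  have k2 := mul_le_mul (abs_sin_le_one (m * θ)) (h.tth_add θ) (norm_nonneg _) zero_le_one
  linarith

lemma norm_trig_le {V : Type*} [NormedAddCommGroup V] [NormedSpace ℝ V] {x y : V} {b : ℝ}
    (hx : ‖x‖ ≤ b) (hy : ‖y‖ ≤ b) (φ : ℝ) :
    ‖cos φ • x - sin φ • y‖ ≤ 2 * b ∧ ‖sin φ • x + cos φ • y‖ ≤ 2 * b := by
  have k1 := mul_le_mul (abs_cos_le_one φ) hx (norm_nonneg _) zero_le_one
  have k2 := mul_le_mul (abs_sin_le_one φ) hy (norm_nonneg _) zero_le_one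
  have k3 := mul_le_mul (abs_sin_le_one φ) hx (norm_nonneg _) zero_le_one
  have k4 := mul_le_mul (abs_cos_le_one φ) hy (norm_nonneg _) zero_le_one
  constructor
  · refine (norm_sub_le _ _).trans ?_
    rw [norm_smul, norm_smul, Real.norm_eq_abs, Real.norm_eq_abs]; linarith
  · refine (norm_add_le _ _).trans ?_
    rw [norm_smul, norm_smul, Real.norm_eq_abs, Real.norm_eq_abs]; linarith

lemma t_approx (h : NearCircle f u s m t ε) {θ : ℝ} (hθ : θ ∈ Icc 0 (2 * π)) :
    ‖pt f t θ - (cos (m * θ) • pt f t 0 - sin (m * θ) • pth f t 0)‖ ≤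
      200 * (Real.exp (u t 0) * ε) := by
  have h1 := (norm_trig_le (h.frame₁ hθ) (h.frame₂ hθ) (m * θ)).1
  refine (le_of_eq ?_).trans (h1.trans (by linarith))
  congr 1
  have h2 := sin_sq_add_cos_sq ((m : ℝ) * θ)
  match_scalars <;> linarith

lemma th_approx (h : NearCircle f u s m t ε) {θ : ℝ} (hθ : θ ∈ Icc 0 (2 * π)) :
    ‖pth f t θ - (sin (m * θ) • pt f t 0 + cos (m * θ) • pth f t 0)‖ ≤
      200 * (Real.exp (u t 0) * ε) := by
  have h1 := (norm_trig_le (h.frame₁ hθ) (h.frame₂ hθ) (m * θ)).2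
  refine (le_of_eq ?_).trans (h1.trans (by linarith))
  congr 1
  have h2 := sin_sq_add_cos_sq ((m : ℝ) * θ)
  match_scalars <;> linarith

lemma f_approx (h : NearCircle f u s m t ε) {θ : ℝ} (hθ : θ ∈ Icc 0 (2 * π)) :
    ‖f t θ - (f t 0 + (m : ℝ)⁻¹ • pt f t 0) +
      (m : ℝ)⁻¹ • (cos (m * θ) • pt f t 0 - sin (m * θ) • pth f t 0)‖ ≤
      1300 * (Real.exp (u t 0) * ε) := by
  have hf := h.conf.s2f
  have sc : Smooth2 fun _ θ => cos ((m : ℝ) * θ) := smooth2_cos m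
  have ss : Smooth2 fun _ θ => sin ((m : ℝ) * θ) := smooth2_sin m
  have m0 : (m : ℝ) ≠ 0 := Nat.cast_ne_zero.2 h.pos.ne'
  have hs := hf.add ((Smooth2.const (m : ℝ)⁻¹).smul ((sc.smul (Smooth2.const (pt f t 0))).sub
    (ss.smul (Smooth2.const (pth f t 0)))))
  have h1 := norm_sub_le_circInt hs t hθ
  simp only [mul_zero, cos_zero, sin_zero, one_smul, zero_smul, sub_zero] at h1
  have e : ∀ ψ, pth (fun t' θ => f t' θ + (m : ℝ)⁻¹ • (cos ((m : ℝ) * θ) • pt f t 0 -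
      sin ((m : ℝ) * θ) • pth f t 0)) t ψ =
      pth f t ψ - (sin (m * ψ) • pt f t 0 + cos (m * ψ) • pth f t 0) := by
    intro θ
    have k1 : HasDerivAt (fun θ : ℝ => (m : ℝ) * θ) m θ := by
      simpa using (hasDerivAt_id θ).const_mul (m : ℝ)
    refine ((hf.dth t θ).add (((k1.cos.smul_const (pt f t 0)).sub
      (k1.sin.smul_const (pth f t 0))).const_smul (m : ℝ)⁻¹)).deriv.trans ?_
    match_scalars <;> field_simp
  have h2 : circInt (fun t' ψ => ‖pth (fun t' θ => f t' θ + (m : ℝ)⁻¹ • (cos ((m : ℝ) * θ) •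
      pt f t 0 - sin ((m : ℝ) * θ) • pth f t 0)) t' ψ‖) t ≤
      circInt (fun _ _ => 200 * (Real.exp (u t 0) * ε)) t := by
    refine circInt_mono_on hs.pth.cont.norm (Cont2.const _) fun ψ hψ => ?_
    rw [e]
    exact h.th_approx hψ
  rw [circInt_const] at h2
  have h3 : 0 ≤ Real.exp (u t 0) * ε := mul_nonneg (Real.exp_pos _).le h.eps_nonneg
  have h4 := mul_le_mul_of_nonneg_left Real.pi_lt_d2.le h3
  norm_num at h4
  refine (le_of_eq ?_).trans (h1.trans (h2.trans (by linarith)))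
  congr 1
  module

end NearCircle

end Frame

section Resonance

local notation "𝔼" n => EuclideanSpace ℝ (Fin n)

section Algebra

variable {V : Type*} [NormedAddCommGroup V] [InnerProductSpace ℝ V]

/-- The infinitesimal rotation `b ↦ ⟪y, b⟫ x - ⟪x, b⟫ y`. -/
def wedge (x y : V) : V →L[ℝ] V :=
  (innerSL ℝ y).smulRight x - (innerSL ℝ x).smulRight y

lemma wedge_apply (x y b : V) : wedge x y b = ⟪y, b⟫_ℝ • x - ⟪x, b⟫_ℝ • y := rfl

lemma inner_wedge_comm (x y a b : V) : ⟪wedge x y a, b⟫_ℝ = -⟪wedge x y b, a⟫_ℝ := by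
  simp only [wedge_apply, inner_sub_left, real_inner_smul_left]
  ring

lemma inner_wedge_self (x y a : V) : ⟪wedge x y a, a⟫_ℝ = 0 := by
  linarith [inner_wedge_comm x y a a]

lemma norm_wedge_le (x y b : V) : ‖wedge x y b‖ ≤ 2 * (‖x‖ * ‖y‖) * ‖b‖ := by
  rw [wedge_apply]
  refine (norm_sub_le _ _).trans ?_
  rw [norm_smul, norm_smul]
  have h1 := mul_le_mul_of_nonneg_right (norm_inner_le_norm (𝕜 := ℝ) y b) (norm_nonneg x)
  have h2 := mul_le_mul_of_nonneg_right (norm_inner_le_norm (𝕜 := ℝ) x b) (norm_nonneg y)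
  linarith

lemma abs_inner_wedge_le (x y a b : V) :
    |⟪wedge x y a, b⟫_ℝ| ≤ 2 * (‖x‖ * ‖y‖) * (‖a‖ * ‖b‖) := by
  refine (abs_real_inner_le_norm _ _).trans ?_
  have := mul_le_mul_of_nonneg_right (norm_wedge_le x y a) (norm_nonneg b)
  linarith

lemma sq_add_sq_le_of_wedge {R I F G : V} {l τ β : ℝ} (hF : ‖F‖ = l) (hG : ‖G‖ = l)
    (hFG : ⟪F, G⟫_ℝ = 0) (h1 : |⟪F, R⟫_ℝ| ≤ τ) (h2 : |⟪G, R⟫_ℝ| ≤ τ) (h3 : |⟪F, I⟫_ℝ| ≤ τ)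
    (h4 : |⟪G, I⟫_ℝ| ≤ τ)
    (h : ∀ x y : V, |⟪wedge x y F, R⟫_ℝ - ⟪wedge x y G, I⟫_ℝ| ≤ β * (‖x‖ * ‖y‖)) :
    l ^ 2 * (‖R‖ ^ 2 + ‖I‖ ^ 2) ≤ 8 * τ ^ 2 + 2 * β ^ 2 := by
  have a1 := (abs_le.1 (h R F)).2
  have a2 := (abs_le.1 (h I G)).1
  simp only [wedge_apply, inner_sub_left, real_inner_smul_left] at a1 a2
  rw [real_inner_self_eq_norm_sq, real_inner_self_eq_norm_sq, hFG, hF,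
    real_inner_comm G R, real_inner_comm F R] at a1
  rw [real_inner_self_eq_norm_sq G, real_inner_self_eq_norm_sq I, real_inner_comm F G, hFG, hG,
    real_inner_comm G I, real_inner_comm F I] at a2
  have τ0 : 0 ≤ τ := (abs_nonneg _).trans h1
  have m1 := mul_le_mul h1 h1 (abs_nonneg _) τ0
  have m2 := mul_le_mul h3 h2 (abs_nonneg _) τ0
  have m4 := mul_le_mul h4 h4 (abs_nonneg _) τ0
  rw [← abs_mul] at m1 m2 m4
  have n1 := abs_le.1 m1
  have n2 := abs_le.1 m2
  have n4 := abs_le.1 m4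
  nlinarith [sq_nonneg (β - ‖R‖ * l), sq_nonneg (β - ‖I‖ * l)]

lemma inner_fc [CompleteSpace V] (k : ℤ) {A B : ℝ → ℝ → V} (hA : Cont2 A) (hB : Cont2 B) (x : V)
    (t : ℝ) : ⟪x, fc k A B t⟫_ℝ =
      circInt (fun t θ => cos (k * θ) * ⟪x, A t θ⟫_ℝ + sin (k * θ) * ⟪x, B t θ⟫_ℝ) t := by
  rw [fc, inner_circInt_right (((cont2_cos k).smul hA).add ((cont2_sin k).smul hB))]
  exact circInt_congr fun θ => by rw [inner_add_right, inner_smul_right, inner_smul_right]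

lemma abs_circInt_le {F G : ℝ → ℝ → ℝ} (hF : Cont2 F) (hG : Cont2 G) {t : ℝ}
    (h : ∀ θ ∈ Icc 0 (2 * π), |F t θ| ≤ G t θ) : |circInt F t| ≤ circInt G t :=
  (norm_circInt_le F t).trans (circInt_mono_on hF.norm hG h)

end Algebra

variable {f : ℝ → ℝ → 𝔼 n} {u : ℝ → ℝ → ℝ} {s : Set ℝ} {m : ℕ} {t ε : ℝ}

namespace ConfImm

lemma t_ptHmc (hc : ConfImm f u s) (hs : s ∈ nhds t) (θ : ℝ) :
    ⟪pt f t θ, pt (Hmc f u) t θ⟫_ℝ = -⟪Hmc f u t θ, Att f u t θ⟫_ℝ := by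
  have hH := smooth2_Hmc hc.s2f hc.s2u
  have h1 := ((hc.s2f.pt.dt t θ).inner ℝ (hH.dt t θ)).deriv
  have h3 : pt (fun t θ => ⟪pt f t θ, Hmc f u t θ⟫_ℝ) t θ = pt (fun _ _ => (0 : ℝ)) t θ :=
    pt_congr (eventually_eventually_nhds.2 hs) fun x hx => hc.t_Hmc hx θ
  have h4 : ⟪pt f t θ, pt (Hmc f u) t θ⟫_ℝ + ⟪pt (pt f) t θ, Hmc f u t θ⟫_ℝ = 0 :=
    h1.symm.trans (h3.trans (by simp [pt]))
  have h5 : ⟪Hmc f u t θ, Att f u t θ⟫_ℝ = ⟪pt (pt f) t θ, Hmc f u t θ⟫_ℝ := by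
    rw [real_inner_comm, Att, inner_add_left, inner_sub_left, real_inner_smul_left,
      real_inner_smul_left, hc.t_Hmc hs, hc.th_Hmc hs]
    ring
  linarith

lemma th_ptHmc (hc : ConfImm f u s) (hs : s ∈ nhds t) (θ : ℝ) :
    ⟪pth f t θ, pt (Hmc f u) t θ⟫_ℝ = -⟪Hmc f u t θ, Atth f u t θ⟫_ℝ := by
  have hH := smooth2_Hmc hc.s2f hc.s2u
  have h1 := ((hc.s2f.pth.dt t θ).inner ℝ (hH.dt t θ)).deriv
  have h3 : pt (fun t θ => ⟪pth f t θ, Hmc f u t θ⟫_ℝ) t θ = pt (fun _ _ => (0 : ℝ)) t θ :=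
    pt_congr (eventually_eventually_nhds.2 hs) fun x hx => hc.th_Hmc hx θ
  have h4 : ⟪pth f t θ, pt (Hmc f u) t θ⟫_ℝ + ⟪pt (pth f) t θ, Hmc f u t θ⟫_ℝ = 0 :=
    h1.symm.trans (h3.trans (by simp [pt]))
  have h5 : ⟪Hmc f u t θ, Atth f u t θ⟫_ℝ = ⟪pt (pth f) t θ, Hmc f u t θ⟫_ℝ := by
    rw [real_inner_comm, Atth, inner_sub_left, inner_sub_left, real_inner_smul_left,
      real_inner_smul_left, hc.t_Hmc hs, hc.th_Hmc hs]
    ring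
  linarith

lemma abs_inner_cur₁_le (hc : ConfImm f u s) (hs : s ∈ nhds t) (θ : ℝ) :
    |⟪pt f t θ, cur₁ f u t θ⟫_ℝ| ≤ 10 * Adens f u t θ ∧
      |⟪pth f t θ, cur₁ f u t θ⟫_ℝ| ≤ 10 * Adens f u t θ := by
  have hQ := hc.norm_curQ₁_le hs θ
  have k1 := (abs_real_inner_le_norm (pt f t θ) (curQ₁ f u t θ))
  have k2 := (abs_real_inner_le_norm (pth f t θ) (curQ₁ f u t θ))
  rw [hc.norm_t hs] at k1
  rw [hc.norm_th hs] at k2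
  have e1 := abs_inner_Hmc_le (norm_Att_le (f := f) (u := u) (t := t) θ)
  have e2 := abs_inner_Hmc_le (norm_Atth_le (f := f) (u := u) (t := t) θ)
  have e0 := Adens_nonneg (f := f) (u := u) t θ
  simp only [cur₁, inner_add_right, hc.t_ptHmc hs, hc.th_ptHmc hs]
  constructor
  · refine (abs_add_le _ _).trans ?_
    rw [abs_neg]; linarith
  · refine (abs_add_le _ _).trans ?_
    rw [abs_neg]; linarith

end ConfImm

section Residues

lemma circInt_cur₁_eq_zero (hf : Smooth2 f) (hu : Smooth2 u) (h : ∀ c, tau1 f u c t = 0) :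
    circInt (cur₁ f u) t = 0 := by
  have hH := smooth2_Hmc hf hu
  have cA : Cont2 fun t θ => Real.exp (-(2 * u t θ)) •
      (⟪Hmc f u t θ, Att f u t θ⟫_ℝ • pt f t θ + ⟪Hmc f u t θ, Atth f u t θ⟫_ℝ • pth f t θ) :=
    ((smooth2_expfac_neg hu 2).smul (((hH.inner (smooth2_Att hf hu)).smul hf.pt).add
      ((hH.inner (smooth2_Atth hf hu)).smul hf.pth))).cont
  have cN : Cont2 fun t θ => ‖Hmc f u t θ‖ ^ 2 • pt f t θ := (hH.norm_sq.smul hf.pt).cont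
  have c2 := (Cont2.const (2 : ℝ)).smul cA
  have c3 := (Cont2.const (2⁻¹ : ℝ)).smul cN
  have e : circInt (cur₁ f u) t = circInt (pt (Hmc f u)) t + ((2 : ℝ) • circInt (fun t θ =>
      Real.exp (-(2 * u t θ)) • (⟪Hmc f u t θ, Att f u t θ⟫_ℝ • pt f t θ +
        ⟪Hmc f u t θ, Atth f u t θ⟫_ℝ • pth f t θ)) t -
      (2⁻¹ : ℝ) • circInt (fun t θ => ‖Hmc f u t θ‖ ^ 2 • pt f t θ) t) := by
    rw [← circInt_smul, ← circInt_smul, ← circInt_sub c2 c3, ← circInt_add hH.pt.cont (c2.sub c3)]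
    rfl
  have h1 := h (circInt (cur₁ f u) t)
  unfold tau1 at h1
  have e2 : circInt (cur₁ f u) t = -(2⁻¹ : ℝ) • ((-2 : ℝ) • circInt (pt (Hmc f u)) t -
      (4 : ℝ) • circInt (fun t θ => Real.exp (-(2 * u t θ)) •
        (⟪Hmc f u t θ, Att f u t θ⟫_ℝ • pt f t θ + ⟪Hmc f u t θ, Atth f u t θ⟫_ℝ • pth f t θ)) t +
      circInt (fun t θ => ‖Hmc f u t θ‖ ^ 2 • pt f t θ) t) := by
    rw [e]; module
  have h2 : ⟪circInt (cur₁ f u) t, circInt (cur₁ f u) t⟫_ℝ = 0 := by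
    nth_rewrite 1 [e2]
    rw [real_inner_smul_left]
    simp only [circInt] at h1 ⊢
    rw [h1, mul_zero]
  exact inner_self_eq_zero.1 h2

lemma toEuclideanLin_wedge (x y b : 𝔼 n) :
    (Matrix.toEuclideanLin (Matrix.of fun i j => x i * y j - y i * x j)) b = wedge x y b := by
  ext i
  simp only [wedge_apply, Matrix.toLpLin_apply, Matrix.mulVec, dotProduct, Matrix.of_apply,
    PiLp.sub_apply, PiLp.smul_apply, smul_eq_mul, PiLp.inner_apply, RCLike.inner_apply,
    conj_trivial, Finset.sum_mul, ← Finset.sum_sub_distrib]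
  exact Finset.sum_congr rfl fun j _ => by ring

lemma circInt_wedge_eq_zero (hf : Smooth2 f) (hu : Smooth2 u) (h1 : ∀ c, tau1 f u c t = 0)
    (h2 : ∀ S : Matrix (Fin n) (Fin n) ℝ, S.transpose = -S → tau2 f u S t = 0) (x y c : 𝔼 n) :
    circInt (fun t θ => ⟪wedge x y (pt f t θ), Hmc f u t θ⟫_ℝ -
      ⟪wedge x y (f t θ - c), cur₁ f u t θ⟫_ℝ) t = 0 := by
  have hH := smooth2_Hmc hf hu
  have h := h2 (Matrix.of fun i j => x i * y j - y i * x j) (by ext i j; simp; ring)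
  unfold tau2 at h
  simp only [toEuclideanLin_wedge] at h
  have hS := hf.clm (wedge x y)
  have hd : ∀ θ, pt (fun a b => wedge x y (f a b)) t θ = wedge x y (pt f t θ) := fun θ =>
    ((wedge x y).hasFDerivAt.comp_hasDerivAt t (hf.dt t θ)).deriv
  have cA : Cont2 fun t θ => Real.exp (-(2 * u t θ)) *
      (⟪Hmc f u t θ, Att f u t θ⟫_ℝ * ⟪pt f t θ, wedge x y (f t θ)⟫_ℝ +
        ⟪Hmc f u t θ, Atth f u t θ⟫_ℝ * ⟪pth f t θ, wedge x y (f t θ)⟫_ℝ) :=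
    ((smooth2_expfac_neg hu 2).mul (((hH.inner (smooth2_Att hf hu)).mul (hf.pt.inner hS)).add
      ((hH.inner (smooth2_Atth hf hu)).mul (hf.pth.inner hS)))).cont
  have cN : Cont2 fun t θ => ‖Hmc f u t θ‖ ^ 2 * ⟪pt f t θ, wedge x y (f t θ)⟫_ℝ :=
    (hH.norm_sq.mul (hf.pt.inner hS)).cont
  have cH : Cont2 fun t θ => ⟪Hmc f u t θ, pt (fun a b => wedge x y (f a b)) t θ⟫_ℝ -
      ⟪pt (Hmc f u) t θ, wedge x y (f t θ)⟫_ℝ := ((hH.inner hS.pt).sub (hH.pt.inner hS)).cont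
  have cP := (smooth2_cur₁ hf hu).cont
  have k1 : circInt (fun t θ => ⟪wedge x y c, cur₁ f u t θ⟫_ℝ) t = 0 := by
    rw [← inner_circInt_right cP, circInt_cur₁_eq_zero hf hu h1, inner_zero_right]
  have c4 := (Cont2.const (4 : ℝ)).mul cA
  have c2 := (Cont2.const (2 : ℝ)).mul cH
  have k2 : circInt (fun t θ => 2 * (⟪Hmc f u t θ, pt (fun a b => wedge x y (f a b)) t θ⟫_ℝ -
      ⟪pt (Hmc f u) t θ, wedge x y (f t θ)⟫_ℝ) - 4 * (Real.exp (-(2 * u t θ)) *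
      (⟪Hmc f u t θ, Att f u t θ⟫_ℝ * ⟪pt f t θ, wedge x y (f t θ)⟫_ℝ +
        ⟪Hmc f u t θ, Atth f u t θ⟫_ℝ * ⟪pth f t θ, wedge x y (f t θ)⟫_ℝ)) +
      ‖Hmc f u t θ‖ ^ 2 * ⟪pt f t θ, wedge x y (f t θ)⟫_ℝ) t = 0 := by
    rw [circInt_add (c2.sub c4) cN, circInt_sub c2 c4, circInt_const_mul, circInt_const_mul]
    exact h
  have c5 : Cont2 fun t θ => ⟪wedge x y c, cur₁ f u t θ⟫_ℝ := (Cont2.const _).inner cP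
  have k3 := (circInt_add ((Cont2.const (2⁻¹ : ℝ)).mul ((c2.sub c4).add cN)) c5 t).trans
    (by rw [circInt_const_mul, k1, k2, mul_zero, add_zero])
  rw [← k3]
  refine circInt_congr fun θ => ?_
  rw [hd]
  simp only [map_sub, inner_sub_left, cur₁, curQ₁, inner_add_right, inner_sub_right,
    inner_smul_right, real_inner_comm (Hmc f u t θ) (wedge x y (pt f t θ)),
    real_inner_comm (pt (Hmc f u) t θ), real_inner_comm (pt f t θ) (wedge x y (f t θ)),
    real_inner_comm (pth f t θ) (wedge x y (f t θ))]
  ring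

end Residues

namespace NearCircle

lemma conf_norm_t (h : NearCircle f u s m t ε) (θ : ℝ) : ‖pt f t θ‖ = Real.exp (u t θ) :=
  h.conf.norm_t h.nhds θ

lemma conf_norm_th (h : NearCircle f u s m t ε) (θ : ℝ) : ‖pth f t θ‖ = Real.exp (u t θ) :=
  h.conf.norm_th h.nhds θ

/-- A resonant Fourier coefficient of a pair of fields is controlled by their tangential parts and
by their moments against infinitesimal rotations of the model circle. -/
lemma fc_sq_le (h : NearCircle f u s m t ε) {A B : ℝ → ℝ → 𝔼 n} (hA : Cont2 A) (hB : Cont2 B)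
    {κ : ℝ → ℝ → ℝ} (hκ : Cont2 κ) (hAt : ∀ θ, |⟪pt f t θ, A t θ⟫_ℝ| ≤ κ t θ)
    (hAth : ∀ θ, |⟪pth f t θ, A t θ⟫_ℝ| ≤ κ t θ) (hBt : ∀ θ, |⟪pt f t θ, B t θ⟫_ℝ| ≤ κ t θ)
    (hBth : ∀ θ, |⟪pth f t θ, B t θ⟫_ℝ| ≤ κ t θ) {β : ℝ}
    (hβ : ∀ x y : 𝔼 n, |circInt (fun t' θ =>
      ⟪wedge x y (cos (m * θ) • pt f t 0 - sin (m * θ) • pth f t 0), A t' θ⟫_ℝ +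
      ⟪wedge x y (sin (m * θ) • pt f t 0 + cos (m * θ) • pth f t 0), B t' θ⟫_ℝ) t| ≤
        β * (‖x‖ * ‖y‖)) :
    Real.exp (u t 0) ^ 2 * (‖fc m A B t‖ ^ 2 + ‖fc m B (fun t θ => -A t θ) t‖ ^ 2) ≤
      8 * (4 * circInt κ t + 100 * (Real.exp (u t 0) * ε) *
        circInt (fun t θ => ‖A t θ‖ + ‖B t θ‖) t) ^ 2 + 2 * β ^ 2 := by
  have hA' := hA.neg
  have cs := (cont2_cos m)
  have sn := (cont2_sin m)
  have k0 := h.eps_nonneg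
  set l := Real.exp (u t 0) with hl
  have l0 : 0 < l := Real.exp_pos _
  have cN := hA.norm.add hB.norm
  have e : 4 * circInt κ t + 100 * (l * ε) * circInt (fun t θ => ‖A t θ‖ + ‖B t θ‖) t =
      circInt (fun t θ => 4 * κ t θ + 100 * (l * ε) * (‖A t θ‖ + ‖B t θ‖)) t := by
    rw [circInt_add ((Cont2.const (4 : ℝ)).mul hκ) ((Cont2.const (100 * (l * ε))).mul cN),
      circInt_const_mul, circInt_const_mul]
  have cκ : Cont2 fun t θ => 4 * κ t θ + 100 * (l * ε) * (‖A t θ‖ + ‖B t θ‖) :=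
    ((Cont2.const (4 : ℝ)).mul hκ).add ((Cont2.const (100 * (l * ε))).mul cN)
  have tang : ∀ {x : 𝔼 n} {a b : ℝ} {θ : ℝ} {Z : 𝔼 n}, |a| ≤ 1 → |b| ≤ 1 →
      ‖a • pt f t θ + b • pth f t θ - x‖ ≤ 100 * (l * ε) → |⟪pt f t θ, Z⟫_ℝ| ≤ κ t θ →
      |⟪pth f t θ, Z⟫_ℝ| ≤ κ t θ → |⟪x, Z⟫_ℝ| ≤ 2 * κ t θ + 100 * (l * ε) * ‖Z‖ := by
    intro x a b θ Z ha hb h1 h2 h3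
    have e : ⟪x, Z⟫_ℝ = a * ⟪pt f t θ, Z⟫_ℝ + b * ⟪pth f t θ, Z⟫_ℝ -
        ⟪a • pt f t θ + b • pth f t θ - x, Z⟫_ℝ := by
      rw [inner_sub_left, inner_add_left, real_inner_smul_left, real_inner_smul_left]; ring
    have k1 := mul_le_mul ha h2 (abs_nonneg _) zero_le_one
    have k2 := mul_le_mul hb h3 (abs_nonneg _) zero_le_one
    rw [← abs_mul] at k1 k2
    have k3 := (abs_real_inner_le_norm (a • pt f t θ + b • pth f t θ - x) Z).trans
      (mul_le_mul_of_nonneg_right h1 (norm_nonneg _))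
    rw [e]
    refine (abs_sub _ _).trans ?_
    have := abs_add_le (a * ⟪pt f t θ, Z⟫_ℝ) (b * ⟪pth f t θ, Z⟫_ℝ)
    linarith
  have comb : ∀ {x : 𝔼 n} {a b : ℝ} {θ : ℝ} {Z W : 𝔼 n}, |a| ≤ 1 → |b| ≤ 1 →
      |⟪x, Z⟫_ℝ| ≤ 2 * κ t θ + 100 * (l * ε) * ‖Z‖ →
      |⟪x, W⟫_ℝ| ≤ 2 * κ t θ + 100 * (l * ε) * ‖W‖ →
      |a * ⟪x, Z⟫_ℝ + b * ⟪x, W⟫_ℝ| ≤ 4 * κ t θ + 100 * (l * ε) * (‖Z‖ + ‖W‖) := by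
    intro x a b θ Z W ha hb h1 h2
    have k1 := mul_le_mul ha h1 (abs_nonneg _) zero_le_one
    have k2 := mul_le_mul hb h2 (abs_nonneg _) zero_le_one
    rw [← abs_mul] at k1 k2
    refine (abs_add_le _ _).trans ?_
    linarith
  have tF : ∀ {θ : ℝ} {Z : 𝔼 n}, θ ∈ Icc 0 (2 * π) → |⟪pt f t θ, Z⟫_ℝ| ≤ κ t θ →
      |⟪pth f t θ, Z⟫_ℝ| ≤ κ t θ → |⟪pt f t 0, Z⟫_ℝ| ≤ 2 * κ t θ + 100 * (l * ε) * ‖Z‖ :=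
    fun hθ h1 h2 => tang (abs_cos_le_one _) (abs_sin_le_one _) (h.frame₁ hθ) h1 h2
  have tG : ∀ {θ : ℝ} {Z : 𝔼 n}, θ ∈ Icc 0 (2 * π) → |⟪pt f t θ, Z⟫_ℝ| ≤ κ t θ →
      |⟪pth f t θ, Z⟫_ℝ| ≤ κ t θ → |⟪pth f t 0, Z⟫_ℝ| ≤ 2 * κ t θ + 100 * (l * ε) * ‖Z‖ := by
    intro θ Z hθ h1 h2
    refine tang (a := -sin (m * θ)) (b := cos (m * θ)) (by rw [abs_neg]; exact abs_sin_le_one _)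
      (abs_cos_le_one _) ?_ h1 h2
    refine (le_of_eq ?_).trans (h.frame₂ hθ)
    congr 1
    module
  have nA : ∀ {x : 𝔼 n} {θ : ℝ}, |⟪x, A t θ⟫_ℝ| ≤ κ t θ → |⟪x, -A t θ⟫_ℝ| ≤ κ t θ := by
    intro x θ h1
    rwa [inner_neg_right, abs_neg]
  have X1 : ∀ x : 𝔼 n, (∀ {θ : ℝ} {Z : 𝔼 n}, θ ∈ Icc 0 (2 * π) → |⟪pt f t θ, Z⟫_ℝ| ≤ κ t θ →
      |⟪pth f t θ, Z⟫_ℝ| ≤ κ t θ → |⟪x, Z⟫_ℝ| ≤ 2 * κ t θ + 100 * (l * ε) * ‖Z‖) →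
      |⟪x, fc m A B t⟫_ℝ| ≤ 4 * circInt κ t +
        100 * (l * ε) * circInt (fun t θ => ‖A t θ‖ + ‖B t θ‖) t ∧
      |⟪x, fc m B (fun t θ => -A t θ) t⟫_ℝ| ≤ 4 * circInt κ t +
        100 * (l * ε) * circInt (fun t θ => ‖A t θ‖ + ‖B t θ‖) t := by
    intro x hx
    rw [e, inner_fc m hA hB, inner_fc m hB hA']
    constructor
    · exact abs_circInt_le ((cs.mul ((Cont2.const x).inner hA)).add
        (sn.mul ((Cont2.const x).inner hB))) cκ fun θ hθ =>
        comb (abs_cos_le_one _) (abs_sin_le_one _) (hx hθ (hAt θ) (hAth θ)) (hx hθ (hBt θ) (hBth θ))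
    · refine abs_circInt_le ((cs.mul ((Cont2.const x).inner hB)).add
        (sn.mul ((Cont2.const x).inner hA'))) cκ fun θ hθ => ?_
      refine (comb (abs_cos_le_one _) (abs_sin_le_one _) (hx hθ (hBt θ) (hBth θ))
        (hx hθ (nA (hAt θ)) (nA (hAth θ)))).trans ?_
      rw [norm_neg]
      linarith
  have hβ' : ∀ x y : 𝔼 n, |⟪wedge x y (pt f t 0), fc m A B t⟫_ℝ -
      ⟪wedge x y (pth f t 0), -fc m B (fun t θ => -A t θ) t⟫_ℝ| ≤ β * (‖x‖ * ‖y‖) := by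
    intro x y
    refine (le_of_eq ?_).trans (hβ x y)
    rw [inner_neg_right, sub_neg_eq_add, inner_fc m hA hB, inner_fc m hB hA', ← circInt_add
      ((cs.mul ((Cont2.const _).inner hA)).add (sn.mul ((Cont2.const _).inner hB)))
      ((cs.mul ((Cont2.const _).inner hB)).add (sn.mul ((Cont2.const _).inner hA')))]
    congr 1
    refine circInt_congr fun θ => ?_
    simp only [map_add, map_sub, map_smul, inner_add_left, inner_sub_left, real_inner_smul_left,
      inner_neg_right, Int.cast_natCast]
    ring
  have := sq_add_sq_le_of_wedge (h.conf_norm_t 0) (h.conf_norm_th 0) (h.conf.orth h.nhds 0)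
    (X1 _ tF).1 (X1 _ tG).1 (I := -fc m B (fun t θ => -A t θ) t)
    (by rw [inner_neg_right, abs_neg]; exact (X1 _ tF).2)
    (by rw [inner_neg_right, abs_neg]; exact (X1 _ tG).2) hβ'
  rwa [norm_neg] at this

lemma exp_sq_mul_circInt_sq_le (h : NearCircle f u s m t ε) {F : ℝ → ℝ → ℝ} (hF : Cont2 F) :
    Real.exp (u t 0) ^ 2 * circInt F t ^ 2 ≤
      57 * circInt (fun t θ => Real.exp (2 * u t θ) * F t θ ^ 2) t := by
  have h1 := circInt_sq_le hF t
  have c1 : Cont2 fun t' θ => Real.exp (u t 0) ^ 2 * F t' θ ^ 2 := (Cont2.const _).mul (hF.pow 2)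
  have c2 : Cont2 fun t θ => Real.exp (2 * u t θ) * F t θ ^ 2 :=
    (smooth2_expfac h.conf.s2u 2).cont.mul (hF.pow 2)
  have h2 := circInt_mono_on c1 ((Cont2.const (9 : ℝ)).mul c2) (t := t) fun θ hθ => by
    have k1 := mul_self_le_mul_self (Real.exp_pos _).le (h.le_exp hθ)
    have k2 : Real.exp (2 * u t θ) = Real.exp (u t θ) * Real.exp (u t θ) := by
      rw [← Real.exp_add]; congr 1; ring
    rw [k2]
    nlinarith [sq_nonneg (F t θ)]
  rw [circInt_const_mul, circInt_const_mul] at h2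
  have h3 : 0 ≤ circInt (fun t θ => Real.exp (2 * u t θ) * F t θ ^ 2) t :=
    circInt_nonneg fun θ => by positivity
  have h4 := mul_le_mul_of_nonneg_left h1 (sq_nonneg (Real.exp (u t 0)))
  have h5 := mul_le_mul_of_nonneg_left h2 Real.two_pi_pos.le
  nlinarith [Real.pi_lt_d2]

lemma exp_neg_sq_mul_circInt_sq_le (h : NearCircle f u s m t ε) {F : ℝ → ℝ → ℝ} (hF : Cont2 F) :
    circInt F t ^ 2 ≤ Real.exp (u t 0) ^ 2 *
      (57 * circInt (fun t θ => Real.exp (-(2 * u t θ)) * F t θ ^ 2) t) := by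
  have h1 := circInt_sq_le hF t
  have c2 : Cont2 fun t θ => Real.exp (-(2 * u t θ)) * F t θ ^ 2 :=
    (smooth2_expfac_neg h.conf.s2u 2).cont.mul (hF.pow 2)
  have h2 := circInt_mono_on (hF.pow 2) ((Cont2.const (Real.exp (u t 0) ^ 2 * 9)).mul c2) (t := t)
    fun θ hθ => by
    have k1 := mul_self_le_mul_self (Real.exp_pos _).le (h.exp_le hθ)
    have k2 : Real.exp (u t θ) * Real.exp (u t θ) * Real.exp (-(2 * u t θ)) = 1 := by
      rw [← Real.exp_add, ← Real.exp_add]; ring_nf; exact Real.exp_zero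
    have k3 := mul_le_mul_of_nonneg_right k1 (Real.exp_pos (-(2 * u t θ))).le
    rw [k2] at k3
    have k4 := mul_le_mul_of_nonneg_right k3 (sq_nonneg (F t θ))
    linarith
  rw [circInt_const_mul] at h2
  have h3 : 0 ≤ circInt (fun t θ => Real.exp (-(2 * u t θ)) * F t θ ^ 2) t :=
    circInt_nonneg fun θ => by positivity
  have h5 := mul_le_mul_of_nonneg_left h2 Real.two_pi_pos.le
  have h6 : 0 ≤ Real.exp (u t 0) ^ 2 *
    circInt (fun t θ => Real.exp (-(2 * u t θ)) * F t θ ^ 2) t := by positivity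
  nlinarith [Real.pi_lt_d2]

end NearCircle

end Resonance

section ResonantModes

local notation "𝔼" n => EuclideanSpace ℝ (Fin n)

variable {f : ℝ → ℝ → 𝔼 n} {u : ℝ → ℝ → ℝ} {s : Set ℝ} {m : ℕ} {t ε : ℝ}

lemma circInt_wedge_trf (hf : Smooth2 f) (hu : Smooth2 u) (pf : Periodic2 f) (pu : Periodic2 u)
    (x y : 𝔼 n) (t : ℝ) :
    circInt (fun t θ => Real.exp (-(2 * u t θ)) * (⟪wedge x y (pt f t θ), trf₁ f u t θ⟫_ℝ +
      ⟪wedge x y (pth f t θ), trf₂ f u t θ⟫_ℝ) - ⟪wedge x y (pt f t θ), Hmc f u t θ⟫_ℝ) t = 0 := by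
  have hS := hf.pth.clm (wedge x y)
  have hE := smooth2_expfac_neg hu 2
  have hF : Smooth2 fun t θ =>
      (2 : ℝ) * (Real.exp (-(2 * u t θ)) * ⟪pt f t θ, wedge x y (pth f t θ)⟫_ℝ) :=
    (Smooth2.const 2).mul (hE.mul (hf.pt.inner hS))
  have hp : Periodic2 fun t θ =>
      (2 : ℝ) * (Real.exp (-(2 * u t θ)) * ⟪pt f t θ, wedge x y (pth f t θ)⟫_ℝ) := fun t θ => by
    simp only [pu t θ, pf.pt t θ, pf.pth t θ]
  rw [← circInt_pth_eq_zero hF hp t]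
  refine circInt_congr fun θ => ?_
  have d1 := ((hE.dth t θ).mul ((hf.pt.dth t θ).inner ℝ (hS.dth t θ))).const_mul (2 : ℝ)
  have d2 : pth (fun t θ => Real.exp (-(2 * u t θ))) t θ =
      Real.exp (-(2 * u t θ)) * -(2 * pth u t θ) := ((hu.dth t θ).const_mul 2).neg.exp.deriv
  have d3 : pth (fun t θ => wedge x y (pth f t θ)) t θ = wedge x y (pth (pth f) t θ) :=
    ((wedge x y).hasFDerivAt.comp_hasDerivAt θ (hf.pth.dth t θ)).deriv
  rw [d2, d3, hf.pth_pt] at d1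
  refine Eq.trans ?_ d1.deriv.symm
  have w1 := inner_wedge_comm x y (pt f t θ) (pth (pth f) t θ)
  have w2 := inner_wedge_comm x y (pt f t θ) (pth f t θ)
  simp only [trf₁, trf₂, Att, Atth, Athth, Hmc, inner_add_right, inner_sub_right, inner_smul_right,
    inner_wedge_self, real_inner_comm (wedge x y (pth (pth f) t θ)) (pt f t θ),
    real_inner_comm (wedge x y (pth f t θ)) (pt f t θ),
    real_inner_comm (wedge x y (pth f t θ)) (pt (pth f) t θ)]
  linear_combination (-2 * Real.exp (-(2 * u t θ))) * w1 + 2 * Real.exp (-(2 * u t θ)) * pth u t θ * w2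

namespace NearCircle

lemma quadratic_energy_le (h : NearCircle f u s m t ε) : 
    Real.exp (u t 0) ^ 2 * circInt (fun t θ => ‖Hmc f u t θ‖ + ‖cur₁ f u t θ‖) t ^ 2 ≤
      30000 * (circInt (Adens f u) t + circInt (Gdens f u) t +
        circInt (fun t θ => Adens f u t θ ^ 2) t) := by
  have hf := h.conf.s2f
  have hu := h.conf.s2u
  have cZ := (smooth2_Adens hf hu).cont
  have cG := (smooth2_Gdens hf hu).cont
  have h1 := h.exp_sq_mul_circInt_sq_le
    ((smooth2_Hmc hf hu).cont.norm.add (smooth2_cur₁ hf hu).cont.norm)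
  have h2 := circInt_mono ((smooth2_expfac hu 2).cont.mul
    (((smooth2_Hmc hf hu).cont.norm.add (smooth2_cur₁ hf hu).cont.norm).pow 2))
    ((Cont2.const (512 : ℝ)).mul ((cZ.add cG).add (cZ.pow 2))) (t := t) fun θ => by
    have k1 := h.conf.curQ_sq_le h.nhds θ
    have k2 := Adens_eq_dens (f := f) (u := u) t θ
    have k3 := Bdens_nonneg (f := f) (u := u) t θ
    have k4 : ‖cur₁ f u t θ‖ ≤ _ := norm_add_le _ _
    have k5 : (‖Hmc f u t θ‖ + ‖cur₁ f u t θ‖) ^ 2 ≤ 2 * ‖Hmc f u t θ‖ ^ 2 +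
        4 * (‖pt (Hmc f u) t θ‖ ^ 2 + ‖curQ₁ f u t θ‖ ^ 2) := by
      have k6 := mul_self_le_mul_self (norm_nonneg _) k4
      nlinarith [sq_nonneg (‖Hmc f u t θ‖ - ‖cur₁ f u t θ‖),
        sq_nonneg (‖pt (Hmc f u) t θ‖ - ‖curQ₁ f u t θ‖)]
    have e0 := Real.exp_pos (2 * u t θ)
    have k7 := mul_le_mul_of_nonneg_left k5 e0.le
    have k8 : 0 ≤ Real.exp (2 * u t θ) * ‖pth (Hmc f u) t θ‖ ^ 2 := by positivity
    have k9 : 0 ≤ Real.exp (2 * u t θ) * ‖curQ₂ f u t θ‖ ^ 2 := by positivity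
    have k10 := Gdens_nonneg (f := f) (u := u) t θ
    have k11 := Adens_nonneg (f := f) (u := u) t θ
    have k12 : Gdens f u t θ = Real.exp (2 * u t θ) * ‖pt (Hmc f u) t θ‖ ^ 2 +
      Real.exp (2 * u t θ) * ‖pth (Hmc f u) t θ‖ ^ 2 := by rw [Gdens]; ring
    rw [Hdens] at k2
    nlinarith
  rw [circInt_const_mul, circInt_add (cZ.add cG) (cZ.pow 2), circInt_add cZ cG] at h2
  have n1 : 0 ≤ circInt (Adens f u) t := circInt_nonneg fun θ => Adens_nonneg t θ
  have n2 : 0 ≤ circInt (Gdens f u) t := circInt_nonneg fun θ => Gdens_nonneg t θ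
  have n3 : 0 ≤ circInt (fun t θ => Adens f u t θ ^ 2) t := circInt_nonneg fun θ => sq_nonneg _
  refine h1.trans ?_
  linarith

/-- The resonant Fourier coefficient of the mean curvature. -/
lemma resonant_H (h : NearCircle f u s m t ε) (h1 : ∀ c, tau1 f u c t = 0)
    (h2 : ∀ S : Matrix (Fin n) (Fin n) ℝ, S.transpose = -S → tau2 f u S t = 0) :
    Real.exp (u t 0) ^ 2 *
      (‖fc m (fun t θ => Hmc f u t θ + (m : ℝ)⁻¹ • cur₁ f u t θ) (fun _ _ => 0) t‖ ^ 2 +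
      ‖fc m (fun _ _ => 0) (fun t θ => -(Hmc f u t θ + (m : ℝ)⁻¹ • cur₁ f u t θ)) t‖ ^ 2) ≤
      10 ^ 12 * (ε ^ 2 * (circInt (Adens f u) t + circInt (Gdens f u) t +
        circInt (fun t θ => Adens f u t θ ^ 2) t)) := by
  have hf := h.conf.s2f
  have hu := h.conf.s2u
  have hH := smooth2_Hmc hf hu
  have hP := smooth2_cur₁ hf hu
  have cZ := (smooth2_Adens hf hu).cont
  have k0 := h.eps_nonneg
  have m1 : (m : ℝ)⁻¹ ≤ 1 := inv_le_one_of_one_le₀ (by exact_mod_cast h.pos)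
  have m0 : (0 : ℝ) ≤ (m : ℝ)⁻¹ := by positivity
  have l0 : 0 < Real.exp (u t 0) := Real.exp_pos _
  have cN := hH.cont.norm.add hP.cont.norm
  have hA : Cont2 fun t θ => Hmc f u t θ + (m : ℝ)⁻¹ • cur₁ f u t θ :=
    hH.cont.add ((Cont2.const _).smul hP.cont)
  have hz : ∀ θ, |(0 : ℝ)| ≤ 10 * Adens f u t θ := fun θ => by
    rw [abs_zero]; linarith [Adens_nonneg (f := f) (u := u) t θ]
  have tang : ∀ {a θ : ℝ}, |a| ≤ 10 * Adens f u t θ → |(m : ℝ)⁻¹ * a| ≤ 10 * Adens f u t θ := by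
    intro a θ ha
    rw [abs_mul, abs_of_nonneg m0]
    nlinarith [abs_nonneg a]
  have key := h.fc_sq_le (A := fun t θ => Hmc f u t θ + (m : ℝ)⁻¹ • cur₁ f u t θ)
    (B := fun _ _ => 0) (κ := fun t θ => 10 * Adens f u t θ)
    (β := 2600 * (Real.exp (u t 0) * ε) * circInt (fun t θ => ‖Hmc f u t θ‖ + ‖cur₁ f u t θ‖) t)
    hA (Cont2.const 0) ((Cont2.const (10 : ℝ)).mul cZ)
    (fun θ => by
      rw [inner_add_right, inner_smul_right, h.conf.t_Hmc h.nhds, zero_add]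
      exact tang (h.conf.abs_inner_cur₁_le h.nhds θ).1)
    (fun θ => by
      rw [inner_add_right, inner_smul_right, h.conf.th_Hmc h.nhds, zero_add]
      exact tang (h.conf.abs_inner_cur₁_le h.nhds θ).2)
    (fun θ => by rw [inner_zero_right]; exact hz θ)
    (fun θ => by rw [inner_zero_right]; exact hz θ) (fun x y => by
      have z0 := circInt_wedge_eq_zero hf hu h1 h2 x y (f t 0 + (m : ℝ)⁻¹ • pt f t 0)
      have c1 : Cont2 fun t' θ => ⟪wedge x y (cos (m * θ) • pt f t 0 - sin (m * θ) • pth f t 0),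
          Hmc f u t' θ + (m : ℝ)⁻¹ • cur₁ f u t' θ⟫_ℝ + ⟪wedge x y (sin (m * θ) • pt f t 0 +
            cos (m * θ) • pth f t 0), (0 : 𝔼 n)⟫_ℝ := by
        have c := cont2_cos m
        have s := cont2_sin m
        simp only [Int.cast_natCast] at c s
        exact (((wedge x y).continuous.comp ((c.smul (Cont2.const _)).sub
          (s.smul (Cont2.const _)))).inner hA).add (((wedge x y).continuous.comp
          ((s.smul (Cont2.const _)).add (c.smul (Cont2.const _)))).inner continuous_const)
      have c2 : Cont2 fun t' θ => ⟪wedge x y (pt f t' θ), Hmc f u t' θ⟫_ℝ -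
          ⟪wedge x y (f t' θ - (f t 0 + (m : ℝ)⁻¹ • pt f t 0)), cur₁ f u t' θ⟫_ℝ :=
        (((wedge x y).continuous.comp hf.pt.cont).inner hH.cont).sub
          (((wedge x y).continuous.comp (hf.cont.sub (Cont2.const _))).inner hP.cont)
      have e1 := circInt_sub c1 c2 t
      rw [z0, sub_zero] at e1
      rw [← e1]
      have b1 := abs_circInt_le (c1.sub c2) ((Cont2.const (2 * (‖x‖ * ‖y‖) *
        (1300 * (Real.exp (u t 0) * ε)))).mul cN) (t := t) fun θ hθ => by
        have e : ⟪wedge x y (cos (m * θ) • pt f t 0 - sin (m * θ) • pth f t 0),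
            Hmc f u t θ + (m : ℝ)⁻¹ • cur₁ f u t θ⟫_ℝ + ⟪wedge x y (sin (m * θ) • pt f t 0 +
            cos (m * θ) • pth f t 0), (0 : 𝔼 n)⟫_ℝ - (⟪wedge x y (pt f t θ), Hmc f u t θ⟫_ℝ -
          ⟪wedge x y (f t θ - (f t 0 + (m : ℝ)⁻¹ • pt f t 0)), cur₁ f u t θ⟫_ℝ) =
          -⟪wedge x y (pt f t θ - (cos (m * θ) • pt f t 0 - sin (m * θ) • pth f t 0)),
            Hmc f u t θ⟫_ℝ + ⟪wedge x y (f t θ - (f t 0 + (m : ℝ)⁻¹ • pt f t 0) +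
            (m : ℝ)⁻¹ • (cos (m * θ) • pt f t 0 - sin (m * θ) • pth f t 0)), cur₁ f u t θ⟫_ℝ := by
          simp only [map_sub, map_add, map_smul, inner_add_left, inner_sub_left, inner_add_right,
            real_inner_smul_left, inner_smul_right, inner_zero_right]
          ring
        rw [e]
        refine (abs_add_le _ _).trans ?_
        rw [abs_neg]
        have xy : 0 ≤ 2 * (‖x‖ * ‖y‖) := by positivity
        have le : 0 ≤ Real.exp (u t 0) * ε := by positivity
        have a1 := (abs_inner_wedge_le x y _ (Hmc f u t θ)).trans (mul_le_mul_of_nonneg_left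
          (mul_le_mul_of_nonneg_right ((h.t_approx hθ).trans
            (by linarith : _ ≤ 1300 * (Real.exp (u t 0) * ε))) (norm_nonneg _)) xy)
        have a2 := (abs_inner_wedge_le x y _ (cur₁ f u t θ)).trans (mul_le_mul_of_nonneg_left
          (mul_le_mul_of_nonneg_right (h.f_approx hθ) (norm_nonneg _)) xy)
        linarith
      rw [circInt_const_mul] at b1
      refine b1.trans (le_of_eq (by ring)))
  have e0 : (fun t θ => -(Hmc f u t θ + (m : ℝ)⁻¹ • cur₁ f u t θ)) =
    fun t θ => -(fun t θ => Hmc f u t θ + (m : ℝ)⁻¹ • cur₁ f u t θ) t θ := rfl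
  refine (le_of_eq ?_).trans (key.trans ?_)
  · rfl
  rw [circInt_const_mul]
  have n1 : 0 ≤ circInt (Adens f u) t := circInt_nonneg fun θ => Adens_nonneg t θ
  have n2 : 0 ≤ circInt (Gdens f u) t := circInt_nonneg fun θ => Gdens_nonneg t θ
  have n3 : 0 ≤ circInt (fun t θ => Adens f u t θ ^ 2) t := circInt_nonneg fun θ => sq_nonneg _
  have hN : circInt (fun t θ => ‖Hmc f u t θ + (m : ℝ)⁻¹ • cur₁ f u t θ‖ + ‖(0 : 𝔼 n)‖) t ≤
      circInt (fun t θ => ‖Hmc f u t θ‖ + ‖cur₁ f u t θ‖) t :=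
    circInt_mono (hA.norm.add (Cont2.const _)) cN fun θ => by
      rw [norm_zero, add_zero]
      refine (norm_add_le _ _).trans ?_
      rw [norm_smul, Real.norm_of_nonneg m0]
      nlinarith [norm_nonneg (cur₁ f u t θ)]
  have hN0 : 0 ≤ circInt (fun t θ => ‖Hmc f u t θ + (m : ℝ)⁻¹ • cur₁ f u t θ‖ + ‖(0 : 𝔼 n)‖) t :=
    circInt_nonneg fun θ => by positivity
  have hq := h.quadratic_energy_le
  have hE := mul_le_mul_of_nonneg_right h.energy_le n1
  generalize circInt (fun t θ => ‖Hmc f u t θ + (m : ℝ)⁻¹ • cur₁ f u t θ‖ + ‖(0 : 𝔼 n)‖) t = N' at *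
  generalize circInt (fun t θ => ‖Hmc f u t θ‖ + ‖cur₁ f u t θ‖) t = N at *
  generalize circInt (Adens f u) t = E at *
  generalize circInt (Gdens f u) t = G at *
  generalize circInt (fun t θ => Adens f u t θ ^ 2) t = D at *
  generalize Real.exp (u t 0) = l at *
  have p1 : (l * ε * N') ^ 2 ≤ (l * ε * N) ^ 2 :=
    pow_le_pow_left₀ (by positivity) (mul_le_mul_of_nonneg_left hN (by positivity)) 2
  have p2 : (l * ε * N) ^ 2 ≤ 30000 * (ε ^ 2 * (E + G + D)) := by
    have := mul_le_mul_of_nonneg_left hq (sq_nonneg ε)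
    calc (l * ε * N) ^ 2 = ε ^ 2 * (l ^ 2 * N ^ 2) := by ring
      _ ≤ _ := this
      _ = _ := by ring
  have p3 : (4 * (10 * E) + 100 * (l * ε) * N') ^ 2 ≤ 3200 * (E * E) + 20000 * (l * ε * N') ^ 2 := by
    nlinarith [sq_nonneg (40 * E - 100 * (l * ε * N'))]
  have p4 : 0 ≤ ε ^ 2 * G := by positivity
  have p5 : 0 ≤ ε ^ 2 * D := by positivity
  have p6 : (2600 * (l * ε) * N) ^ 2 = 6760000 * (l * ε * N) ^ 2 := by ring
  rw [p6]
  nlinarith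

lemma rescaled_sub_le (h : NearCircle f u s m t ε) {θ : ℝ} (hθ : θ ∈ Icc 0 (2 * π)) {Z φ : 𝔼 n}
    (hZ : ‖Z‖ = Real.exp (u t θ)) (hφ : ‖Z - φ‖ ≤ 200 * (Real.exp (u t 0) * ε)) :
    ‖φ - (Real.exp (u t 0) ^ 2 * Real.exp (-(2 * u t θ))) • Z‖ ≤
      300 * (Real.exp (u t 0) * ε) := by
  have h0 := h.eps_nonneg
  have h1 := h.abs_u_sub_le hθ
  have hs := h.small
  have e1 : Real.exp (u t 0) ^ 2 * Real.exp (-(2 * u t θ)) =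
      Real.exp (-(2 * (u t θ - u t 0))) := by
    rw [← Real.exp_nat_mul, ← Real.exp_add]; congr 1; push_cast; ring
  have h2 : 2 * π * ε ≤ 1 / 2 := by nlinarith [Real.pi_lt_d2]
  have h3 : |-(2 * (u t θ - u t 0))| ≤ 4 * π * ε := by
    rw [abs_neg, abs_mul, abs_two]; linarith
  have h4 := Real.abs_exp_sub_one_le (h3.trans (by linarith))
  have h5 : |Real.exp (-(2 * (u t θ - u t 0))) - 1| ≤ 26 * ε := by
    nlinarith [Real.pi_lt_d2]
  have h6 := h.exp_le hθ
  rw [e1]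
  have e2 : φ - Real.exp (-(2 * (u t θ - u t 0))) • Z =
      -(Z - φ) - (Real.exp (-(2 * (u t θ - u t 0))) - 1) • Z := by module
  rw [e2]
  refine (norm_sub_le _ _).trans ?_
  rw [norm_neg, norm_smul, hZ, Real.norm_eq_abs]
  have h7 := mul_le_mul h5 h6 (Real.exp_pos _).le (by positivity)
  have h8 : 0 ≤ Real.exp (u t 0) * ε := by positivity
  linarith

/-- The resonant Fourier coefficient of the trace-free second fundamental form. -/
lemma resonant_B (h : NearCircle f u s m t ε) :
    Real.exp (-(2 * u t 0)) * (‖fc m (trf₁ f u) (trf₂ f u) t‖ ^ 2 +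
      ‖fc m (trf₂ f u) (fun t θ => -trf₁ f u t θ) t‖ ^ 2) ≤
      10 ^ 9 * (ε ^ 2 * circInt (Bdens f u) t) + 10 ^ 4 * circInt (Hdens f u) t := by
  have hf := h.conf.s2f
  have hu := h.conf.s2u
  have hH := smooth2_Hmc hf hu
  have h₁ := smooth2_trf₁ hf hu
  have h₂ := smooth2_trf₂ hf hu
  have k0 := h.eps_nonneg
  have l0 : 0 < Real.exp (u t 0) := Real.exp_pos _
  have cN := h₁.cont.norm.add h₂.cont.norm
  have key := h.fc_sq_le (A := trf₁ f u) (B := trf₂ f u) (κ := fun _ _ => 0)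
    (β := 600 * (Real.exp (u t 0) * ε) * circInt (fun t θ => ‖trf₁ f u t θ‖ + ‖trf₂ f u t θ‖) t +
      6 * Real.exp (u t 0) ^ 3 * circInt (fun t θ => ‖Hmc f u t θ‖) t)
    h₁.cont h₂.cont (Cont2.const 0)
    (fun θ => by rw [h.conf.t_trf₁ h.nhds, abs_zero])
    (fun θ => by rw [h.conf.th_trf₁ h.nhds, abs_zero])
    (fun θ => by rw [h.conf.t_trf₂ h.nhds, abs_zero])
    (fun θ => by rw [h.conf.th_trf₂ h.nhds, abs_zero]) (fun x y => by
      have z0 := circInt_wedge_trf hf hu h.conf.pf h.conf.pu x y t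
      have c1 : Cont2 fun t' θ => ⟪wedge x y (cos (m * θ) • pt f t 0 - sin (m * θ) • pth f t 0),
          trf₁ f u t' θ⟫_ℝ + ⟪wedge x y (sin (m * θ) • pt f t 0 +
            cos (m * θ) • pth f t 0), trf₂ f u t' θ⟫_ℝ := by
        have c := cont2_cos m
        have s := cont2_sin m
        simp only [Int.cast_natCast] at c s
        exact (((wedge x y).continuous.comp ((c.smul (Cont2.const _)).sub
          (s.smul (Cont2.const _)))).inner h₁.cont).add (((wedge x y).continuous.comp
          ((s.smul (Cont2.const _)).add (c.smul (Cont2.const _)))).inner h₂.cont)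
      have c2 : Cont2 fun t θ => Real.exp (-(2 * u t θ)) *
          (⟪wedge x y (pt f t θ), trf₁ f u t θ⟫_ℝ + ⟪wedge x y (pth f t θ), trf₂ f u t θ⟫_ℝ) -
          ⟪wedge x y (pt f t θ), Hmc f u t θ⟫_ℝ :=
        ((smooth2_expfac_neg hu 2).cont.mul (((hf.pt.clm (wedge x y)).cont.inner
          h₁.cont).add ((hf.pth.clm (wedge x y)).cont.inner h₂.cont))).sub
          ((hf.pt.clm (wedge x y)).cont.inner hH.cont)
      have c3 := (Cont2.const (Real.exp (u t 0) ^ 2)).mul c2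
      have e1 := circInt_sub c1 c3 t
      rw [circInt_const_mul, z0, mul_zero, sub_zero] at e1
      rw [← e1]
      have c4 := (Cont2.const (2 * (‖x‖ * ‖y‖) * (300 * (Real.exp (u t 0) * ε)))).mul cN
      have c5 := (Cont2.const (2 * (‖x‖ * ‖y‖) * (3 * Real.exp (u t 0) ^ 3))).mul hH.cont.norm
      have b1 := abs_circInt_le (c1.sub c3) (c4.add c5) (t := t) fun θ hθ => by
        set w := Real.exp (u t 0) ^ 2 * Real.exp (-(2 * u t θ)) with hw
        set φ₁ := cos (m * θ) • pt f t 0 - sin (m * θ) • pth f t 0 with hφ₁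
        set φ₂ := sin (m * θ) • pt f t 0 + cos (m * θ) • pth f t 0 with hφ₂
        have e : ⟪wedge x y φ₁, trf₁ f u t θ⟫_ℝ + ⟪wedge x y φ₂, trf₂ f u t θ⟫_ℝ -
            Real.exp (u t 0) ^ 2 * (Real.exp (-(2 * u t θ)) *
              (⟪wedge x y (pt f t θ), trf₁ f u t θ⟫_ℝ + ⟪wedge x y (pth f t θ), trf₂ f u t θ⟫_ℝ) -
            ⟪wedge x y (pt f t θ), Hmc f u t θ⟫_ℝ) =
            ⟪wedge x y (φ₁ - w • pt f t θ), trf₁ f u t θ⟫_ℝ +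
            ⟪wedge x y (φ₂ - w • pth f t θ), trf₂ f u t θ⟫_ℝ +
            Real.exp (u t 0) ^ 2 * ⟪wedge x y (pt f t θ), Hmc f u t θ⟫_ℝ := by
          simp only [map_sub, map_smul, inner_sub_left, real_inner_smul_left, hw]
          ring
        rw [e]
        refine (abs_add_le _ _).trans ((add_le_add_left (abs_add_le _ _) _).trans ?_)
        have xy : 0 ≤ 2 * (‖x‖ * ‖y‖) := by positivity
        have a1 := (abs_inner_wedge_le x y _ (trf₁ f u t θ)).trans (mul_le_mul_of_nonneg_left
          (mul_le_mul_of_nonneg_right (h.rescaled_sub_le hθ (h.conf_norm_t θ) (h.t_approx hθ))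
            (norm_nonneg _)) xy)
        have a2 := (abs_inner_wedge_le x y _ (trf₂ f u t θ)).trans (mul_le_mul_of_nonneg_left
          (mul_le_mul_of_nonneg_right (h.rescaled_sub_le hθ (h.conf_norm_th θ) (h.th_approx hθ))
            (norm_nonneg _)) xy)
        have a3 := (abs_inner_wedge_le x y (pt f t θ) (Hmc f u t θ)).trans
          (mul_le_mul_of_nonneg_left (mul_le_mul_of_nonneg_right
            ((h.conf_norm_t θ).trans_le (h.exp_le hθ)) (norm_nonneg _)) xy)
        have a4 := mul_le_mul_of_nonneg_left a3 (sq_nonneg (Real.exp (u t 0)))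
        rw [abs_mul, abs_of_nonneg (sq_nonneg (Real.exp (u t 0)))]
        linarith
      rw [circInt_add c4 c5, circInt_const_mul, circInt_const_mul] at b1
      exact b1.trans (le_of_eq (by ring)))
  have cH := h.exp_sq_mul_circInt_sq_le hH.cont.norm
  have eH : circInt (fun t θ => Real.exp (2 * u t θ) * ‖Hmc f u t θ‖ ^ 2) t =
      circInt (Hdens f u) t := circInt_congr fun θ => mul_comm _ _
  rw [eH] at cH
  have cB := h.exp_neg_sq_mul_circInt_sq_le cN
  have eB := circInt_mono ((smooth2_expfac_neg hu 2).cont.mul (cN.pow 2))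
    ((Cont2.const (2 : ℝ)).mul (smooth2_Bdens hf hu).cont) (t := t) fun θ => by
      have := Real.exp_pos (-(2 * u t θ))
      rw [Bdens]
      nlinarith [sq_nonneg (‖trf₁ f u t θ‖ - ‖trf₂ f u t θ‖)]
  rw [circInt_const_mul] at eB
  have ez : circInt (fun _ _ => (0 : ℝ)) t = 0 := by rw [circInt_const, mul_zero]
  rw [ez] at key
  have e3 : Real.exp (-(2 * u t 0)) * (Real.exp (u t 0) ^ 2 * Real.exp (u t 0) ^ 2) =
      Real.exp (u t 0) ^ 2 := by
    rw [← Real.exp_nat_mul, ← Real.exp_add, ← Real.exp_add]; congr 1; push_cast; ring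
  have e4 : Real.exp (-(2 * u t 0)) * Real.exp (u t 0) ^ 2 = 1 := by
    rw [← Real.exp_nat_mul, ← Real.exp_add]; simp
  have w0 := Real.exp_pos (-(2 * u t 0))
  have n1 : 0 ≤ circInt (Bdens f u) t := circInt_nonneg fun θ => Bdens_nonneg t θ
  have n2 : 0 ≤ circInt (Hdens f u) t := circInt_nonneg fun θ => Hdens_nonneg t θ
  generalize ‖fc m (trf₁ f u) (trf₂ f u) t‖ ^ 2 +
    ‖fc m (trf₂ f u) (fun t θ => -trf₁ f u t θ) t‖ ^ 2 = X at *
  generalize circInt (fun t θ => ‖Hmc f u t θ‖) t = Y at *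
  generalize circInt (fun t θ => ‖trf₁ f u t θ‖ + ‖trf₂ f u t θ‖) t = N at *
  generalize circInt (fun t θ => Real.exp (-(2 * u t θ)) *
    (‖trf₁ f u t θ‖ + ‖trf₂ f u t θ‖) ^ 2) t = N₂ at *
  generalize circInt (Bdens f u) t = b at *
  generalize circInt (Hdens f u) t = a at *
  generalize Real.exp (-(2 * u t 0)) = w at *
  generalize Real.exp (u t 0) = l at *
  have q1 : N ^ 2 ≤ l ^ 2 * (114 * b) :=
    cB.trans (mul_le_mul_of_nonneg_left (by linarith) (sq_nonneg l))
  have q2 : l ^ 2 * X ≤ 1520000 * (l ^ 2 * (ε ^ 2 * N ^ 2)) + 144 * (l ^ 4 * (l ^ 2 * Y ^ 2)) := by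
    nlinarith [sq_nonneg (600 * (l * ε) * N - 6 * l ^ 3 * Y)]
  have q3 : X ≤ 1520000 * (ε ^ 2 * N ^ 2) + 144 * (l ^ 2 * (l ^ 2 * Y ^ 2)) := by
    have l2 : 0 < l ^ 2 := by positivity
    refine le_of_mul_le_mul_left (q2.trans (le_of_eq (by ring))) l2
  have q4 : X ≤ 1520000 * (ε ^ 2 * (l ^ 2 * (114 * b))) + 144 * (l ^ 2 * (57 * a)) := by
    refine q3.trans (add_le_add ?_ ?_) <;> gcongr
  have q5 := mul_le_mul_of_nonneg_left q4 w0.le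
  have q6 : w * (1520000 * (ε ^ 2 * (l ^ 2 * (114 * b))) + 144 * (l ^ 2 * (57 * a))) =
      1520000 * 114 * (ε ^ 2 * b) + 144 * 57 * a := by
    linear_combination (1520000 * 114 * (ε ^ 2 * b) + 144 * 57 * a) * e4
  rw [q6] at q5
  have q7 : 0 ≤ ε ^ 2 * b := by positivity
  linarith

end NearCircle

end ResonantModes

section WeightedModes

variable {V : Type*} [NormedAddCommGroup V] [InnerProductSpace ℝ V]

lemma weighted_spectral_estimate {a b q d : ℝ} (hab : a ≤ b) (hqd : q + d < 2)
    {y₁ y₂ s₁ s₂ : ℤ → ℝ → V} {g g' ω ω' η η' X Y Z : ℝ → ℝ} (κ : ℤ)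
    (hy₁ : ∀ k, ∀ t ∈ Icc a b, HasDerivAt (y₁ k) ((k : ℝ) • y₁ k t + s₁ k t) t)
    (hy₂ : ∀ k, ∀ t ∈ Icc a b, HasDerivAt (y₂ k) ((k : ℝ) • y₂ k t + s₂ k t) t)
    (hy₁c : ∀ k, Continuous (y₁ k)) (hy₂c : ∀ k, Continuous (y₂ k))
    (hs₁c : ∀ k, Continuous (s₁ k)) (hs₂c : ∀ k, Continuous (s₂ k))
    (hg : ∀ t, HasDerivAt g (g' t) t) (hg'c : Continuous g')
    (hgκ : ∀ t ∈ Icc a b, |g' t + 2 * (κ : ℝ)| ≤ d)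
    (hω : ∀ t, HasDerivAt ω (ω' t) t) (hω'c : Continuous ω') (hω0 : ∀ t, 0 < ω t)
    (hωq : ∀ t, |ω' t| ≤ q * ω t)
    (hη : ∀ t, HasDerivAt η (η' t) t) (hη'c : Continuous η') (ha : η a = 0) (hb : η b = 0)
    (hXc : Continuous X) (hYc : Continuous Y) (hZc : Continuous Z)
    (hX : ∀ F : Finset ℤ, ∀ t ∈ Icc a b,
      Real.exp (g t) * ∑ k ∈ F, (‖s₁ k t‖ ^ 2 + ‖s₂ k t‖ ^ 2) ≤ X t)
    (hY : ∀ F : Finset ℤ, ∀ t ∈ Icc a b,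
      Real.exp (g t) * ∑ k ∈ F, (‖y₁ k t‖ ^ 2 + ‖y₂ k t‖ ^ 2) ≤ Y t)
    (hZ : ∀ t ∈ Icc a b, Real.exp (g t) * (‖y₁ κ t‖ ^ 2 + ‖y₂ κ t‖ ^ 2) ≤ Z t) (F : Finset ℤ) :
    ∫ t in a..b, ω t * η t ^ 2 * Real.exp (g t) * ∑ k ∈ F, (‖y₁ k t‖ ^ 2 + ‖y₂ k t‖ ^ 2) ≤
      (∫ t in a..b, ω t * η t ^ 2 * Z t) +
        8 / (2 - q - d) ^ 2 * ∫ t in a..b, ω t * (η t ^ 2 * X t + η' t ^ 2 * Y t) := by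
  have hgc : Continuous g := continuous_iff_continuousAt.2 fun t => (hg t).continuousAt
  have hωc : Continuous ω := continuous_iff_continuousAt.2 fun t => (hω t).continuousAt
  have hdiv : ∀ {t x y : ℝ}, Real.exp (g t) * x ≤ y → x ≤ Real.exp (-g t) * y := by
    intro t x y hxy
    have := mul_le_mul_of_nonneg_left hxy (Real.exp_pos (-g t)).le
    rwa [← mul_assoc, ← Real.exp_add, neg_add_cancel, Real.exp_zero, one_mul] at this
  have key := spectral_estimate hab (c := 2 - q - d) (by linarith) κ hy₁ hy₂ hy₁c hy₂c hs₁c hs₂c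
    (ρ := fun t => ω t * Real.exp (g t))
    (ρ' := fun t => ω' t * Real.exp (g t) + ω t * (Real.exp (g t) * g' t))
    (fun t => (hω t).mul (hg t).exp) (by fun_prop)
    (fun t => mul_pos (hω0 t) (Real.exp_pos _)) hη hη'c ha hb ?_
    (S := fun t => Real.exp (-g t) * X t) (N := fun t => Real.exp (-g t) * Y t)
    (R := fun t => Real.exp (-g t) * Z t) (by fun_prop) (by fun_prop) (by fun_prop)
    (fun F t ht => hdiv (hX F t ht)) (fun F t ht => hdiv (hY F t ht))
    (fun t ht => hdiv (hZ t ht)) F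
  · have hE : ∀ t, Real.exp (g t) * Real.exp (-g t) = 1 := fun t => by
      rw [← Real.exp_add, add_neg_cancel, Real.exp_zero]
    refine le_of_eq_of_le ?_ (key.trans_eq ?_)
    · congr 1; funext t; ring
    · congr 1
      · congr 1; funext t
        linear_combination (ω t * η t ^ 2 * Z t) * hE t
      · congr 2; funext t
        linear_combination (ω t * (η t ^ 2 * X t + η' t ^ 2 * Y t)) * hE t
  · intro k hk
    have hE : ∀ t, 0 ≤ ω t * Real.exp (g t) := fun t => (mul_pos (hω0 t) (Real.exp_pos _)).le
    rcases lt_or_gt_of_ne hk with h | h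
    · refine Or.inr fun t ht => ?_
      have hk' : (k : ℝ) + 1 ≤ κ := by exact_mod_cast h
      have h1 := (abs_le.1 (hgκ t ht)).2
      have h2 := mul_le_mul_of_nonneg_right (abs_le.1 (hωq t)).2 (Real.exp_pos (g t)).le
      have h3 := mul_le_mul_of_nonneg_left
        (show g' t + 2 * (k : ℝ) ≤ d - 2 by linarith) (hE t)
      linarith
    · refine Or.inl fun t ht => ?_
      have hk' : (κ : ℝ) + 1 ≤ k := by exact_mod_cast h
      have h1 := (abs_le.1 (hgκ t ht)).1
      have h2 := mul_le_mul_of_nonneg_right (abs_le.1 (hωq t)).1 (Real.exp_pos (g t)).le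
      have h3 := mul_le_mul_of_nonneg_left
        (show 2 - d ≤ g' t + 2 * (k : ℝ) by linarith) (hE t)
      linarith

lemma fc_neg_index (k : ℤ) (A B : ℝ → ℝ → V) (t : ℝ) :
    fc (-k) A B t = fc k A (fun t θ => -B t θ) t := by
  unfold fc
  refine circInt_congr fun θ => ?_
  simp

lemma fc_neg_index_neg (k : ℤ) (A B : ℝ → ℝ → V) (t : ℝ) :
    fc (-k) (fun t θ => -A t θ) B t = -fc k A B t := by
  rw [← fc_neg, fc_neg_index]

/-- Fourier modes of a Cauchy-Riemann system with right-hand side. -/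
lemma fc_hasDerivAt_cauchyRiemann [CompleteSpace V] (k : ℤ) {A B σ τ : ℝ → ℝ → V}
    (hA : Smooth2 A) (hB : Smooth2 B) (hσ : Cont2 σ) (hτ : Cont2 τ)
    (pA : Periodic2 A) (pB : Periodic2 B) {t : ℝ}
    (h₁ : ∀ θ, pt A t θ = pth B t θ + σ t θ) (h₂ : ∀ θ, pt B t θ = -pth A t θ + τ t θ) :
    HasDerivAt (fc k A B) ((k : ℝ) • fc k A B t + fc k σ τ t) t := by
  refine (fc_hasDerivAt k hA hB t).congr_deriv ?_
  have e : fc k (pth B) (fun t θ => -pth A t θ) t = (k : ℝ) • fc k A B t := by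
    have h := fc_pth k hB hA.neg pB (fun t θ => by simp only [pA t θ]) t
    have h' : ∀ θ, pth (fun t θ => -A t θ) t θ = -pth A t θ := fun θ => (hA.dth t θ).neg.deriv
    rw [fc_congr k (A' := pth B) (B' := fun t θ => -pth A t θ) (fun _ => rfl) h', fc_neg] at h
    rw [h]; simp
  rw [fc_congr k (A' := fun t θ => pth B t θ + σ t θ)
    (B' := fun t θ => -pth A t θ + τ t θ) h₁ h₂, fc_add k hB.pth.cont hA.pth.neg.cont hσ hτ, e]

end WeightedModes

section WeightedEstimates

local notation "𝔼" n => EuclideanSpace ℝ (Fin n)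

variable {f : ℝ → ℝ → 𝔼 n} {u : ℝ → ℝ → ℝ} {s : Set ℝ} {m : ℕ} {t ε : ℝ}

namespace NearCircle

lemma exp_two_mul_le (h : NearCircle f u s m t ε) {θ : ℝ} (hθ : θ ∈ Icc 0 (2 * π)) :
    Real.exp (2 * u t θ) ≤ 9 * Real.exp (2 * u t 0) := by
  have := h.exp_le hθ
  rw [two_mul, two_mul, Real.exp_add, Real.exp_add]
  nlinarith [Real.exp_pos (u t θ), Real.exp_pos (u t 0)]

lemma le_exp_two_mul (h : NearCircle f u s m t ε) {θ : ℝ} (hθ : θ ∈ Icc 0 (2 * π)) :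
    Real.exp (2 * u t 0) ≤ 9 * Real.exp (2 * u t θ) := by
  have := h.le_exp hθ
  rw [two_mul, two_mul, Real.exp_add, Real.exp_add]
  nlinarith [Real.exp_pos (u t θ), Real.exp_pos (u t 0)]

lemma exp_neg_two_mul_le (h : NearCircle f u s m t ε) {θ : ℝ} (hθ : θ ∈ Icc 0 (2 * π)) :
    Real.exp (-(2 * u t θ)) ≤ 9 * Real.exp (-(2 * u t 0)) := by
  rw [Real.exp_neg, Real.exp_neg, ← div_eq_mul_inv, le_div_iff₀ (Real.exp_pos _), ← div_eq_inv_mul,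
    div_le_iff₀ (Real.exp_pos _)]
  exact h.le_exp_two_mul hθ

lemma le_exp_neg_two_mul (h : NearCircle f u s m t ε) {θ : ℝ} (hθ : θ ∈ Icc 0 (2 * π)) :
    Real.exp (-(2 * u t 0)) ≤ 9 * Real.exp (-(2 * u t θ)) := by
  rw [Real.exp_neg, Real.exp_neg, ← div_eq_mul_inv, le_div_iff₀ (Real.exp_pos _), ← div_eq_inv_mul,
    div_le_iff₀ (Real.exp_pos _)]
  exact h.exp_two_mul_le hθ

lemma exp_mul_circInt_le (h : NearCircle f u s m t ε) {F G : ℝ → ℝ → ℝ} (hF : Cont2 F)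
    (hG : Cont2 G) (hF0 : ∀ θ, 0 ≤ F t θ) (hFG : ∀ θ, Real.exp (2 * u t θ) * F t θ ≤ G t θ) :
    Real.exp (2 * u t 0) * circInt F t ≤ 9 * circInt G t := by
  rw [← circInt_const_mul, ← circInt_const_mul]
  refine circInt_mono_on ((Cont2.const _).mul hF) ((Cont2.const _).mul hG) fun θ hθ => ?_
  have h1 := mul_le_mul_of_nonneg_right (h.le_exp_two_mul hθ) (hF0 θ)
  linarith [hFG θ]

lemma circInt_exp_mul_le (h : NearCircle f u s m t ε) {F : ℝ → ℝ → ℝ} (hF : Cont2 F)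
    (hF0 : ∀ θ, 0 ≤ F t θ) : circInt (fun t θ => Real.exp (2 * u t θ) * F t θ) t ≤
      9 * (Real.exp (2 * u t 0) * circInt F t) := by
  rw [← circInt_const_mul, ← circInt_const_mul]
  refine circInt_mono_on ((smooth2_expfac h.conf.s2u 2).cont.mul hF)
    ((Cont2.const _).mul ((Cont2.const _).mul hF)) fun θ hθ => ?_
  have h1 := mul_le_mul_of_nonneg_right (h.exp_two_mul_le hθ) (hF0 θ)
  linarith

lemma exp_neg_mul_circInt_le (h : NearCircle f u s m t ε) {F G : ℝ → ℝ → ℝ} (hF : Cont2 F)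
    (hG : Cont2 G) (hF0 : ∀ θ, 0 ≤ F t θ) (hFG : ∀ θ, Real.exp (-(2 * u t θ)) * F t θ ≤ G t θ) :
    Real.exp (-(2 * u t 0)) * circInt F t ≤ 9 * circInt G t := by
  rw [← circInt_const_mul, ← circInt_const_mul]
  refine circInt_mono_on ((Cont2.const _).mul hF) ((Cont2.const _).mul hG) fun θ hθ => ?_
  have h1 := mul_le_mul_of_nonneg_right (h.le_exp_neg_two_mul hθ) (hF0 θ)
  linarith [hFG θ]

lemma circInt_exp_neg_mul_le (h : NearCircle f u s m t ε) {F : ℝ → ℝ → ℝ} (hF : Cont2 F)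
    (hF0 : ∀ θ, 0 ≤ F t θ) : circInt (fun t θ => Real.exp (-(2 * u t θ)) * F t θ) t ≤
      9 * (Real.exp (-(2 * u t 0)) * circInt F t) := by
  rw [← circInt_const_mul, ← circInt_const_mul]
  refine circInt_mono_on ((smooth2_expfac_neg h.conf.s2u 2).cont.mul hF)
    ((Cont2.const _).mul ((Cont2.const _).mul hF)) fun θ hθ => ?_
  have h1 := mul_le_mul_of_nonneg_right (h.exp_neg_two_mul_le hθ) (hF0 θ)
  linarith

end NearCircle

lemma weighted_estimate_B {a b q : ℝ} (hab : a ≤ b) (hq : q + 2 * ε < 2)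
    (near : ∀ t ∈ Icc a b, NearCircle f u s m t ε) {ω ω' η η' : ℝ → ℝ}
    (hω : ∀ t, HasDerivAt ω (ω' t) t) (hω'c : Continuous ω') (hω0 : ∀ t, 0 < ω t)
    (hωq : ∀ t, |ω' t| ≤ q * ω t)
    (hη : ∀ t, HasDerivAt η (η' t) t) (hη'c : Continuous η') (ha : η a = 0) (hb : η b = 0) :
    ∫ t in a..b, ω t * η t ^ 2 * circInt (Bdens f u) t ≤
      2 * ((∫ t in a..b, ω t * η t ^ 2 *
        (10 ^ 9 * (ε ^ 2 * circInt (Bdens f u) t) + 10 ^ 4 * circInt (Hdens f u) t)) +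
      8 / (2 - q - 2 * ε) ^ 2 * ∫ t in a..b, ω t * (η t ^ 2 *
        (10 ^ 4 * (circInt (Gdens f u) t + circInt (fun t θ => Adens f u t θ ^ 2) t)) +
        η' t ^ 2 * (10 ^ 3 * circInt (Bdens f u) t))) := by
  have hN := near a (left_mem_Icc.2 hab)
  have hf := hN.conf.s2f
  have hu := hN.conf.s2u
  have pf := hN.conf.pf
  have pu := hN.conf.pu
  have h₁ := smooth2_trf₁ hf hu
  have h₂ := smooth2_trf₂ hf hu
  have cA := (smooth2_Adens hf hu).cont
  have cG := (smooth2_Gdens hf hu).cont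
  have cB := (smooth2_Bdens hf hu).cont
  have cH := (smooth2_Hdens hf hu).cont
  have cσ := (h₁.pt.add h₂.pth).cont
  have cτ := (h₁.pth.sub h₂.pt).cont
  have cN : Cont2 fun t θ => ‖trf₁ f u t θ‖ ^ 2 + ‖-trf₂ f u t θ‖ ^ 2 :=
    (h₁.cont.norm.pow 2).add (h₂.neg.cont.norm.pow 2)
  have hωc : Continuous ω := continuous_iff_continuousAt.2 fun t => (hω t).continuousAt
  have hηc : Continuous η := continuous_iff_continuousAt.2 fun t => (hη t).continuousAt
  have hπ : π ≤ 4 := pi_le_four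
  have huc := hu.continuous_fst 0
  have key := integral_le_of_modes h₁.cont h₂.neg.cont
    (w := fun t => ω t * η t ^ 2 * Real.exp (-(2 * u t 0)))
    (by fun_prop) (fun t => by have := hω0 t; positivity) fun F =>
    weighted_spectral_estimate hab (d := 2 * ε) hq
    (y₁ := fun k => fc k (trf₁ f u) fun t θ => -trf₂ f u t θ)
    (y₂ := fun k => fc k (fun t θ => -trf₂ f u t θ) fun t θ => -trf₁ f u t θ)
    (s₁ := fun k => fc k (fun t θ => pt (trf₁ f u) t θ + pth (trf₂ f u) t θ)
      fun t θ => pth (trf₁ f u) t θ - pt (trf₂ f u) t θ)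
    (s₂ := fun k => fc k (fun t θ => pth (trf₁ f u) t θ - pt (trf₂ f u) t θ)
      fun t θ => -(pt (trf₁ f u) t θ + pth (trf₂ f u) t θ))
    (g := fun t => -(2 * u t 0)) (g' := fun t => -(2 * pt u t 0)) (-(m : ℤ))
    (fun k t _ => fc_hasDerivAt_cauchyRiemann k h₁ h₂.neg cσ cτ (periodic2_trf₁ pf pu)
      (fun t θ => by simp only [periodic2_trf₂ pf pu t θ])
      (fun θ => by
        rw [show pth (fun t θ => -trf₂ f u t θ) t θ = _ from (h₂.dth t θ).neg.deriv]; abel)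
      (fun θ => by
        rw [show pt (fun t θ => -trf₂ f u t θ) t θ = _ from (h₂.dt t θ).neg.deriv]; abel))
    (fun k t _ => fc_hasDerivAt_cauchyRiemann k h₂.neg h₁.neg cτ cσ.neg
      (fun t θ => by simp only [periodic2_trf₂ pf pu t θ])
      (fun t θ => by simp only [periodic2_trf₁ pf pu t θ])
      (fun θ => by
        rw [show pt (fun t θ => -trf₂ f u t θ) t θ = _ from (h₂.dt t θ).neg.deriv,
          show pth (fun t θ => -trf₁ f u t θ) t θ = _ from (h₁.dth t θ).neg.deriv]; abel)
      (fun θ => by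
        rw [show pth (fun t θ => -trf₂ f u t θ) t θ = _ from (h₂.dth t θ).neg.deriv,
          show pt (fun t θ => -trf₁ f u t θ) t θ = _ from (h₁.dt t θ).neg.deriv]; abel))
    (fun k => fc_continuous k h₁.cont h₂.neg.cont)
    (fun k => fc_continuous k h₂.neg.cont h₁.neg.cont)
    (fun k => fc_continuous k cσ cτ) (fun k => fc_continuous k cτ cσ.neg)
    (fun t => ((hu.dt t 0).const_mul 2).neg) ((hu.pt.continuous_fst 0).const_smul (2 : ℝ)).neg
    (fun t ht => by
      have := (near t ht).abs_pt_le 0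
      rw [abs_le] at this ⊢
      push_cast
      constructor <;> linarith)
    hω hω'c hω0 hωq hη hη'c ha hb
    (X := fun t => 10 ^ 4 * (circInt (Gdens f u) t + circInt (fun t θ => Adens f u t θ ^ 2) t))
    (Y := fun t => 10 ^ 3 * circInt (Bdens f u) t)
    (Z := fun t => 10 ^ 9 * (ε ^ 2 * circInt (Bdens f u) t) + 10 ^ 4 * circInt (Hdens f u) t)
    ((cG.circInt.add (cA.pow 2).circInt).const_smul (10 ^ 4 : ℝ))
    (cB.circInt.const_smul (10 ^ 3 : ℝ))
    (((cB.circInt.const_smul (ε ^ 2)).const_smul (10 ^ 9 : ℝ)).add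
      (cH.circInt.const_smul (10 ^ 4 : ℝ)))
    (fun F t ht => by
      have e := Real.exp_pos (-(2 * u t 0))
      have k1 := mul_le_mul_of_nonneg_left (sum_modes_le cσ cτ t F) e.le
      have k2 := (near t ht).exp_neg_mul_circInt_le ((cσ.norm.pow 2).add (cτ.norm.pow 2))
        (((Cont2.const (2 : ℝ)).mul cG).add ((Cont2.const (16 : ℝ)).mul (cA.pow 2)))
        (fun θ => by positivity) fun θ => (near t ht).conf.codazzi_sq_le (near t ht).nhds θ
      rw [circInt_add ((Cont2.const (2 : ℝ)).mul cG) ((Cont2.const (16 : ℝ)).mul (cA.pow 2)),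
        circInt_const_mul, circInt_const_mul] at k2
      have k3 := circInt_nonneg (F := Gdens f u) (t := t) fun θ => Gdens_nonneg t θ
      have k4 := circInt_nonneg (F := fun t θ => Adens f u t θ ^ 2) (t := t) fun θ => sq_nonneg _
      refine k1.trans ?_
      rw [mul_left_comm]
      refine (mul_le_mul_of_nonneg_left k2 Real.two_pi_pos.le).trans ?_
      nlinarith)
    (fun F t ht => by
      have e := Real.exp_pos (-(2 * u t 0))
      have k1 := mul_le_mul_of_nonneg_left (sum_modes_le h₁.cont h₂.neg.cont t F) e.le
      have k2 := (near t ht).exp_neg_mul_circInt_le cN cB (fun θ => by positivity)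
        fun θ => by rw [norm_neg]; exact le_rfl
      have k3 := circInt_nonneg (F := Bdens f u) (t := t) fun θ => Bdens_nonneg t θ
      refine k1.trans ?_
      rw [mul_left_comm]
      refine (mul_le_mul_of_nonneg_left k2 Real.two_pi_pos.le).trans ?_
      nlinarith)
    (fun t ht => by
      have k := (near t ht).resonant_B
      have e1 : fc (-(m : ℤ)) (trf₁ f u) (fun t θ => -trf₂ f u t θ) t =
          fc m (trf₁ f u) (trf₂ f u) t := by
        rw [fc_neg_index]; simp only [neg_neg]
      have e2 : fc (-(m : ℤ)) (fun t θ => -trf₂ f u t θ) (fun t θ => -trf₁ f u t θ) t =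
          -fc m (trf₂ f u) (fun t θ => -trf₁ f u t θ) t := fc_neg_index_neg _ _ _ _
      rw [e1, e2, norm_neg]
      exact k) F
  rw [← div_le_iff₀' two_pos]
  refine le_trans ?_ key
  rw [div_le_iff₀' two_pos, ← intervalIntegral.integral_const_mul]
  refine intervalIntegral.integral_mono_on hab
    (Continuous.intervalIntegrable (by have := cB.circInt; fun_prop) _ _)
    (Continuous.intervalIntegrable (by have := cN.circInt; fun_prop) _ _) fun t ht => ?_
  have k1 := (near t ht).circInt_exp_neg_mul_le cN fun θ => by positivity
  have k2 : circInt (Bdens f u) t = circInt (fun t θ => Real.exp (-(2 * u t θ)) *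
      (‖trf₁ f u t θ‖ ^ 2 + ‖-trf₂ f u t θ‖ ^ 2)) t :=
    circInt_congr fun θ => by rw [norm_neg]; rfl
  rw [← k2] at k1
  have k3 : 0 ≤ Real.exp (-(2 * u t 0)) * circInt (fun t θ => ‖trf₁ f u t θ‖ ^ 2 +
      ‖-trf₂ f u t θ‖ ^ 2) t :=
    mul_nonneg (Real.exp_pos _).le (circInt_nonneg fun θ => by positivity)
  have k4 : circInt (Bdens f u) t ≤ 2 * (2 * π * (Real.exp (-(2 * u t 0)) *
      circInt (fun t θ => ‖trf₁ f u t θ‖ ^ 2 + ‖-trf₂ f u t θ‖ ^ 2) t)) := by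
    nlinarith [pi_gt_three]
  have k5 := mul_le_mul_of_nonneg_left k4 (mul_nonneg (hω0 t).le (sq_nonneg (η t)))
  linarith

end WeightedEstimates

section FourierCoefficients

variable {V : Type*} [NormedAddCommGroup V] [InnerProductSpace ℝ V]

/-- The cosine Fourier coefficient on the slice `t`. -/
def cosCoeff (k : ℤ) (A : ℝ → ℝ → V) : ℝ → V := fc k A fun _ _ => 0

/-- The sine Fourier coefficient on the slice `t`. -/
def sinCoeff (k : ℤ) (A : ℝ → ℝ → V) : ℝ → V := fc k (fun _ _ => 0) A

lemma fc_eq_cosCoeff_add_sinCoeff (k : ℤ) {A B : ℝ → ℝ → V} (hA : Cont2 A) (hB : Cont2 B) (t : ℝ) :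
    fc k A B t = cosCoeff k A t + sinCoeff k B t := by
  rw [cosCoeff, sinCoeff, ← fc_add k hA (Cont2.const 0) (Cont2.const 0) hB]
  simp only [add_zero, zero_add]

lemma cosCoeff_add (k : ℤ) {A B : ℝ → ℝ → V} (hA : Cont2 A) (hB : Cont2 B) (t : ℝ) :
    cosCoeff k (fun t θ => A t θ + B t θ) t = cosCoeff k A t + cosCoeff k B t := by
  rw [cosCoeff, cosCoeff, cosCoeff, ← fc_add k hA (Cont2.const 0) hB (Cont2.const 0)]
  simp only [add_zero]

lemma sinCoeff_add (k : ℤ) {A B : ℝ → ℝ → V} (hA : Cont2 A) (hB : Cont2 B) (t : ℝ) :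
    sinCoeff k (fun t θ => A t θ + B t θ) t = sinCoeff k A t + sinCoeff k B t := by
  rw [sinCoeff, sinCoeff, sinCoeff, ← fc_add k (Cont2.const 0) hA (Cont2.const 0) hB]
  simp only [add_zero]

lemma cosCoeff_neg (k : ℤ) (A : ℝ → ℝ → V) (t : ℝ) :
    cosCoeff k (fun t θ => -A t θ) t = -cosCoeff k A t := by
  rw [cosCoeff, cosCoeff, ← fc_neg]; simp only [neg_zero]

lemma sinCoeff_neg (k : ℤ) (A : ℝ → ℝ → V) (t : ℝ) :
    sinCoeff k (fun t θ => -A t θ) t = -sinCoeff k A t := by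
  rw [sinCoeff, sinCoeff, ← fc_neg]; simp only [neg_zero]

lemma cosCoeff_congr (k : ℤ) {A B : ℝ → ℝ → V} {t : ℝ} (h : ∀ θ, A t θ = B t θ) :
    cosCoeff k A t = cosCoeff k B t := fc_congr k h fun _ => rfl

lemma sinCoeff_congr (k : ℤ) {A B : ℝ → ℝ → V} {t : ℝ} (h : ∀ θ, A t θ = B t θ) :
    sinCoeff k A t = sinCoeff k B t := fc_congr k (fun _ => rfl) h

lemma cosCoeff_continuous (k : ℤ) {A : ℝ → ℝ → V} (hA : Cont2 A) : Continuous (cosCoeff k A) :=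
  fc_continuous k hA (Cont2.const 0)

lemma sinCoeff_continuous (k : ℤ) {A : ℝ → ℝ → V} (hA : Cont2 A) : Continuous (sinCoeff k A) :=
  fc_continuous k (Cont2.const 0) hA

lemma cosCoeff_neg_index (k : ℤ) (A : ℝ → ℝ → V) (t : ℝ) : cosCoeff (-k) A t = cosCoeff k A t := by
  rw [cosCoeff, cosCoeff, fc_neg_index]; simp only [neg_zero]

lemma sinCoeff_neg_index (k : ℤ) (A : ℝ → ℝ → V) (t : ℝ) :
    sinCoeff (-k) A t = -sinCoeff k A t := by
  rw [sinCoeff, sinCoeff, fc_neg_index, ← fc_neg]; simp only [neg_zero]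

lemma cosCoeff_zero_index (A : ℝ → ℝ → V) (t : ℝ) : cosCoeff 0 A t = circInt A t := by
  simp [cosCoeff, fc, circInt]

lemma sinCoeff_zero_index (A : ℝ → ℝ → V) (t : ℝ) : sinCoeff 0 A t = 0 := by
  simp [sinCoeff, fc, circInt]

variable [CompleteSpace V]

lemma cosCoeff_hasDerivAt (k : ℤ) {A : ℝ → ℝ → V} (hA : Smooth2 A) (t : ℝ) :
    HasDerivAt (cosCoeff k A) (cosCoeff k (pt A) t) t := by
  refine (fc_hasDerivAt k hA (Smooth2.const 0) t).congr_deriv (fc_congr k (fun _ => rfl) fun θ => ?_)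
  simp [pt]

lemma sinCoeff_hasDerivAt (k : ℤ) {A : ℝ → ℝ → V} (hA : Smooth2 A) (t : ℝ) :
    HasDerivAt (sinCoeff k A) (sinCoeff k (pt A) t) t := by
  refine (fc_hasDerivAt k (Smooth2.const 0) hA t).congr_deriv (fc_congr k (fun θ => ?_) fun _ => rfl)
  simp [pt]

lemma cosCoeff_pth (k : ℤ) {A : ℝ → ℝ → V} (hA : Smooth2 A) (pA : Periodic2 A) (t : ℝ) :
    cosCoeff k (pth A) t = (k : ℝ) • sinCoeff k A t := by
  have h := fc_pth k hA (Smooth2.const 0) pA (fun _ _ => rfl) t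
  rw [fc_congr k (A' := pth A) (B' := fun _ _ => 0) (fun _ => rfl) (fun θ => by simp [pth])] at h
  rw [cosCoeff, h, neg_smul, ← smul_neg]
  have e := sinCoeff_neg k A t
  rw [sinCoeff] at e
  rw [e, neg_neg]

lemma sinCoeff_pth (k : ℤ) {A : ℝ → ℝ → V} (hA : Smooth2 A) (pA : Periodic2 A) (t : ℝ) :
    sinCoeff k (pth A) t = -((k : ℝ) • cosCoeff k A t) := by
  have h := fc_pth k (Smooth2.const 0) hA (fun _ _ => rfl) pA t
  rw [fc_congr k (A' := fun _ _ => 0) (B' := pth A) (fun θ => by simp [pth]) (fun _ => rfl)] at h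
  rw [sinCoeff, h, neg_smul]
  simp only [neg_zero]; rfl

end FourierCoefficients

section MeanCurvatureModes

local notation "𝔼" n => EuclideanSpace ℝ (Fin n)

variable {f : ℝ → ℝ → 𝔼 n} {u : ℝ → ℝ → ℝ} {s : Set ℝ} {t : ℝ}

namespace ConfWillmore

lemma hasDerivAt_cosMode (h : ConfWillmore f u s) (hs : s ∈ nhds t)
    (h0 : circInt (cur₁ f u) t = 0) (k : ℤ) :
    HasDerivAt (fun t => cosCoeff k (Hmc f u) t + (k : ℝ)⁻¹ • cosCoeff k (cur₁ f u) t)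
      ((k : ℝ) • (cosCoeff k (Hmc f u) t + (k : ℝ)⁻¹ • cosCoeff k (cur₁ f u) t) +
        -fc k (curQ₁ f u) (curQ₂ f u) t) t := by
  have hf := h.1.s2f
  have hu := h.1.s2u
  have pf := h.1.pf
  have pu := h.1.pu
  have hH := smooth2_Hmc hf hu
  have hP := smooth2_cur₁ hf hu
  have hW := smooth2_cur₂ hf hu
  have h₁ := smooth2_curQ₁ hf hu
  have h₂ := smooth2_curQ₂ hf hu
  refine ((cosCoeff_hasDerivAt k hH t).add
    ((cosCoeff_hasDerivAt k hP t).const_smul (k : ℝ)⁻¹)).congr_deriv ?_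
  have e1 : cosCoeff k (cur₁ f u) t = cosCoeff k (pt (Hmc f u)) t + cosCoeff k (curQ₁ f u) t :=
    cosCoeff_add k hH.pt.cont h₁.cont t
  have e2 : sinCoeff k (cur₂ f u) t = sinCoeff k (pth (Hmc f u)) t + sinCoeff k (curQ₂ f u) t :=
    sinCoeff_add k hH.pth.cont h₂.cont t
  have e3 : cosCoeff k (pt (cur₁ f u)) t = -((k : ℝ) • sinCoeff k (cur₂ f u) t) := by
    rw [← cosCoeff_pth k hW (periodic2_cur₂ pf pu), ← cosCoeff_neg]
    exact cosCoeff_congr k fun θ => eq_neg_of_add_eq_zero_left (h.div_cur (mem_of_mem_nhds hs) θ)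
  rw [sinCoeff_pth k hH (periodic2_Hmc pf pu)] at e2
  rw [fc_eq_cosCoeff_add_sinCoeff k h₁.cont h₂.cont, e3, e2]
  rcases eq_or_ne k 0 with rfl | hk
  · rw [cosCoeff_zero_index (cur₁ f u), h0] at e1
    rw [sinCoeff_zero_index]
    simpa using eq_neg_of_add_eq_zero_left e1.symm
  · have hk' : (k : ℝ) ≠ 0 := by exact_mod_cast hk
    rw [smul_neg, inv_smul_smul₀ hk', smul_add, smul_inv_smul₀ hk', e1]
    module

lemma hasDerivAt_sinMode (h : ConfWillmore f u s) (hs : s ∈ nhds t) (k : ℤ) :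
    HasDerivAt (fun t => -(sinCoeff k (Hmc f u) t + (k : ℝ)⁻¹ • sinCoeff k (cur₁ f u) t))
      ((k : ℝ) • -(sinCoeff k (Hmc f u) t + (k : ℝ)⁻¹ • sinCoeff k (cur₁ f u) t) +
        if k = 0 then 0 else -fc k (curQ₂ f u) (fun t θ => -curQ₁ f u t θ) t) t := by
  have hf := h.1.s2f
  have hu := h.1.s2u
  have pf := h.1.pf
  have pu := h.1.pu
  have hH := smooth2_Hmc hf hu
  have hP := smooth2_cur₁ hf hu
  have hW := smooth2_cur₂ hf hu
  have h₁ := smooth2_curQ₁ hf hu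
  have h₂ := smooth2_curQ₂ hf hu
  refine ((sinCoeff_hasDerivAt k hH t).add
    ((sinCoeff_hasDerivAt k hP t).const_smul (k : ℝ)⁻¹)).neg.congr_deriv ?_
  have e1 : sinCoeff k (cur₁ f u) t = sinCoeff k (pt (Hmc f u)) t + sinCoeff k (curQ₁ f u) t :=
    sinCoeff_add k hH.pt.cont h₁.cont t
  have e2 : cosCoeff k (cur₂ f u) t = cosCoeff k (pth (Hmc f u)) t + cosCoeff k (curQ₂ f u) t :=
    cosCoeff_add k hH.pth.cont h₂.cont t
  have e3 : sinCoeff k (pt (cur₁ f u)) t = (k : ℝ) • cosCoeff k (cur₂ f u) t := by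
    rw [← neg_neg ((k : ℝ) • cosCoeff k (cur₂ f u) t),
      ← sinCoeff_pth k hW (periodic2_cur₂ pf pu), ← sinCoeff_neg]
    exact sinCoeff_congr k fun θ => eq_neg_of_add_eq_zero_left (h.div_cur (mem_of_mem_nhds hs) θ)
  rw [cosCoeff_pth k hH (periodic2_Hmc pf pu)] at e2
  rw [fc_eq_cosCoeff_add_sinCoeff k h₂.cont h₁.neg.cont, sinCoeff_neg, e3, e2]
  rcases eq_or_ne k 0 with rfl | hk
  · simp [sinCoeff_zero_index]
  · have hk' : (k : ℝ) ≠ 0 := by exact_mod_cast hk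
    rw [if_neg hk, inv_smul_smul₀ hk', smul_neg, smul_add, smul_inv_smul₀ hk', e1]
    module

end ConfWillmore

end MeanCurvatureModes

section MeanCurvatureEstimate

local notation "𝔼" n => EuclideanSpace ℝ (Fin n)

lemma cosCoeff_const_smul {V : Type*} [NormedAddCommGroup V] [InnerProductSpace ℝ V] (k : ℤ) (r : ℝ)
    (A : ℝ → ℝ → V) (t : ℝ) : cosCoeff k (fun t θ => r • A t θ) t = r • cosCoeff k A t := by
  rw [cosCoeff, cosCoeff, fc, fc, ← circInt_smul]
  exact circInt_congr fun θ => by module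

lemma sinCoeff_const_smul {V : Type*} [NormedAddCommGroup V] [InnerProductSpace ℝ V] (k : ℤ) (r : ℝ)
    (A : ℝ → ℝ → V) (t : ℝ) : sinCoeff k (fun t θ => r • A t θ) t = r • sinCoeff k A t := by
  rw [sinCoeff, sinCoeff, fc, fc, ← circInt_smul]
  exact circInt_congr fun θ => by module

lemma sum_cosCoeff_sinCoeff_le {A : ℝ → ℝ → 𝔼 n} (hA : Cont2 A) (t : ℝ) (F : Finset ℤ) :
    ∑ k ∈ F, (‖cosCoeff k A t‖ ^ 2 + ‖sinCoeff k A t‖ ^ 2) ≤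
      2 * π * circInt (fun t θ => ‖A t θ‖ ^ 2) t := by
  have h := sum_modes_le hA (Cont2.const 0) t F
  refine le_of_eq_of_le (Finset.sum_congr rfl fun k _ => ?_) (h.trans_eq ?_)
  · have e : ‖sinCoeff k (fun t θ => -A t θ) t‖ = ‖sinCoeff k A t‖ := by
      rw [sinCoeff_neg, norm_neg]
    rw [← e]; rfl
  · simp

variable {f : ℝ → ℝ → 𝔼 n} {u : ℝ → ℝ → ℝ} {s : Set ℝ} {m : ℕ} {t ε : ℝ}

lemma norm_add_smul_sq_le {V : Type*} [NormedAddCommGroup V] [InnerProductSpace ℝ V] (k : ℤ)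
    (x y : V) : ‖x + (k : ℝ)⁻¹ • y‖ ^ 2 ≤ 2 * ‖x‖ ^ 2 + 2 * ‖y‖ ^ 2 := by
  have h1 : ‖(k : ℝ)⁻¹ • y‖ ≤ ‖y‖ := by
    rw [norm_smul]
    refine mul_le_of_le_one_left (norm_nonneg _) ?_
    rcases eq_or_ne k 0 with rfl | hk
    · simp
    · rw [norm_inv]
      refine inv_le_one_of_one_le₀ ?_
      rw [Real.norm_eq_abs]
      exact_mod_cast Int.one_le_abs hk
  have h2 := norm_add_le x ((k : ℝ)⁻¹ • y)
  have h3 : ‖x + (k : ℝ)⁻¹ • y‖ ≤ ‖x‖ + ‖y‖ := by linarith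
  nlinarith [norm_nonneg (x + (k : ℝ)⁻¹ • y), sq_nonneg (‖x‖ - ‖y‖)]

lemma ConfImm.exp_mul_norm_cur₁_sq_le (h : ConfImm f u s) (hs : s ∈ nhds t) (θ : ℝ) :
    Real.exp (2 * u t θ) * ‖cur₁ f u t θ‖ ^ 2 ≤ 2 * Gdens f u t θ + 256 * Adens f u t θ ^ 2 := by
  have k1 := h.curQ_sq_le hs θ
  have k2 : ‖cur₁ f u t θ‖ ^ 2 ≤ 2 * (‖pt (Hmc f u) t θ‖ ^ 2 + ‖curQ₁ f u t θ‖ ^ 2) := by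
    have := norm_add_le (pt (Hmc f u) t θ) (curQ₁ f u t θ)
    unfold cur₁
    nlinarith [norm_nonneg (pt (Hmc f u) t θ + curQ₁ f u t θ),
      sq_nonneg (‖pt (Hmc f u) t θ‖ - ‖curQ₁ f u t θ‖)]
  have e := Real.exp_pos (2 * u t θ)
  have k3 := mul_le_mul_of_nonneg_left k2 e.le
  unfold Gdens
  nlinarith [mul_nonneg e.le (sq_nonneg ‖pth (Hmc f u) t θ‖),
    mul_nonneg e.le (sq_nonneg ‖curQ₂ f u t θ‖)]

lemma weighted_estimate_H {a b q : ℝ} (hab : a ≤ b) (hq : q + 2 * ε < 2)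
    (hW : ConfWillmore f u s) (near : ∀ t ∈ Icc a b, NearCircle f u s m t ε)
    (hτ₁ : ∀ t ∈ Icc a b, ∀ c, tau1 f u c t = 0)
    (hτ₂ : ∀ t ∈ Icc a b, ∀ S : Matrix (Fin n) (Fin n) ℝ, S.transpose = -S → tau2 f u S t = 0)
    {ω ω' η η' : ℝ → ℝ}
    (hω : ∀ t, HasDerivAt ω (ω' t) t) (hω'c : Continuous ω') (hω0 : ∀ t, 0 < ω t)
    (hωq : ∀ t, |ω' t| ≤ q * ω t)
    (hη : ∀ t, HasDerivAt η (η' t) t) (hη'c : Continuous η') (ha : η a = 0) (hb : η b = 0) :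
    ∫ t in a..b, ω t * η t ^ 2 * circInt (Hdens f u) t ≤
      2 * ((∫ t in a..b, ω t * η t ^ 2 * (10 ^ 12 * (ε ^ 2 * (circInt (Adens f u) t +
        circInt (Gdens f u) t + circInt (fun t θ => Adens f u t θ ^ 2) t)))) +
      8 / (2 - q - 2 * ε) ^ 2 * ∫ t in a..b, ω t * (η t ^ 2 *
        (10 ^ 4 * circInt (fun t θ => Adens f u t θ ^ 2) t) +
        η' t ^ 2 * (10 ^ 5 * (circInt (Hdens f u) t + circInt (Gdens f u) t +
          circInt (fun t θ => Adens f u t θ ^ 2) t)))) := by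
  have hf := hW.1.s2f
  have hu := hW.1.s2u
  have hH := smooth2_Hmc hf hu
  have hP := smooth2_cur₁ hf hu
  have cQ₁ := (smooth2_curQ₁ hf hu).cont
  have cQ₂ := (smooth2_curQ₂ hf hu).cont
  have cA := (smooth2_Adens hf hu).cont
  have cG := (smooth2_Gdens hf hu).cont
  have cH := (smooth2_Hdens hf hu).cont
  have cN : Cont2 fun t θ => ‖Hmc f u t θ‖ ^ 2 := hH.cont.norm.pow 2
  have cN' : Cont2 fun t θ => ‖cur₁ f u t θ‖ ^ 2 := hP.cont.norm.pow 2
  have hωc : Continuous ω := continuous_iff_continuousAt.2 fun t => (hω t).continuousAt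
  have hηc : Continuous η := continuous_iff_continuousAt.2 fun t => (hη t).continuousAt
  have hπ : π ≤ 4 := pi_le_four
  have huc := hu.continuous_fst 0
  have jA : Continuous (circInt (Adens f u)) := cA.circInt
  have jG : Continuous (circInt (Gdens f u)) := cG.circInt
  have jH : Continuous (circInt (Hdens f u)) := cH.circInt
  have jA2 : Continuous (circInt fun t θ => Adens f u t θ ^ 2) := (cA.pow 2).circInt
  let y₁ : ℤ → ℝ → 𝔼 n := fun k t =>
    cosCoeff k (Hmc f u) t + (k : ℝ)⁻¹ • cosCoeff k (cur₁ f u) t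
  let y₂ : ℤ → ℝ → 𝔼 n := fun k t =>
    -(sinCoeff k (Hmc f u) t + (k : ℝ)⁻¹ • sinCoeff k (cur₁ f u) t)
  have hy₁c : ∀ k, Continuous (y₁ k) := fun k => by
    have c1 := cosCoeff_continuous k hH.cont
    have c2 := cosCoeff_continuous k hP.cont
    change Continuous fun t => cosCoeff k (Hmc f u) t + (k : ℝ)⁻¹ • cosCoeff k (cur₁ f u) t
    fun_prop
  have hy₂c : ∀ k, Continuous (y₂ k) := fun k => by
    have c1 := sinCoeff_continuous k hH.cont
    have c2 := sinCoeff_continuous k hP.cont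
    change Continuous fun t => -(sinCoeff k (Hmc f u) t + (k : ℝ)⁻¹ • sinCoeff k (cur₁ f u) t)
    fun_prop
  have main := weighted_spectral_estimate hab (d := 2 * ε) hq (y₁ := y₁) (y₂ := y₂)
    (s₁ := fun k t => -fc k (curQ₁ f u) (curQ₂ f u) t)
    (s₂ := fun k t => if k = 0 then 0 else -fc k (curQ₂ f u) (fun t θ => -curQ₁ f u t θ) t)
    (g := fun t => 2 * u t 0) (g' := fun t => 2 * pt u t 0) (m : ℤ)
    (fun k t ht => hW.hasDerivAt_cosMode (near t ht).nhds
      (circInt_cur₁_eq_zero hf hu (hτ₁ t ht)) k)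
    (fun k t ht => hW.hasDerivAt_sinMode (near t ht).nhds k)
    hy₁c hy₂c
    (fun k => (fc_continuous k cQ₁ cQ₂).neg)
    (fun k => by
      rcases eq_or_ne k 0 with rfl | hk
      · simpa using continuous_const
      · simp only [hk, if_false]
        exact (fc_continuous k cQ₂ cQ₁.neg).neg)
    (fun t => (hu.dt t 0).const_mul 2) ((hu.pt.continuous_fst 0).const_smul (2 : ℝ))
    (fun t ht => by
      have := (near t ht).abs_pt_le 0
      rw [abs_le] at this ⊢
      push_cast
      constructor <;> linarith)
    hω hω'c hω0 hωq hη hη'c ha hb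
    (X := fun t => 10 ^ 4 * circInt (fun t θ => Adens f u t θ ^ 2) t)
    (Y := fun t => 10 ^ 5 * (circInt (Hdens f u) t + circInt (Gdens f u) t +
          circInt (fun t θ => Adens f u t θ ^ 2) t))
    (Z := fun t => 10 ^ 12 * (ε ^ 2 * (circInt (Adens f u) t +
        circInt (Gdens f u) t + circInt (fun t θ => Adens f u t θ ^ 2) t)))
    (by fun_prop) (by fun_prop) (by fun_prop)
    (fun F t ht => by
      have e := Real.exp_pos (2 * u t 0)
      have k0 : ∑ k ∈ F, (‖-fc k (curQ₁ f u) (curQ₂ f u) t‖ ^ 2 +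
          ‖if k = 0 then 0 else -fc k (curQ₂ f u) (fun t θ => -curQ₁ f u t θ) t‖ ^ 2) ≤
          ∑ k ∈ F, (‖fc k (curQ₁ f u) (curQ₂ f u) t‖ ^ 2 +
            ‖fc k (curQ₂ f u) (fun t θ => -curQ₁ f u t θ) t‖ ^ 2) := by
        refine Finset.sum_le_sum fun k _ => ?_
        split_ifs <;> simp
      have k1 := mul_le_mul_of_nonneg_left (k0.trans (sum_modes_le cQ₁ cQ₂ t F)) e.le
      have k2 := (near t ht).exp_mul_circInt_le ((cQ₁.norm.pow 2).add (cQ₂.norm.pow 2))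
        ((Cont2.const (128 : ℝ)).mul (cA.pow 2))
        (fun θ => by positivity) fun θ => hW.1.curQ_sq_le (near t ht).nhds θ
      rw [circInt_const_mul] at k2
      have k4 := circInt_nonneg (F := fun t θ => Adens f u t θ ^ 2) (t := t) fun θ => sq_nonneg _
      refine k1.trans ?_
      rw [mul_left_comm]
      refine (mul_le_mul_of_nonneg_left k2 Real.two_pi_pos.le).trans ?_
      nlinarith)
    (fun F t ht => by
      have e := Real.exp_pos (2 * u t 0)
      have k0 : ∑ k ∈ F, (‖y₁ k t‖ ^ 2 + ‖y₂ k t‖ ^ 2) ≤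
          2 * ∑ k ∈ F, (‖cosCoeff k (Hmc f u) t‖ ^ 2 + ‖sinCoeff k (Hmc f u) t‖ ^ 2) +
          2 * ∑ k ∈ F, (‖cosCoeff k (cur₁ f u) t‖ ^ 2 + ‖sinCoeff k (cur₁ f u) t‖ ^ 2) := by
        rw [Finset.mul_sum, Finset.mul_sum, ← Finset.sum_add_distrib]
        refine Finset.sum_le_sum fun k _ => ?_
        have a1 := norm_add_smul_sq_le k (cosCoeff k (Hmc f u) t) (cosCoeff k (cur₁ f u) t)
        have a2 := norm_add_smul_sq_le k (sinCoeff k (Hmc f u) t) (sinCoeff k (cur₁ f u) t)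
        simp only [y₁, y₂, norm_neg]
        linarith
      have k1 := mul_le_mul_of_nonneg_left (k0.trans (add_le_add
        (mul_le_mul_of_nonneg_left (sum_cosCoeff_sinCoeff_le hH.cont t F) two_pos.le)
        (mul_le_mul_of_nonneg_left (sum_cosCoeff_sinCoeff_le hP.cont t F) two_pos.le))) e.le
      have k2 := (near t ht).exp_mul_circInt_le cN cH (fun θ => by positivity)
        fun θ => (mul_comm _ _).le
      have k3 := (near t ht).exp_mul_circInt_le cN' (((Cont2.const (2 : ℝ)).mul cG).add
        ((Cont2.const (256 : ℝ)).mul (cA.pow 2))) (fun θ => by positivity)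
        fun θ => hW.1.exp_mul_norm_cur₁_sq_le (near t ht).nhds θ
      rw [circInt_add ((Cont2.const (2 : ℝ)).mul cG) ((Cont2.const (256 : ℝ)).mul (cA.pow 2)),
        circInt_const_mul, circInt_const_mul] at k3
      have k4 := circInt_nonneg (F := fun t θ => Adens f u t θ ^ 2) (t := t) fun θ => sq_nonneg _
      have k5 := circInt_nonneg (F := Hdens f u) (t := t) fun θ => Hdens_nonneg t θ
      have k6 := circInt_nonneg (F := Gdens f u) (t := t) fun θ => Gdens_nonneg t θ
      refine k1.trans ?_
      have k7 := mul_le_mul_of_nonneg_left (add_le_add k2 k3) Real.two_pi_pos.le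
      have k8 : 2 * π * (9 * circInt (Hdens f u) t + 9 * (2 * circInt (Gdens f u) t +
          256 * circInt (fun t θ => Adens f u t θ ^ 2) t)) ≤
          8 * (9 * circInt (Hdens f u) t + 9 * (2 * circInt (Gdens f u) t +
          256 * circInt (fun t θ => Adens f u t θ ^ 2) t)) :=
        mul_le_mul_of_nonneg_right (by linarith) (by positivity)
      linarith)
    (fun t ht => by
      have k := (near t ht).resonant_H (hτ₁ t ht) (hτ₂ t ht)
      have hmP := ((Cont2.const (m : ℝ)⁻¹).smul hP.cont)
      have e0 : Real.exp (2 * u t 0) = Real.exp (u t 0) ^ 2 := by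
        rw [sq, ← Real.exp_add]; ring_nf
      have e1 : y₁ m t = fc m (fun t θ => Hmc f u t θ + (m : ℝ)⁻¹ • cur₁ f u t θ)
          (fun _ _ => 0) t := by
        change _ = cosCoeff m _ t
        rw [cosCoeff_add m hH.cont hmP, cosCoeff_const_smul]
        simp only [y₁, Int.cast_natCast]
      have e2 : y₂ m t = fc m (fun _ _ => 0)
          (fun t θ => -(Hmc f u t θ + (m : ℝ)⁻¹ • cur₁ f u t θ)) t := by
        change _ = sinCoeff m _ t
        rw [sinCoeff_neg, sinCoeff_add m hH.cont hmP, sinCoeff_const_smul]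
        simp only [y₂, Int.cast_natCast]
      rw [e0, e1, e2]
      exact k)
  have hpair : ∀ (F : Finset ℤ) (t : ℝ), ∑ k ∈ F, (‖fc k (Hmc f u) (fun _ _ => 0) t‖ ^ 2 +
      ‖fc k (fun _ _ => 0) (fun t θ => -Hmc f u t θ) t‖ ^ 2) ≤
      2⁻¹ * (∑ k ∈ F, (‖y₁ k t‖ ^ 2 + ‖y₂ k t‖ ^ 2) +
        ∑ k ∈ F.map (Equiv.neg ℤ).toEmbedding, (‖y₁ k t‖ ^ 2 + ‖y₂ k t‖ ^ 2)) := by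
    intro F t
    rw [Finset.sum_map, ← Finset.sum_add_distrib, Finset.mul_sum]
    refine Finset.sum_le_sum fun k _ => ?_
    have e1 : fc k (Hmc f u) (fun _ _ => 0) t = (2⁻¹ : ℝ) • (y₁ k t + y₁ (-k) t) := by
      change cosCoeff k (Hmc f u) t = _
      simp only [y₁, cosCoeff_neg_index, Int.cast_neg, inv_neg]
      module
    have e2 : fc k (fun _ _ => 0) (fun t θ => -Hmc f u t θ) t =
        (2⁻¹ : ℝ) • (y₂ k t - y₂ (-k) t) := by
      change sinCoeff k (fun t θ => -Hmc f u t θ) t = _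
      rw [sinCoeff_neg]
      simp only [y₂, sinCoeff_neg_index, Int.cast_neg, inv_neg]
      module
    have e3 := norm_add_le (y₁ k t) (y₁ (-k) t)
    have e4 := norm_sub_le (y₂ k t) (y₂ (-k) t)
    rw [e1, e2, norm_smul, norm_smul, Real.norm_of_nonneg (by norm_num : (0 : ℝ) ≤ 2⁻¹)]
    simp only [Equiv.coe_toEmbedding, Equiv.neg_apply]
    nlinarith [norm_nonneg (y₁ k t + y₁ (-k) t), norm_nonneg (y₂ k t - y₂ (-k) t),
      sq_nonneg (‖y₁ k t‖ - ‖y₁ (-k) t‖), sq_nonneg (‖y₂ k t‖ - ‖y₂ (-k) t‖)]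
  have hwc : Continuous fun t => ω t * η t ^ 2 * Real.exp (2 * u t 0) := by fun_prop
  have hw0 : ∀ t, 0 ≤ ω t * η t ^ 2 * Real.exp (2 * u t 0) := fun t => by
    have := hω0 t; positivity
  have hsum : ∀ F : Finset ℤ, IntervalIntegrable (fun t => ω t * η t ^ 2 * Real.exp (2 * u t 0) *
      ∑ k ∈ F, (‖y₁ k t‖ ^ 2 + ‖y₂ k t‖ ^ 2)) volume a b := fun F =>
    (hwc.mul (continuous_finsetSum F fun k _ =>
      ((hy₁c k).norm.pow 2).add ((hy₂c k).norm.pow 2))).intervalIntegrable _ _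
  rw [← div_le_iff₀' two_pos]
  refine le_trans ?_ (integral_le_of_modes (a := a) (b := b) hH.cont
    (Cont2.const (0 : 𝔼 n)) hwc hw0 fun F => ?_)
  · rw [div_le_iff₀' two_pos, ← intervalIntegral.integral_const_mul]
    refine intervalIntegral.integral_mono_on hab
      (Continuous.intervalIntegrable (by fun_prop) _ _)
      (Continuous.intervalIntegrable (continuous_const.mul (hwc.mul (continuous_const.mul
        ((cN.add ((Cont2.const (0 : 𝔼 n)).norm.pow 2)).circInt)))) _ _) fun t ht => ?_
    have k1 := (near t ht).circInt_exp_mul_le cN fun θ => by positivity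
    have k2 : circInt (Hdens f u) t = circInt (fun t θ => Real.exp (2 * u t θ) *
        ‖Hmc f u t θ‖ ^ 2) t := circInt_congr fun θ => mul_comm _ _
    rw [← k2] at k1
    have k3 : 0 ≤ Real.exp (2 * u t 0) * circInt (fun t θ => ‖Hmc f u t θ‖ ^ 2) t :=
      mul_nonneg (Real.exp_pos _).le (circInt_nonneg fun θ => by positivity)
    have k4 : circInt (Hdens f u) t ≤ 2 * (2 * π * (Real.exp (2 * u t 0) *
        circInt (fun t θ => ‖Hmc f u t θ‖ ^ 2) t)) := by
      nlinarith [pi_gt_three]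
    have k5 := mul_le_mul_of_nonneg_left k4 (mul_nonneg (hω0 t).le (sq_nonneg (η t)))
    simp only [norm_zero, ne_eq, OfNat.ofNat_ne_zero, not_false_eq_true, zero_pow, add_zero]
    linarith
  · have i1 := main F
    have i2 := main (F.map (Equiv.neg ℤ).toEmbedding)
    refine le_trans ?_ (show (2 : ℝ)⁻¹ * ((∫ t in a..b, ω t * η t ^ 2 * Real.exp (2 * u t 0) *
      ∑ k ∈ F, (‖y₁ k t‖ ^ 2 + ‖y₂ k t‖ ^ 2)) + ∫ t in a..b, ω t * η t ^ 2 * Real.exp (2 * u t 0) *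
      ∑ k ∈ F.map (Equiv.neg ℤ).toEmbedding, (‖y₁ k t‖ ^ 2 + ‖y₂ k t‖ ^ 2)) ≤ _ by linarith)
    rw [← intervalIntegral.integral_add (hsum _) (hsum _), ← intervalIntegral.integral_const_mul]
    refine intervalIntegral.integral_mono_on hab
      (Continuous.intervalIntegrable (hwc.mul (continuous_finsetSum F fun k _ =>
        ((fc_continuous k hH.cont (Cont2.const 0)).norm.pow 2).add
          ((fc_continuous k (Cont2.const 0) hH.neg.cont).norm.pow 2))) _ _)
      (((hsum _).add (hsum _)).const_mul _) fun t _ => ?_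
    have := mul_le_mul_of_nonneg_left (hpair F t) (hw0 t)
    linarith

end MeanCurvatureEstimate

section Absorption

/-- Weighted integral over an interval. -/
def wInt (ω F : ℝ → ℝ) (a b : ℝ) : ℝ := ∫ t in a..b, ω t * F t

variable {ω F G : ℝ → ℝ} {a b c : ℝ}

lemma wInt_add (hω : Continuous ω) (hF : Continuous F) (hG : Continuous G) (a b : ℝ) :
    wInt ω (fun t => F t + G t) a b = wInt ω F a b + wInt ω G a b := by
  simp only [wInt, mul_add]
  exact intervalIntegral.integral_add ((hω.mul hF).intervalIntegrable _ _)
    ((hω.mul hG).intervalIntegrable _ _)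

lemma wInt_const_mul (r : ℝ) (ω F : ℝ → ℝ) (a b : ℝ) :
    wInt ω (fun t => r * F t) a b = r * wInt ω F a b := by
  unfold wInt
  rw [← intervalIntegral.integral_const_mul]
  simp only [mul_left_comm]

lemma wInt_mono (hω : Continuous ω) (hω0 : ∀ t, 0 ≤ ω t) (hF : Continuous F) (hG : Continuous G)
    (hab : a ≤ b) (h : ∀ t, F t ≤ G t) : wInt ω F a b ≤ wInt ω G a b :=
  intervalIntegral.integral_mono_on hab ((hω.mul hF).intervalIntegrable _ _)
    ((hω.mul hG).intervalIntegrable _ _) fun t _ => mul_le_mul_of_nonneg_left (h t) (hω0 t)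

lemma wInt_nonneg (hω0 : ∀ t, 0 ≤ ω t) (hF0 : ∀ t, 0 ≤ F t) (hab : a ≤ b) : 0 ≤ wInt ω F a b :=
  intervalIntegral.integral_nonneg hab fun t _ => mul_nonneg (hω0 t) (hF0 t)

lemma wInt_add_adjacent (hω : Continuous ω) (hF : Continuous F) (a b c : ℝ) :
    wInt ω F a b + wInt ω F b c = wInt ω F a c :=
  intervalIntegral.integral_add_adjacent_intervals ((hω.mul hF).intervalIntegrable _ _)
    ((hω.mul hF).intervalIntegrable _ _)

lemma wInt_le_of_le {M : ℝ} (hω : Continuous ω) (hF : Continuous F) (hF0 : ∀ t, 0 ≤ F t)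
    (hab : a ≤ b) (h : ∀ t ∈ Icc a b, ω t ≤ M) : wInt ω F a b ≤ M * ∫ t in a..b, F t := by
  rw [← intervalIntegral.integral_const_mul]
  exact intervalIntegral.integral_mono_on hab ((hω.mul hF).intervalIntegrable _ _)
    ((continuous_const.mul hF).intervalIntegrable _ _)
    fun t ht => mul_le_mul_of_nonneg_right (h t ht) (hF0 t)

lemma exists_cutoff_bound : ∃ K : ℝ, 1 ≤ K ∧ ∀ a b : ℝ, a + 2 ≤ b → ∀ (c : ℝ) (ω Φ X Y Z : ℝ → ℝ),
    0 ≤ c → Continuous ω → Continuous Φ → Continuous X → Continuous Y → Continuous Z →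
    (∀ t, 0 ≤ ω t) → (∀ t, 0 ≤ Φ t) → (∀ t, 0 ≤ X t) → (∀ t, 0 ≤ Y t) → (∀ t, 0 ≤ Z t) →
    (∀ η η' : ℝ → ℝ, (∀ t, HasDerivAt η (η' t) t) → Continuous η' → η a = 0 → η b = 0 →
      ∫ t in a..b, ω t * η t ^ 2 * Φ t ≤ 2 * ((∫ t in a..b, ω t * η t ^ 2 * Z t) +
        c * ∫ t in a..b, ω t * (η t ^ 2 * X t + η' t ^ 2 * Y t))) →
    wInt ω Φ (a + 1) (b - 1) ≤ 2 * (wInt ω Z a b + c * (wInt ω X a b +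
      K * (wInt ω Y a (a + 1) + wInt ω Y (b - 1) b))) := by
  obtain ⟨K, hK, hη⟩ := exists_cutoff
  refine ⟨K ^ 2, one_le_pow₀ hK, ?_⟩
  intro a b hab c ω Φ X Y Z hc hω hΦ hX hY hZ hω0 hΦ0 hX0 hY0 hZ0 h
  obtain ⟨η, hsm, h0, h1, ha, hb, hmid, hK'⟩ := hη a b hab
  have hdc : Continuous (deriv η) := hsm.continuous_deriv (by simp)
  have hηc : Continuous η := hsm.continuous
  have key := h η (deriv η) (fun t => (hsm.differentiable (by simp) t).hasDerivAt) hdc ha hb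
  have hsq : ∀ t, η t ^ 2 ≤ 1 := fun t => pow_le_one₀ (h0 t) (h1 t)
  have e1 : ∀ {W : ℝ → ℝ}, Continuous W → (∀ t, 0 ≤ W t) →
      ∫ t in a..b, ω t * η t ^ 2 * W t ≤ wInt ω W a b := fun hW hW0 =>
    intervalIntegral.integral_mono_on (by linarith)
      (Continuous.intervalIntegrable (by fun_prop) _ _)
      (Continuous.intervalIntegrable (by fun_prop) _ _) fun t _ => by
        have := mul_le_mul_of_nonneg_left (hsq t) (mul_nonneg (hω0 t) (hW0 t))
        linarith
  have hη2 : Continuous fun t => η t ^ 2 := hηc.pow 2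
  have hd2 : Continuous fun t => deriv η t ^ 2 := hdc.pow 2
  have hP : Continuous fun t => η t ^ 2 * Φ t := hη2.mul hΦ
  have hQ : Continuous fun t => deriv η t ^ 2 * Y t := hd2.mul hY
  have e2 : wInt ω Φ (a + 1) (b - 1) ≤ ∫ t in a..b, ω t * η t ^ 2 * Φ t := by
    have s1 := wInt_add_adjacent hω hP a (a + 1) (b - 1)
    have s2 := wInt_add_adjacent hω hP a (b - 1) b
    have s3 : 0 ≤ wInt ω (fun t => η t ^ 2 * Φ t) a (a + 1) :=
      wInt_nonneg hω0 (fun t => mul_nonneg (sq_nonneg _) (hΦ0 t)) (by linarith)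
    have s4 : 0 ≤ wInt ω (fun t => η t ^ 2 * Φ t) (b - 1) b :=
      wInt_nonneg hω0 (fun t => mul_nonneg (sq_nonneg _) (hΦ0 t)) (by linarith)
    have s5 : wInt ω (fun t => η t ^ 2 * Φ t) (a + 1) (b - 1) = wInt ω Φ (a + 1) (b - 1) := by
      refine intervalIntegral.integral_congr fun t ht => ?_
      rw [uIcc_of_le (by linarith)] at ht
      simp only [(hmid t ht).1]; ring
    have s6 : wInt ω (fun t => η t ^ 2 * Φ t) a b = ∫ t in a..b, ω t * η t ^ 2 * Φ t := by
      unfold wInt; congr 1; funext t; ring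
    linarith
  have e3 : wInt ω (fun t => deriv η t ^ 2 * Y t) a b ≤
      K ^ 2 * (wInt ω Y a (a + 1) + wInt ω Y (b - 1) b) := by
    have s1 := wInt_add_adjacent hω hQ a (a + 1) (b - 1)
    have s2 := wInt_add_adjacent hω hQ a (b - 1) b
    have s5 : wInt ω (fun t => deriv η t ^ 2 * Y t) (a + 1) (b - 1) = 0 := by
      refine (intervalIntegral.integral_congr (g := fun _ => 0) fun t ht => ?_).trans (by simp)
      rw [uIcc_of_le (by linarith)] at ht
      simp [(hmid t ht).2]
    have s6 : ∀ t, deriv η t ^ 2 * Y t ≤ K ^ 2 * Y t := fun t =>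
      mul_le_mul_of_nonneg_right (by rw [← sq_abs]; gcongr; exact hK' t) (hY0 t)
    have hKY : Continuous fun t => K ^ 2 * Y t := continuous_const.mul hY
    have s7 := wInt_mono hω hω0 hQ hKY
      (show a ≤ a + 1 by linarith) s6
    have s8 := wInt_mono hω hω0 hQ hKY
      (show b - 1 ≤ b by linarith) s6
    rw [wInt_const_mul] at s7 s8
    linarith
  have e4 : ∫ t in a..b, ω t * (η t ^ 2 * X t + deriv η t ^ 2 * Y t) =
      wInt ω (fun t => η t ^ 2 * X t) a b + wInt ω (fun t => deriv η t ^ 2 * Y t) a b :=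
    wInt_add hω (hη2.mul hX) (hd2.mul hY) a b
  have e5 : wInt ω (fun t => η t ^ 2 * X t) a b = ∫ t in a..b, ω t * η t ^ 2 * X t := by
    unfold wInt; congr 1; funext t; ring
  rw [e4, e5] at key
  have e6 := mul_le_mul_of_nonneg_left (add_le_add (e1 hX hX0) e3) hc
  have e7 := e1 hZ hZ0
  linarith

lemma weight_absorb (K : ℝ) (hK : 1 ≤ K) : ∃ σ₀ > 0, ∃ B : ℝ, 0 ≤ B ∧
    ∀ σ W Wh Wb z Z G e : ℝ, 0 ≤ σ → σ ≤ σ₀ → 0 ≤ Wh → 0 ≤ Wb → 0 ≤ e →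
    W = 2⁻¹ * Wh + 2⁻¹ * Wb → z ≤ K * (W + e) → Z ≤ K * (σ * (W + e)) →
    G ≤ K * (Wh + e + σ * (W + e)) → Wh ≤ K * (σ * (z + G + Z) + Z + e) →
    Wb ≤ K * (σ * z + Wh + G + Z + e) → W ≤ B * e := by
  have hK1 : 1 ≤ K ^ 4 := one_le_pow₀ hK
  refine ⟨1 / (22 * K ^ 4), by positivity, 1 + 6 * K ^ 3, by positivity, ?_⟩
  intro σ W Wh Wb z Z G e hσ hσ' hWh hWb he hW hz hZ hG h1 h2
  have hσK : σ * (22 * K ^ 4) ≤ 1 := by rwa [le_div_iff₀ (by positivity)] at hσ'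
  have hσ1 : σ ≤ 1 := hσ'.trans (by rw [div_le_one (by positivity)]; linarith)
  have hw : 0 ≤ W + e := by linarith
  generalize hwe : W + e = w at *
  have hK0 : 0 ≤ K := by linarith
  have hσw : σ * w ≤ w := mul_le_of_le_one_left hw hσ1
  have hσw0 : 0 ≤ σ * w := mul_nonneg hσ hw
  have hKw : K * (σ * w) ≤ K * w := mul_le_mul_of_nonneg_left hσw hK0
  have g1 : G ≤ 3 * (K * w) := hG.trans <| by
    have : Wh + e + σ * w ≤ 3 * w := by linarith
    linarith [mul_le_mul_of_nonneg_left this hK0]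
  have g2 : Wh ≤ 6 * (K ^ 2 * (σ * w)) + K * e := h1.trans <| by
    have a1 : z + G + Z ≤ 5 * (K * w) := by linarith
    have a2 := mul_le_mul_of_nonneg_left a1 hσ
    have a3 : σ * (z + G + Z) + Z + e ≤ 6 * (K * (σ * w)) + e := by linarith
    have a4 := mul_le_mul_of_nonneg_left a3 hK0
    linarith
  have k1 : K ≤ K ^ 2 := le_self_pow₀ hK (by norm_num)
  have k2 : K ≤ K ^ 3 := le_self_pow₀ hK (by norm_num)
  have k3 : K ^ 2 ≤ K ^ 3 := pow_le_pow_right₀ hK (by norm_num)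
  have k4 : K ^ 2 ≤ K ^ 4 := pow_le_pow_right₀ hK (by norm_num)
  have g3 : Wb ≤ 3 * (K ^ 2 * (σ * w)) + 2 * (K ^ 2 * Wh) + 2 * (K ^ 2 * e) := h2.trans <| by
    have a1 := mul_le_mul_of_nonneg_left hz hσ
    have a2 : σ * z + Wh + G + Z + e ≤ 3 * (K * (σ * w)) + (1 + K) * Wh + (1 + K) * e := by
      linarith
    have a3 := mul_le_mul_of_nonneg_left a2 hK0
    linarith [mul_le_mul_of_nonneg_right k1 hWh, mul_le_mul_of_nonneg_right k1 he]
  have g4 := mul_le_mul_of_nonneg_left g2 (sq_nonneg K)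
  have g5 : W ≤ 11 * (K ^ 4 * (σ * w)) + 3 * (K ^ 3 * e) := by
    have b1 : 0 ≤ K ^ 4 * (σ * w) := by positivity
    have b2 : 0 ≤ K ^ 3 * e := by positivity
    linarith [mul_le_mul_of_nonneg_right k4 hσw0, mul_le_mul_of_nonneg_right k2 he,
      mul_le_mul_of_nonneg_right k3 he]
  have g6 : 22 * (K ^ 4 * (σ * w)) ≤ w := by
    linarith [mul_le_mul_of_nonneg_right hσK hw]
  linarith

end Absorption

section Windows

lemma exists_weight {q : ℝ} (hq : 0 < q) (t₀ : ℝ) : ∃ ω ω' : ℝ → ℝ,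
    (∀ t, HasDerivAt ω (ω' t) t) ∧ Continuous ω' ∧ (∀ t, 0 < ω t) ∧ (∀ t, |ω' t| ≤ q * ω t) ∧
    (∀ x y, |x - y| ≤ 3 → ω x ≤ exp (3 * q) * ω y) ∧ ω t₀ = 1 ∧
    (∀ t, ω t ≤ 2 * exp (-q * (t - t₀))) ∧ ∀ t, ω t ≤ 2 * exp (-q * (t₀ - t)) := by
  have hc : ∀ t, 0 < cosh (q * (t - t₀)) := fun t => cosh_pos _
  refine ⟨fun t => (cosh (q * (t - t₀)))⁻¹,
    fun t => -(q * sinh (q * (t - t₀))) / cosh (q * (t - t₀)) ^ 2, fun t => ?_, ?_,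
    fun t => inv_pos.2 (hc t), fun t => ?_, fun x y hxy => ?_, by simp, fun t => ?_, fun t => ?_⟩
  · have h1 : HasDerivAt (fun t => q * (t - t₀)) q t := by
      simpa using ((hasDerivAt_id t).sub_const t₀).const_mul q
    have h2 := (h1.cosh).inv (hc t).ne'
    rwa [mul_comm (sinh _)] at h2
  · exact Continuous.div (by fun_prop) (by fun_prop) fun t => (pow_pos (hc t) 2).ne'
  · have h1 : |sinh (q * (t - t₀))| ≤ cosh (q * (t - t₀)) := by
      rw [abs_le]
      constructor <;> linarith [exp_pos (q * (t - t₀)), exp_pos (-(q * (t - t₀))),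
        cosh_add_sinh (q * (t - t₀)), cosh_sub_sinh (q * (t - t₀))]
    rw [abs_div, abs_neg, abs_mul, abs_of_pos hq, abs_of_pos (pow_pos (hc t) 2),
      div_le_iff₀ (pow_pos (hc t) 2)]
    calc q * |sinh (q * (t - t₀))| ≤ q * cosh (q * (t - t₀)) := by gcongr
      _ = _ := by have := (hc t).ne'; field_simp
  · rw [← div_eq_mul_inv, le_div_iff₀ (hc y), inv_mul_le_iff₀ (hc x)]
    rw [abs_le] at hxy
    have h1 : exp (q * (y - t₀)) ≤ exp (3 * q) * exp (q * (x - t₀)) := by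
      rw [← exp_add]; gcongr; nlinarith
    have h2 : exp (-(q * (y - t₀))) ≤ exp (3 * q) * exp (-(q * (x - t₀))) := by
      rw [← exp_add]; gcongr; nlinarith
    rw [cosh_eq, cosh_eq]
    linarith
  · rw [inv_le_iff_one_le_mul₀ (hc t), cosh_eq]
    have h1 : exp (-q * (t - t₀)) * exp (q * (t - t₀)) = 1 := by rw [← exp_add]; simp
    nlinarith [mul_pos (exp_pos (-q * (t - t₀))) (exp_pos (-(q * (t - t₀))))]
  · rw [inv_le_iff_one_le_mul₀ (hc t), cosh_eq]
    have h1 : exp (-q * (t₀ - t)) * exp (-(q * (t - t₀))) = 1 := by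
      rw [← exp_add, exp_eq_one_iff]; ring
    nlinarith [mul_pos (exp_pos (-q * (t₀ - t))) (exp_pos (q * (t - t₀)))]

lemma window_bounds {K C c κ δ σ W Wh Wb z z1 Z G h1 h2 b2 be pe e : ℝ} (hK : 1 ≤ K) (hC : 1 ≤ C)
    (hc : 0 ≤ c) (hκ : 1 ≤ κ) (hδ : 0 ≤ δ) (hδσ : C * δ ≤ σ) (he : 0 ≤ e) (hW : 0 ≤ W)
    (hWh : 0 ≤ Wh) (hz0 : 0 ≤ z) (hZ0 : 0 ≤ Z) (hG0 : 0 ≤ G) (hz1 : z1 ≤ W + K * 6 * e)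
    (hh1 : h1 ≤ Wh + K * 6 * e) (hh2 : h2 ≤ h1) (hz : z ≤ z1) (hb2 : b2 ≤ 2 * z)
    (hZ : Z ≤ 3 * (3 * (C * δ) * K ^ 2) * z1) (hG : G ≤ 3 * (C * K ^ 2) * (h1 + 3 * δ * z1))
    (hpe : pe ≤ 30 * (C * K) * e) (hbe : be ≤ K * 6 * e)
    (hH : Wh ≤ 2 * (10 ^ 12 * (σ * (z + G + Z)) + c * (10 ^ 4 * Z + κ * (10 ^ 5 * pe))))
    (hB : Wb ≤ 2 * (10 ^ 9 * (σ * b2) + 10 ^ 4 * h2 +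
      c * (10 ^ 4 * (G + Z) + κ * (10 ^ 3 * be)))) :
    z ≤ 10 ^ 13 * (C * K ^ 3 * ((1 + c) * κ)) * (W + e) ∧
    Z ≤ 10 ^ 13 * (C * K ^ 3 * ((1 + c) * κ)) * (σ * (W + e)) ∧
    G ≤ 10 ^ 13 * (C * K ^ 3 * ((1 + c) * κ)) * (Wh + e + σ * (W + e)) ∧
    Wh ≤ 10 ^ 13 * (C * K ^ 3 * ((1 + c) * κ)) * (σ * (z + G + Z) + Z + e) ∧
    Wb ≤ 10 ^ 13 * (C * K ^ 3 * ((1 + c) * κ)) * (σ * z + Wh + G + Z + e) := by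
  have hK0 : 0 ≤ K := by linarith
  have hC0 : 0 ≤ C := by linarith
  have hκ0 : 0 ≤ κ := by linarith
  have hσ : 0 ≤ σ := le_trans (by positivity) hδσ
  have hK3 : K ≤ K ^ 3 := le_self_pow₀ hK (by norm_num)
  have hK23 : K ^ 2 ≤ K ^ 3 := pow_le_pow_right₀ hK (by norm_num)
  have hK13 : 1 ≤ K ^ 3 := one_le_pow₀ hK
  have hp : K ^ 3 ≤ C * K ^ 3 := le_mul_of_one_le_left (by positivity) hC
  have hCK : C * K ≤ C * K ^ 3 := mul_le_mul_of_nonneg_left hK3 hC0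
  have hCK2 : C * K ^ 2 ≤ C * K ^ 3 := mul_le_mul_of_nonneg_left hK23 hC0
  have hr : 1 + c ≤ (1 + c) * κ := le_mul_of_one_le_right (by positivity) hκ
  have hcκ : c * κ ≤ (1 + c) * κ := by linarith
  set p := C * K ^ 3 with hp'
  set r := (1 + c) * κ with hr'
  have hpr : p ≤ p * r := le_mul_of_one_le_right (by linarith) (by linarith)
  have hrp : r ≤ p * r := le_mul_of_one_le_left (by linarith) (by linarith)
  have hpe' : c * κ * (C * K) ≤ p * r := by
    rw [mul_comm p r]; exact mul_le_mul hcκ hCK (by positivity) (by linarith)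
  have hbe' : c * κ * K ≤ p * r :=
    (mul_le_mul_of_nonneg_left (le_mul_of_one_le_left hK0 hC) (by positivity)).trans hpe'
  have hP : 0 ≤ p * r := by positivity
  have w0 : 0 ≤ W + e := by linarith
  have z1w : z1 ≤ 6 * K * (W + e) := by nlinarith [mul_le_mul_of_nonneg_right hK hW]
  have dz1 : C * δ * K ^ 2 * z1 ≤ 6 * (K ^ 3 * (σ * (W + e))) :=
    calc C * δ * K ^ 2 * z1 ≤ C * δ * K ^ 2 * (6 * K * (W + e)) := by gcongr
      _ ≤ σ * K ^ 2 * (6 * K * (W + e)) := by gcongr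
      _ = _ := by ring
  generalize hw : W + e = w at *
  have hσw : 0 ≤ σ * w := mul_nonneg hσ w0
  have i3 : C * K ^ 2 * h1 ≤ p * Wh + 6 * (p * e) := by
    have a1 := mul_le_mul_of_nonneg_left hh1 (by positivity : 0 ≤ C * K ^ 2)
    have a2 := mul_le_mul_of_nonneg_right hCK2 hWh
    have a3 : C * K ^ 2 * (K * 6 * e) = 6 * (p * e) := by rw [hp']; ring
    linarith
  refine ⟨?_, ?_, ?_, ?_, ?_⟩
  · have a1 := mul_le_mul_of_nonneg_right (show K ≤ p * r by linarith) w0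
    have a2 := mul_nonneg hP w0
    linarith
  · have a1 := mul_le_mul_of_nonneg_right (show K ^ 3 ≤ p * r by linarith) hσw
    have a2 := mul_nonneg hP hσw
    linarith
  · have a1 := mul_le_mul_of_nonneg_right (show K ^ 3 ≤ p * r by linarith) hσw
    have a2 := mul_nonneg hP hσw
    have a3 := mul_le_mul_of_nonneg_right hpr hWh
    have a4 := mul_le_mul_of_nonneg_right hpr he
    have a5 := mul_nonneg hP hWh
    have a6 := mul_nonneg hP he
    linarith
  · have a1 := mul_le_mul_of_nonneg_left hpe (by positivity : 0 ≤ c * κ)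
    have a2 := mul_le_mul_of_nonneg_right hpe' he
    have a3 := mul_le_mul_of_nonneg_right (show c ≤ p * r by linarith) hZ0
    have a4 : 0 ≤ σ * (z + G + Z) := by positivity
    have a5 := mul_le_mul_of_nonneg_right (show 1 ≤ p * r by linarith) a4
    have a6 := mul_nonneg hP hZ0
    have a7 := mul_nonneg hP he
    linarith
  · have a1 := mul_le_mul_of_nonneg_left hbe (by positivity : 0 ≤ c * κ)
    have a2 := mul_le_mul_of_nonneg_right hbe' he
    have a3 := mul_le_mul_of_nonneg_right (show c ≤ p * r by linarith) hZ0
    have a4 := mul_le_mul_of_nonneg_right (show c ≤ p * r by linarith) hG0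
    have a5 := mul_le_mul_of_nonneg_left hb2 hσ
    have a6 := mul_le_mul_of_nonneg_right (show 1 ≤ p * r by linarith) (mul_nonneg hσ hz0)
    have a7 := mul_le_mul_of_nonneg_right (show 1 ≤ p * r by linarith) hWh
    have a8 := mul_le_mul_of_nonneg_right (show K ≤ p * r by linarith) he
    have a9 := mul_nonneg hP hZ0
    have a10 := mul_nonneg hP hG0
    have a11 := mul_nonneg hP he
    have a12 := mul_nonneg hP hWh
    have a13 := mul_nonneg hP (mul_nonneg hσ hz0)
    linarith

lemma window_absorb {K C c κ : ℝ} (hK : 1 ≤ K) (hC : 1 ≤ C) (hc : 0 ≤ c) (hκ : 1 ≤ κ) :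
    ∃ σ₀ > 0, ∃ B : ℝ, 0 ≤ B ∧ ∀ (l : ℕ) (δ σ : ℝ) (ω Jh Jb Jz Jq Jg : ℝ → ℝ), 2 ≤ l → 0 ≤ δ →
    C * δ ≤ σ → σ ≤ σ₀ →
    Continuous ω → Continuous Jh → Continuous Jb → Continuous Jz → Continuous Jq → Continuous Jg →
    (∀ t, 0 ≤ ω t) → (∀ t, 0 ≤ Jh t) → (∀ t, 0 ≤ Jb t) → (∀ t, 0 ≤ Jz t) → (∀ t, 0 ≤ Jq t) →
    (∀ t, 0 ≤ Jg t) → (∀ x y, |x - y| ≤ 3 → ω x ≤ K * ω y) →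
    (∀ t, Jz t = 2⁻¹ * Jh t + 2⁻¹ * Jb t) →
    (∀ j : ℕ, 1 ≤ j → j ≤ l → ∫ t in (j : ℝ)..(j + 3 : ℝ), Jz t ≤ 3 * δ) →
    (∀ j : ℕ, 1 ≤ j → j ≤ l → ∫ t in (j + 1 : ℝ)..(j + 2 : ℝ), Jq t ≤
      C * (∫ t in (j : ℝ)..(j + 3 : ℝ), Jz t) ^ 2) →
    (∀ j : ℕ, 1 ≤ j → j ≤ l → ∫ t in (j + 1 : ℝ)..(j + 2 : ℝ), Jg t ≤
      C * ((∫ t in (j : ℝ)..(j + 3 : ℝ), Jh t) + (∫ t in (j : ℝ)..(j + 3 : ℝ), Jz t) ^ 2)) →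
    wInt ω Jh 3 (l + 1) ≤ 2 * (10 ^ 12 * (σ * (wInt ω Jz 2 (l + 2) + wInt ω Jg 2 (l + 2) +
      wInt ω Jq 2 (l + 2))) + c * (10 ^ 4 * wInt ω Jq 2 (l + 2) +
      κ * (10 ^ 5 * (wInt ω (fun t => Jh t + Jg t + Jq t) 2 3 +
        wInt ω (fun t => Jh t + Jg t + Jq t) (l + 1) (l + 2))))) →
    wInt ω Jb 3 (l + 1) ≤ 2 * (10 ^ 9 * (σ * wInt ω Jb 2 (l + 2)) + 10 ^ 4 * wInt ω Jh 2 (l + 2) +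
      c * (10 ^ 4 * (wInt ω Jg 2 (l + 2) + wInt ω Jq 2 (l + 2)) +
      κ * (10 ^ 3 * (wInt ω Jb 2 3 + wInt ω Jb (l + 1) (l + 2))))) →
    wInt ω Jz 3 (l + 1) ≤ B * (δ * (ω 1 + ω (l + 3))) := by
  have hA : 1 ≤ C * K ^ 3 * ((1 + c) * κ) :=
    one_le_mul_of_one_le_of_one_le
      (one_le_mul_of_one_le_of_one_le hC (one_le_pow₀ hK))
      (one_le_mul_of_one_le_of_one_le (by linarith) hκ)
  obtain ⟨σ₀, hσ₀, B, hB, key⟩ :=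
    weight_absorb (10 ^ 13 * (C * K ^ 3 * ((1 + c) * κ))) (by linarith)
  refine ⟨min σ₀ 1, by positivity, B, hB, ?_⟩
  intro l δ σ ω Jh Jb Jz Jq Jg hl hδ hδσ hσ cω ch cb cz cq cg hω hh hb hz hq hg hωK hJ wz wq wg
    eH eB
  have hσ1 : σ ≤ 1 := hσ.trans (min_le_right _ _)
  have hσ0 : 0 ≤ σ := le_trans (by positivity) hδσ
  have hδC : δ ≤ C * δ := le_mul_of_one_le_left hδ hC
  have hlR : (2 : ℝ) ≤ l := by exact_mod_cast hl
  set e := δ * (ω 1 + ω (l + 3)) with he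
  have he0 : 0 ≤ e := mul_nonneg hδ (add_nonneg (hω _) (hω _))
  have hhz : ∀ t, Jh t ≤ 2 * Jz t := fun t => by linarith [hJ t, hb t]
  have hbz : ∀ t, Jb t ≤ 2 * Jz t := fun t => by linarith [hJ t, hh t]
  -- integrals over single windows
  have mono : ∀ {F : ℝ → ℝ} {a b a' b' : ℝ}, Continuous F → (∀ t, 0 ≤ F t) → a ≤ a' → a' ≤ b' →
      b' ≤ b → ∫ t in a'..b', F t ≤ ∫ t in a..b, F t := fun hF h0 h1 h2 h3 =>
    intervalIntegral.integral_mono_interval h1 h2 h3 (Filter.Eventually.of_forall h0)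
      (hF.intervalIntegrable _ _)
  have hz0 : ∀ j : ℕ, 0 ≤ ∫ t in (j : ℝ)..(j + 3 : ℝ), Jz t := fun j =>
    intervalIntegral.integral_nonneg (by linarith) fun t _ => hz t
  have two : ∀ {F : ℝ → ℝ} {a b : ℝ}, Continuous F → (∀ t, F t ≤ 2 * Jz t) → a ≤ b →
      ∫ t in a..b, F t ≤ 2 * ∫ t in a..b, Jz t := fun hF h hab => by
    rw [← intervalIntegral.integral_const_mul]
    exact intervalIntegral.integral_mono_on hab (hF.intervalIntegrable _ _)
      ((continuous_const.mul cz).intervalIntegrable _ _) fun t _ => h t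
  have sq : ∀ j : ℕ, 1 ≤ j → j ≤ l → C * (∫ t in (j : ℝ)..(j + 3 : ℝ), Jz t) ^ 2 ≤
      3 * (C * δ) * ∫ t in (j : ℝ)..(j + 3 : ℝ), Jz t := fun j h1 h2 => by
    have := mul_le_mul_of_nonneg_right (wz j h1 h2) (hz0 j)
    nlinarith
  have sq' : ∀ j : ℕ, 1 ≤ j → j ≤ l → C * (∫ t in (j : ℝ)..(j + 3 : ℝ), Jz t) ^ 2 ≤ 9 * δ :=
    fun j h1 h2 => (sq j h1 h2).trans <| by
      have a1 := wz j h1 h2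
      have a2 : 3 * (C * δ) * (∫ t in (j : ℝ)..(j + 3 : ℝ), Jz t) ≤ 3 * 1 * (3 * δ) := by
        gcongr
        · exact hz0 j
        · linarith
      linarith
  have chg : Continuous fun t => Jh t + Jg t := ch.add cg
  have cP : Continuous fun t => Jh t + Jg t + Jq t := (ch.add cg).add cq
  have hP : ∀ j : ℕ, 1 ≤ j → j ≤ l →
      ∫ t in (j + 1 : ℝ)..(j + 2 : ℝ), (Jh t + Jg t + Jq t) ≤ 30 * (C * δ) := fun j h1 h2 => by
    have a1 : ∫ t in (j : ℝ)..(j + 3 : ℝ), Jh t ≤ 6 * δ :=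
      (two ch hhz (by linarith)).trans (by linarith [wz j h1 h2])
    have a2 : ∫ t in (j + 1 : ℝ)..(j + 2 : ℝ), Jh t ≤ 6 * δ :=
      (mono ch hh (by linarith) (by linarith) (by linarith)).trans a1
    have a3 := mul_le_mul_of_nonneg_left a1 (by linarith : 0 ≤ C)
    rw [intervalIntegral.integral_add (chg.intervalIntegrable _ _)
      (cq.intervalIntegrable _ _), intervalIntegral.integral_add (ch.intervalIntegrable _ _)
      (cg.intervalIntegrable _ _)]
    linarith [wq j h1 h2, wg j h1 h2, sq' j h1 h2]
  -- weighted integrals near the two ends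
  have left : ∀ {F : ℝ → ℝ} {a b M : ℝ}, Continuous F → (∀ t, 0 ≤ F t) → 1 ≤ a → a ≤ b → b ≤ 3 →
      ∫ t in a..b, F t ≤ M * δ → wInt ω F a b ≤ K * M * (δ * ω 1) := fun hF h0 h1 h2 h3 h => by
    refine (wInt_le_of_le cω hF h0 h2 (M := K * ω 1) fun t ht => hωK _ _ ?_).trans ?_
    · rw [abs_le]; constructor <;> linarith [ht.1, ht.2]
    · have := mul_le_mul_of_nonneg_left h (mul_nonneg (by linarith : 0 ≤ K) (hω 1))
      linarith
  have right : ∀ {F : ℝ → ℝ} {a b M : ℝ}, Continuous F → (∀ t, 0 ≤ F t) → l + 1 ≤ a → a ≤ b →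
      b ≤ l + 3 → ∫ t in a..b, F t ≤ M * δ → wInt ω F a b ≤ K * M * (δ * ω (l + 3)) :=
    fun hF h0 h1 h2 h3 h => by
    refine (wInt_le_of_le cω hF h0 h2 (M := K * ω (l + 3)) fun t ht => hωK _ _ ?_).trans ?_
    · rw [abs_le]; constructor <;> linarith [ht.1, ht.2]
    · have := mul_le_mul_of_nonneg_left h (mul_nonneg (by linarith : 0 ≤ K) (hω (l + 3)))
      linarith
  have wz1 : ∫ t in (1 : ℝ)..4, Jz t ≤ 3 * δ := by
    have := wz 1 le_rfl (by omega); norm_num at this; exact this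
  have wzl : ∫ t in (l : ℝ)..(l + 3), Jz t ≤ 3 * δ := wz l (by omega) le_rfl
  have endL : ∀ {F : ℝ → ℝ} {a b : ℝ}, Continuous F → (∀ t, 0 ≤ F t) → (∀ t, F t ≤ 2 * Jz t) →
      1 ≤ a → a ≤ b → b ≤ 3 → wInt ω F a b ≤ K * 6 * (δ * ω 1) := fun hF h0 h h1 h2 h3 =>
    left hF h0 h1 h2 h3 <| (mono hF h0 h1 h2 (show _ ≤ (4 : ℝ) by linarith)).trans <|
      (two hF h (by norm_num)).trans (by linarith)
  have endR : ∀ {F : ℝ → ℝ} {a b : ℝ}, Continuous F → (∀ t, 0 ≤ F t) → (∀ t, F t ≤ 2 * Jz t) →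
      l + 1 ≤ a → a ≤ b → b ≤ l + 3 → wInt ω F a b ≤ K * 6 * (δ * ω (l + 3)) :=
    fun hF h0 h h1 h2 h3 =>
    right hF h0 h1 h2 h3 <| (mono hF h0 (show (l : ℝ) ≤ _ by linarith) h2 h3).trans <|
      (two hF h (by linarith)).trans (by linarith)
  have ends : ∀ {F : ℝ → ℝ}, Continuous F → (∀ t, 0 ≤ F t) → (∀ t, F t ≤ 2 * Jz t) →
      wInt ω F 1 (l + 3) ≤ wInt ω F 3 (l + 1) + K * 6 * e := fun {F} hF h0 h => by
    have s1 := wInt_add_adjacent cω hF 1 3 (l + 1)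
    have s2 := wInt_add_adjacent cω hF 1 (l + 1) (l + 3)
    have s3 := endL hF h0 h le_rfl (by norm_num) le_rfl
    have s4 := endR hF h0 h le_rfl (by linarith) le_rfl
    rw [he]; linarith
  have inner : ∀ {F : ℝ → ℝ}, Continuous F → (∀ t, 0 ≤ F t) →
      wInt ω F 2 (l + 2) ≤ wInt ω F 1 (l + 3) := fun {F} hF h0 => by
    have s1 := wInt_add_adjacent cω hF 1 2 (l + 2)
    have s2 := wInt_add_adjacent cω hF 1 (l + 2) (l + 3)
    have s3 : 0 ≤ wInt ω F 1 2 := wInt_nonneg hω h0 (by norm_num)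
    have s4 : 0 ≤ wInt ω F (l + 2) (l + 3) := wInt_nonneg hω h0 (by linarith)
    linarith
  -- summation over windows
  have sums : ∀ {F G : ℝ → ℝ} {d : ℝ}, 0 ≤ d → Continuous F → Continuous G → (∀ t, 0 ≤ F t) →
      (∀ t, 0 ≤ G t) → (∀ j : ℕ, 1 ≤ j → j ≤ l →
        ∫ t in (j + 1 : ℝ)..(j + 2 : ℝ), F t ≤ d * ∫ t in (j : ℝ)..(j + 3 : ℝ), G t) →
      wInt ω F 2 (l + 2) ≤ 3 * (d * K ^ 2) * wInt ω G 1 (l + 3) := fun {F G d} hd hF hG h0 h1 h => by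
    have := sum_windows hd (by linarith : 0 ≤ K) hF hG cω h0 h1 hω hωK 1 l
      fun j hj hj' => h j hj (by omega)
    rw [show (((1 : ℕ) : ℝ) + 1) = 2 by norm_num, show (((1 : ℕ) : ℝ) + 2 + l) = l + 3 by
      push_cast; ring, add_comm (2 : ℝ) l, Nat.cast_one] at this
    exact this
  have hZ := sums (by positivity : 0 ≤ 3 * (C * δ)) cq cz hq hz fun j h1 h2 =>
    (wq j h1 h2).trans (sq j h1 h2)
  have cz3 : Continuous fun t => 3 * δ * Jz t := continuous_const.mul cz
  have chz : Continuous fun t => Jh t + 3 * δ * Jz t := ch.add cz3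
  have hG := sums (by linarith : 0 ≤ C) cg chz hg
    (fun t => add_nonneg (hh t) (mul_nonneg (by positivity) (hz t))) fun j h1 h2 => by
      refine (wg j h1 h2).trans ?_
      rw [intervalIntegral.integral_add (ch.intervalIntegrable _ _)
        (cz3.intervalIntegrable _ _), intervalIntegral.integral_const_mul]
      linarith [sq j h1 h2]
  rw [wInt_add cω ch cz3, wInt_const_mul] at hG
  have hPe : wInt ω (fun t => Jh t + Jg t + Jq t) 2 3 +
      wInt ω (fun t => Jh t + Jg t + Jq t) (l + 1) (l + 2) ≤ 30 * (C * K) * e := by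
    have hP0 : ∀ t, 0 ≤ Jh t + Jg t + Jq t := fun t => by linarith [hh t, hg t, hq t]
    have s1 := left (M := 30 * C) cP hP0 (by norm_num : (1 : ℝ) ≤ 2) (by norm_num) le_rfl
      (by have := hP 1 le_rfl (by omega); norm_num at this; linarith)
    have s2 := right (M := 30 * C) cP hP0 le_rfl (by linarith : (l : ℝ) + 1 ≤ l + 2) (by linarith)
      (by have := hP l (by omega) le_rfl; linarith)
    rw [he]; linarith
  have hBe : wInt ω Jb 2 3 + wInt ω Jb (l + 1) (l + 2) ≤ K * 6 * e := by
    have s1 := endL cb hb hbz (by norm_num : (1 : ℝ) ≤ 2) (by norm_num) le_rfl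
    have s2 := endR cb hb hbz le_rfl (by linarith : (l : ℝ) + 1 ≤ l + 2) (by linarith)
    rw [he]; linarith
  have zz := ends cz hz fun t => by linarith [hz t]
  have hz1 := ends ch hh hhz
  have hz2 := inner ch hh
  have hz3 := inner cz hz
  have hz4 : wInt ω Jb 2 (l + 2) ≤ 2 * wInt ω Jz 2 (l + 2) := by
    rw [← wInt_const_mul]
    exact wInt_mono cω hω cb (continuous_const.mul cz) (by linarith) hbz
  have hW : wInt ω Jz 3 (l + 1) = 2⁻¹ * wInt ω Jh 3 (l + 1) + 2⁻¹ * wInt ω Jb 3 (l + 1) := by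
    have ch' : Continuous fun t => 2⁻¹ * Jh t := continuous_const.mul ch
    have cb' : Continuous fun t => 2⁻¹ * Jb t := continuous_const.mul cb
    rw [← wInt_const_mul, ← wInt_const_mul, ← wInt_add cω ch' cb']
    simp only [← hJ]
  have W0 : 0 ≤ wInt ω Jz 3 (l + 1) := wInt_nonneg hω hz (by linarith)
  have Wh0 : 0 ≤ wInt ω Jh 3 (l + 1) := wInt_nonneg hω hh (by linarith)
  have Wb0 : 0 ≤ wInt ω Jb 3 (l + 1) := wInt_nonneg hω hb (by linarith)
  have z0 : 0 ≤ wInt ω Jz 2 (l + 2) := wInt_nonneg hω hz (by linarith)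
  have Z0 : 0 ≤ wInt ω Jq 2 (l + 2) := wInt_nonneg hω hq (by linarith)
  have G0 : 0 ≤ wInt ω Jg 2 (l + 2) := wInt_nonneg hω hg (by linarith)
  obtain ⟨i1, i2, i3, i4, i5⟩ := window_bounds hK hC hc hκ hδ hδσ he0 W0 Wh0 z0 Z0 G0 zz hz1 hz2 hz3
    hz4 hZ hG hPe hBe eH eB
  exact key σ _ _ _ _ _ _ e hσ0 (hσ.trans (min_le_left _ _)) Wh0 Wb0 he0 hW i1 i2 i3 i4 i5

end Windows

section Decay

local notation "𝔼" n => EuclideanSpace ℝ (Fin n)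

lemma weighted_strip_estimate {q : ℝ} (hq0 : 0 < q) (hq2 : q < 2) (m : ℕ) (hm : 0 < m) :
    ∃ δ₁ > 0, ∃ B : ℝ, 0 ≤ B ∧ ∀ (f : ℝ → ℝ → 𝔼 n) (u : ℝ → ℝ → ℝ) (s : Set ℝ) (l : ℕ)
      (δ d : ℝ) (ω ω' : ℝ → ℝ), 2 ≤ l → 0 ≤ δ → δ < δ₁ → d < δ₁ → ConfWillmore f u s →
      (∀ t ∈ Icc (1 : ℝ) (l + 3), s ∈ nhds t) →
      (∀ t ∈ Icc (1 : ℝ) (l + 3), ∀ θ, |pt u t θ + m| ≤ d) →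
      (∀ t ∈ Icc (1 : ℝ) (l + 3), ∀ θ, |pth u t θ| ≤ d) →
      (∀ t ∈ Icc (1 : ℝ) (l + 3), ∀ c, tau1 f u c t = 0) →
      (∀ t ∈ Icc (1 : ℝ) (l + 3), ∀ S : Matrix (Fin n) (Fin n) ℝ, S.transpose = -S →
        tau2 f u S t = 0) →
      (∀ j : ℕ, 1 ≤ j → j ≤ l → stripInt (Adens f u) j (j + 3) ≤ 3 * δ) →
      (∀ t, HasDerivAt ω (ω' t) t) → Continuous ω' → (∀ t, 0 < ω t) → (∀ t, |ω' t| ≤ q * ω t) →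
      (∀ x y, |x - y| ≤ 3 → ω x ≤ exp (3 * q) * ω y) →
      wInt ω (circInt (Adens f u)) 3 (l + 1) ≤ B * (δ * (ω 1 + ω (l + 3))) := by
  obtain ⟨ε₁, hε₁, C, hC, loc⟩ := local_estimate (n := n) (m + 1) (by positivity)
  obtain ⟨κ, hκ, cut⟩ := exists_cutoff_bound
  have hq' : 0 < 2 - q := by linarith
  have hK : 1 ≤ exp (3 * q) := one_le_exp (by positivity)
  obtain ⟨σ₀, hσ₀, B, hB, absorb⟩ := window_absorb hK (by linarith : 1 ≤ 3 * C)
    (by positivity : 0 ≤ 8 / ((2 - q) / 2) ^ 2) hκ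
  obtain ⟨ε, hε, hε1, hε2, hε3⟩ : ∃ ε > 0, ε ≤ 1 / 20 ∧ ε ≤ (2 - q) / 4 ∧ ε ≤ σ₀ :=
    ⟨min (1 / 20) (min ((2 - q) / 4) σ₀), by positivity, min_le_left _ _,
      (min_le_right _ _).trans (min_le_left _ _), (min_le_right _ _).trans (min_le_right _ _)⟩
  have hC0 : 0 < C := by linarith
  refine ⟨min ε (min (ε ^ 2 / (3 * C)) (ε₁ / 3)), by positivity, B, hB, ?_⟩
  intro f u s l δ d ω ω' hl hδ hδ₁ hd hW hs hpt hpth hτ₁ hτ₂ hwin hω hω'c hω0 hωq hωK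
  have hlR : (2 : ℝ) ≤ l := by exact_mod_cast hl
  have hdε : d ≤ ε := hd.le.trans (min_le_left _ _)
  have hδε : 3 * C * δ ≤ ε ^ 2 := by
    have := hδ₁.le.trans ((min_le_right _ _).trans (min_le_left _ _))
    rw [le_div_iff₀ (by positivity)] at this
    linarith
  have hδε₁ : 3 * δ ≤ ε₁ := by
    linarith [hδ₁.le.trans ((min_le_right _ _).trans (min_le_right _ _))]
  have hωc : Continuous ω := continuous_iff_continuousAt.2 fun t => (hω t).continuousAt
  have hω0' : ∀ t, 0 ≤ ω t := fun t => (hω0 t).le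
  have hf := hW.1.s2f
  have hu := hW.1.s2u
  have cz := (smooth2_Adens hf hu).cont.circInt
  have ch := (smooth2_Hdens hf hu).cont.circInt
  have cb := (smooth2_Bdens hf hu).cont.circInt
  have cg := (smooth2_Gdens hf hu).cont.circInt
  have cq := ((smooth2_Adens hf hu).pow 2).cont.circInt
  have hz : ∀ t, 0 ≤ circInt (Adens f u) t := fun t => circInt_nonneg fun θ => Adens_nonneg t θ
  have hh : ∀ t, 0 ≤ circInt (Hdens f u) t := fun t => circInt_nonneg fun θ => Hdens_nonneg t θ
  have hb : ∀ t, 0 ≤ circInt (Bdens f u) t := fun t => circInt_nonneg fun θ => Bdens_nonneg t θ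
  have hg : ∀ t, 0 ≤ circInt (Gdens f u) t := fun t => circInt_nonneg fun θ => Gdens_nonneg t θ
  have hq : ∀ t, 0 ≤ circInt (fun t θ => Adens f u t θ ^ 2) t := fun t =>
    circInt_nonneg fun θ => sq_nonneg _
  have sub : ∀ j : ℕ, 1 ≤ j → j ≤ l → Icc (j : ℝ) (j + 3) ⊆ Icc 1 (l + 3) := fun j h1 h2 => by
    have : (1 : ℝ) ≤ j := by exact_mod_cast h1
    have : (j : ℝ) ≤ l := by exact_mod_cast h2
    exact Icc_subset_Icc (by linarith) (by linarith)
  have hloc := fun (j : ℕ) (h1 : 1 ≤ j) (h2 : j ≤ l) => loc f u s j hW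
    (fun t ht => hs t (sub j h1 h2 ht))
    (fun t ht θ => by
      have := abs_le.1 (hpt t (sub j h1 h2 ht) θ)
      have hm' : (0 : ℝ) ≤ m := m.cast_nonneg
      rw [abs_le]; constructor <;> linarith)
    (fun t ht θ => (hpth t (sub j h1 h2 ht) θ).trans (by
      have hm' : (0 : ℝ) ≤ m := m.cast_nonneg
      linarith))
    ((hwin j h1 h2).trans hδε₁)
  have cover : ∀ t ∈ Icc (2 : ℝ) (l + 2), ∃ j : ℕ, 1 ≤ j ∧ j ≤ l ∧
      t ∈ Icc (j + 1 : ℝ) (j + 2) := fun t ht => by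
    rcases ht.2.eq_or_lt with h | h
    · exact ⟨l, by omega, le_rfl, by linarith, h.le⟩
    · have h0 : 0 ≤ t := by linarith [ht.1]
      have h2 : 2 ≤ ⌊t⌋₊ := Nat.le_floor (by exact_mod_cast ht.1)
      have h3 : ⌊t⌋₊ < l + 2 := (Nat.floor_lt h0).2 (by exact_mod_cast h)
      refine ⟨⌊t⌋₊ - 1, by omega, by omega, ?_, ?_⟩ <;>
        rw [Nat.cast_sub (by omega), Nat.cast_one]
      · linarith [Nat.floor_le h0]
      · linarith [Nat.lt_floor_add_one t]
  have sub' : Icc (2 : ℝ) (l + 2) ⊆ Icc 1 (l + 3) :=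
    Icc_subset_Icc (by norm_num) (by linarith)
  have near : ∀ t ∈ Icc (2 : ℝ) (l + 2), NearCircle f u s m t ε := fun t ht => by
    obtain ⟨j, h1, h2, h3⟩ := cover t ht
    refine ⟨hW.1, hs t (sub' ht), hm, fun θ => (hpt t (sub' ht) θ).trans hdε,
      fun θ => (hpth t (sub' ht) θ).trans hdε, hε1, ?_⟩
    refine ((hloc j h1 h2).1 t h3).trans (le_trans ?_ hδε)
    linarith [mul_le_mul_of_nonneg_left (hwin j h1 h2) hC0.le]
  have hden : 8 / (2 - q - 2 * ε) ^ 2 ≤ 8 / ((2 - q) / 2) ^ 2 := by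
    gcongr; linarith
  have hq2ε : q + 2 * ε < 2 := by linarith
  have hr : 0 ≤ 8 / (2 - q - 2 * ε) ^ 2 := by positivity
  have cm : ∀ (r : ℝ) {F : ℝ → ℝ}, Continuous F → Continuous fun t => r * F t := fun r _ hF =>
    continuous_const.mul hF
  have e₁ : (2 : ℝ) + 1 = 3 := by norm_num
  have e₂ : (l : ℝ) + 2 - 1 = l + 1 := by ring
  refine absorb l δ (ε ^ 2) ω _ _ _ _ _ hl hδ hδε (by nlinarith) hωc ch cb cz cq cg hω0' hh hb hz
    hq hg hωK (fun t => ?_) hwin (fun j h1 h2 => ?_) (fun j h1 h2 => ?_) ?_ ?_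
  · rw [← circInt_const_mul, ← circInt_const_mul, ← circInt_add
      (Cont2.mul (.const _) (smooth2_Hdens hf hu).cont)
      (Cont2.mul (.const _) (smooth2_Bdens hf hu).cont)]
    exact circInt_congr fun θ => Adens_eq_dens t θ
  · refine (hloc j h1 h2).2.1.trans (mul_le_mul_of_nonneg_right (by linarith) (sq_nonneg _))
  · refine (hloc j h1 h2).2.2.trans (mul_le_mul_of_nonneg_right (by linarith) ?_)
    exact add_nonneg (stripInt_nonneg (by linarith) Hdens_nonneg) (sq_nonneg _)
  · have cX : Continuous fun t => 10 ^ 4 * circInt (fun t θ => Adens f u t θ ^ 2) t :=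
      cm _ cq
    have c2 : Continuous fun t => circInt (Adens f u) t + circInt (Gdens f u) t := cz.add cg
    have c3 : Continuous fun t => circInt (Adens f u) t + circInt (Gdens f u) t +
      circInt (fun t θ => Adens f u t θ ^ 2) t := c2.add cq
    have c4 : Continuous fun t => circInt (Hdens f u) t + circInt (Gdens f u) t +
      circInt (fun t θ => Adens f u t θ ^ 2) t := (ch.add cg).add cq
    have h4 : ∀ t, 0 ≤ circInt (Hdens f u) t + circInt (Gdens f u) t +
      circInt (fun t θ => Adens f u t θ ^ 2) t := fun t =>
        add_nonneg (add_nonneg (hh t) (hg t)) (hq t)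
    have := cut 2 (l + 2) (by linarith) _ ω _ _ _ _ hr hωc ch cX
      (cm (10 ^ 5) c4) (cm (10 ^ 12) (cm (ε ^ 2) c3)) hω0' hh
      (fun t => mul_nonneg (by norm_num) (hq t)) (fun t => mul_nonneg (by norm_num) (h4 t))
      (fun t => mul_nonneg (by norm_num) (mul_nonneg (sq_nonneg ε)
        (add_nonneg (add_nonneg (hz t) (hg t)) (hq t))))
      fun η η' e1 e2 e3 e4 => weighted_estimate_H (by linarith) hq2ε hW near
        (fun t ht => hτ₁ t (sub' ht)) (fun t ht => hτ₂ t (sub' ht)) hω hω'c hω0 hωq e1 e2 e3 e4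
    simp only [wInt_const_mul] at this
    rw [wInt_add hωc c2 cq, wInt_add hωc cz cg, e₁, e₂, ← mul_add (10 ^ 5)] at this
    refine this.trans ?_
    have n1 := wInt_nonneg hω0' hq (by linarith : (2 : ℝ) ≤ l + 2)
    have n2 := wInt_nonneg hω0' h4 (by norm_num : (2 : ℝ) ≤ 3)
    have n3 := wInt_nonneg hω0' h4 (by linarith : (l : ℝ) + 1 ≤ l + 2)
    exact mul_le_mul_of_nonneg_left (add_le_add le_rfl
      (mul_le_mul_of_nonneg_right hden (by positivity))) (by norm_num)
  · have c2 : Continuous fun t => circInt (Gdens f u) t + circInt (fun t θ => Adens f u t θ ^ 2) t :=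
      cg.add cq
    have c4 : Continuous fun t => 10 ^ 9 * (ε ^ 2 * circInt (Bdens f u) t) := cm _ (cm _ cb)
    have c5 : Continuous fun t => 10 ^ 4 * circInt (Hdens f u) t := cm _ ch
    have c6 : Continuous fun t => 10 ^ 9 * (ε ^ 2 * circInt (Bdens f u) t) +
      10 ^ 4 * circInt (Hdens f u) t := c4.add c5
    have := cut 2 (l + 2) (by linarith) _ ω _ _ _ _ hr hωc cb (cm (10 ^ 4) c2)
      (cm (10 ^ 3) cb) c6 hω0' hb
      (fun t => mul_nonneg (by norm_num) (add_nonneg (hg t) (hq t)))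
      (fun t => mul_nonneg (by norm_num) (hb t))
      (fun t => add_nonneg (mul_nonneg (by norm_num) (mul_nonneg (sq_nonneg ε) (hb t)))
        (mul_nonneg (by norm_num) (hh t)))
      fun η η' e1 e2 e3 e4 => weighted_estimate_B (by linarith) hq2ε near hω hω'c hω0 hωq
        e1 e2 e3 e4
    rw [wInt_add hωc c4 c5] at this
    simp only [wInt_const_mul] at this
    rw [wInt_add hωc cg cq, e₁, e₂, ← mul_add (10 ^ 3)] at this
    refine this.trans ?_
    have n1 := wInt_nonneg hω0' hq (by linarith : (2 : ℝ) ≤ l + 2)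
    have n2 := wInt_nonneg hω0' hg (by linarith : (2 : ℝ) ≤ l + 2)
    have n3 := wInt_nonneg hω0' hb (by norm_num : (2 : ℝ) ≤ 3)
    have n4 := wInt_nonneg hω0' hb (by linarith : (l : ℝ) + 1 ≤ l + 2)
    exact mul_le_mul_of_nonneg_left (add_le_add le_rfl
      (mul_le_mul_of_nonneg_right hden (by positivity))) (by norm_num)

lemma cylInt_eq_stripInt {F : ℝ → ℝ → ℝ} (hF : Cont2 F) {a b : ℝ} (hab : a ≤ b) :
    cylInt F a b = stripInt F a b := by
  have hc : Continuous fun p : ℝ × ℝ => F p.1 p.2 := hF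
  unfold cylInt stripInt circInt
  rw [intervalIntegral.integral_of_le hab, Measure.volume_eq_prod,
    setIntegral_prod _ (hc.continuousOn.integrableOn_compact (isCompact_Icc.prod isCompact_Icc)),
    integral_Icc_eq_integral_Ioc]
  simp only [intervalIntegral.integral_of_le Real.two_pi_pos.le, integral_Icc_eq_integral_Ioc]

lemma decay_of_weight {q T t₀ δ B : ℝ} (hq : 0 < q) (hδ : 0 ≤ δ) (hB : 0 ≤ B) {l : ℕ}
    {J : ℝ → ℝ} (hJ : Continuous J) (hJ0 : ∀ t, 0 ≤ J t) (h3 : 3 ≤ t₀) (hl : t₀ ≤ l)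
    (hT : T ≤ l + 5)
    (h : ∀ ω ω' : ℝ → ℝ, (∀ t, HasDerivAt ω (ω' t) t) → Continuous ω' → (∀ t, 0 < ω t) →
      (∀ t, |ω' t| ≤ q * ω t) → (∀ x y, |x - y| ≤ 3 → ω x ≤ exp (3 * q) * ω y) →
      wInt ω J 3 (l + 1) ≤ B * (δ * (ω 1 + ω (l + 3)))) :
    ∫ t in t₀..(t₀ + 1), J t ≤
      2 * exp (5 * q) * B * δ * (exp (-q * t₀) + exp (-q * (T - t₀))) := by
  obtain ⟨ω, ω', h1, h2, hω0, hωq, hωK, hω1, hωl, hωr⟩ := exists_weight hq t₀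
  have hωc : Continuous ω := continuous_iff_continuousAt.2 fun t => (h1 t).continuousAt
  have key := h ω ω' h1 h2 hω0 hωq hωK
  have s1 := wInt_add_adjacent hωc hJ 3 t₀ (t₀ + 1)
  have s2 := wInt_add_adjacent hωc hJ 3 (t₀ + 1) (l + 1)
  have s3 : 0 ≤ wInt ω J 3 t₀ := wInt_nonneg (fun t => (hω0 t).le) hJ0 h3
  have s4 : 0 ≤ wInt ω J (t₀ + 1) (l + 1) :=
    wInt_nonneg (fun t => (hω0 t).le) hJ0 (by linarith)
  have s5 : ∫ t in t₀..(t₀ + 1), J t ≤ exp (3 * q) * wInt ω J t₀ (t₀ + 1) := by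
    unfold wInt
    rw [← intervalIntegral.integral_const_mul]
    refine intervalIntegral.integral_mono_on (by linarith) (hJ.intervalIntegrable _ _)
      (Continuous.intervalIntegrable (by fun_prop) _ _) fun t ht => ?_
    have := hωK t₀ t (by rw [abs_le]; constructor <;> linarith [ht.1, ht.2])
    rw [hω1] at this
    nlinarith [mul_le_mul_of_nonneg_right this (hJ0 t)]
  have w1 : ω 1 ≤ 2 * exp (2 * q) * exp (-q * t₀) := (hωr 1).trans <| by
    rw [mul_assoc, ← exp_add]; gcongr; nlinarith
  have w2 : ω (l + 3) ≤ 2 * exp (2 * q) * exp (-q * (T - t₀)) := (hωl (l + 3)).trans <| by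
    rw [mul_assoc, ← exp_add]; gcongr; nlinarith
  calc ∫ t in t₀..(t₀ + 1), J t ≤ exp (3 * q) * wInt ω J 3 (l + 1) :=
        s5.trans (mul_le_mul_of_nonneg_left (by linarith) (exp_pos _).le)
    _ ≤ exp (3 * q) * (B * (δ * (2 * exp (2 * q) * exp (-q * t₀) +
        2 * exp (2 * q) * exp (-q * (T - t₀))))) :=
      mul_le_mul_of_nonneg_left (key.trans (by gcongr)) (exp_pos _).le
    _ = _ := by
      rw [show 5 * q = 3 * q + 2 * q by ring, exp_add]; ring

end Decay

/-- **Theorem 1.3** (main decay estimate). -/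
theorem main_decay_estimate (n : ℕ) (q : ℝ) (hq0 : 0 < q) (hq2 : q < 2) (m : ℕ) (hm : 0 < m) :
    ∃ δ₁ > (0 : ℝ), ∃ C > (0 : ℝ),
      ∀ T : ℝ, 1 ≤ T →
      ∀ (f : ℝ → ℝ → EuclideanSpace ℝ (Fin n)) (v : ℝ → ℝ → ℝ),
      ConfWillmore f (fun t θ => -(m : ℝ) * t + v t θ) (Set.Icc 0 T) →
      (∀ t ∈ Set.Icc (0 : ℝ) T, ∀ c : EuclideanSpace ℝ (Fin n),
        tau1 f (fun t θ => -(m : ℝ) * t + v t θ) c t = 0) →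
      (∀ t ∈ Set.Icc (0 : ℝ) T, ∀ S : Matrix (Fin n) (Fin n) ℝ, S.transpose = -S →
        tau2 f (fun t θ => -(m : ℝ) * t + v t θ) S t = 0) →
      (∃ b < δ₁, ∀ t ∈ Set.Icc (0 : ℝ) T, ∀ θ : ℝ, gradNorm v t θ ≤ b) →
      ∀ δt : ℝ, δt < δ₁ →
      (∀ t ∈ Set.Icc (0 : ℝ) (T - 1),
        cylInt (Adens f (fun t θ => -(m : ℝ) * t + v t θ)) t (t + 1) ≤ δt) →
      ∀ t ∈ Set.Icc (0 : ℝ) (T - 1),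
        cylInt (Adens f (fun t θ => -(m : ℝ) * t + v t θ)) t (t + 1)
          ≤ C * δt * (Real.exp (-q * t) + Real.exp (-q * (T - t))) := by
  obtain ⟨δ₁, hδ₁, B, hB, key⟩ := weighted_strip_estimate (n := n) hq0 hq2 m hm
  refine ⟨δ₁, hδ₁, exp (5 * q) + 2 * exp (5 * q) * B, by positivity, ?_⟩
  intro T hT f v hW hτ₁ hτ₂ hv δt hδt hwin t ht
  obtain ⟨b, hb, hv⟩ := hv
  set u : ℝ → ℝ → ℝ := fun t θ => -(m : ℝ) * t + v t θ with hu_def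
  have hf := hW.1.s2f
  have hu := hW.1.s2u
  have cA := (smooth2_Adens hf hu).cont
  have hA : ∀ t, 0 ≤ circInt (Adens f u) t := fun t => circInt_nonneg fun θ => Adens_nonneg t θ
  have hwin' : ∀ t ∈ Icc (0 : ℝ) (T - 1), stripInt (Adens f u) t (t + 1) ≤ δt := fun t ht => by
    rw [← cylInt_eq_stripInt cA (by linarith)]; exact hwin t ht
  have hδ0 : 0 ≤ δt := (stripInt_nonneg (by linarith) Adens_nonneg).trans (hwin' t ht)
  rw [cylInt_eq_stripInt cA (by linarith)]
  have hX : 0 < exp (-q * t) := exp_pos _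
  have hY : 0 < exp (-q * (T - t)) := exp_pos _
  have hE : 0 ≤ 2 * exp (5 * q) * B * δt * (exp (-q * t) + exp (-q * (T - t))) := by positivity
  have triv : 1 ≤ exp (5 * q) * (exp (-q * t) + exp (-q * (T - t))) →
      stripInt (Adens f u) t (t + 1) ≤ (exp (5 * q) + 2 * exp (5 * q) * B) * δt *
        (exp (-q * t) + exp (-q * (T - t))) := fun h => by
    nlinarith [mul_le_mul_of_nonneg_left h hδ0, hwin' t ht]
  rcases lt_or_ge t 3 with h3 | h3
  · refine triv ?_
    have : 1 ≤ exp (5 * q) * exp (-q * t) := by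
      rw [← exp_add]; exact one_le_exp (by nlinarith)
    nlinarith [exp_pos (5 * q)]
  rcases lt_or_ge (T - t) 5 with h5 | h5
  · refine triv ?_
    have : 1 ≤ exp (5 * q) * exp (-q * (T - t)) := by
      rw [← exp_add]; exact one_le_exp (by nlinarith)
    nlinarith [exp_pos (5 * q)]
  obtain ⟨l, hl⟩ : ∃ l : ℕ, ⌊T⌋₊ = l + 4 := by
    have : 8 ≤ ⌊T⌋₊ := Nat.le_floor (by push_cast; linarith)
    exact ⟨⌊T⌋₊ - 4, by omega⟩
  have hl1 : (l : ℝ) + 4 ≤ T := by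
    have := Nat.floor_le (by linarith : 0 ≤ T); rw [hl] at this; exact_mod_cast this
  have hl2 : T < l + 5 := by
    have := Nat.lt_floor_add_one T; rw [hl] at this; push_cast at this; linarith
  have hl3 : 2 ≤ l := by
    have : (2 : ℝ) < l := by linarith
    exact_mod_cast this.le
  have hIcc : ∀ t ∈ Icc (1 : ℝ) (l + 3), t ∈ Icc 0 T := fun t ht =>
    ⟨by linarith [ht.1], by linarith [ht.2]⟩
  have hpt : ∀ t θ, pt u t θ + m = pt v t θ := fun t θ => by
    have h1 := (hu.dt t θ).add (((hasDerivAt_id t).const_mul (m : ℝ)))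
    have h2 : HasDerivAt (fun s => v s θ) (pt u t θ + m * 1) t :=
      h1.congr_of_eventuallyEq (Eventually.of_forall fun s => by simp [hu_def])
    rw [← mul_one (m : ℝ)]
    exact h2.deriv.symm
  have hpth : ∀ t θ, pth u t θ = pth v t θ := fun t θ => by
    have h1 := (hu.dth t θ).add_const ((m : ℝ) * t)
    have h2 : HasDerivAt (fun s => v t s) (pth u t θ) θ :=
      h1.congr_of_eventuallyEq (Eventually.of_forall fun s => by simp [hu_def])
    exact h2.deriv.symm
  have hthree : ∀ j : ℕ, 1 ≤ j → j ≤ l → stripInt (Adens f u) j (j + 3) ≤ 3 * δt := fun j _ h2 => by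
    have hj : (j : ℝ) ≤ l := by exact_mod_cast h2
    have hj0 : (0 : ℝ) ≤ j := j.cast_nonneg
    have i1 := hwin' j ⟨hj0, by linarith⟩
    have i2 := hwin' (j + 1) ⟨by linarith, by linarith⟩
    have i3 := hwin' (j + 2) ⟨by linarith, by linarith⟩
    have hi : ∀ x y, IntervalIntegrable (circInt (Adens f u)) volume x y := fun x y =>
      cA.circInt.intervalIntegrable _ _
    unfold stripInt at *
    rw [← intervalIntegral.integral_add_adjacent_intervals (hi _ (j + 2)) (hi _ _),
      ← intervalIntegral.integral_add_adjacent_intervals (hi _ (j + 1)) (hi _ _)]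
    ring_nf at *
    linarith
  have main := decay_of_weight hq0 hδ0 hB cA.circInt hA h3 (by linarith : t ≤ l) hl2.le
    fun ω ω' h1 h2 h3 h4 h5 => key f u (Icc 0 T) l δt b ω ω' hl3 hδ0 hδt hb hW
      (fun t ht => Icc_mem_nhds (by linarith [ht.1]) (by linarith [ht.2]))
      (fun t ht θ => (hpt t θ).symm ▸ (abs_le_sqrt (by nlinarith)).trans (hv t (hIcc t ht) θ))
      (fun t ht θ => (hpth t θ).symm ▸ (abs_le_sqrt (by nlinarith)).trans (hv t (hIcc t ht) θ))
      (fun t ht => hτ₁ t (hIcc t ht)) (fun t ht => hτ₂ t (hIcc t ht)) hthree h1 h2 h3 h4 h5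
  have : 0 ≤ exp (5 * q) * δt * (exp (-q * t) + exp (-q * (T - t))) := by positivity
  refine main.trans ?_
  linarith
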